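/- Let m₁(ξ,η) = ξ³/(|ξ|³ + |ξ|η² + η²) and m₂(ξ,η) = ξ²η/(|ξ|³ + |ξ|η² + η²) (defined for (ξ,η) ≠ (0,0)). For every 1 < p < ∞ there exists a constant C_p such that for every Schwartz function f on ℝ² and i ∈ {1,2}, the function gᵢ with Fourier transform ĝᵢ = mᵢ · f̂ satisfies ‖gᵢ‖_{L^p(ℝ²)} ≤ C_p ‖f‖_{L^p(ℝ²)}; that is, m₁ and m₂ are L^p Fourier multipliers on ℝ². -/

import Mathlib

open MeasureTheory Real Filter Topology SchwartzMap ENNReal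
noncomputable section
namespace Paper

/-- The Fourier integral of a function on `ℝ²` (explicit formula). -/
def FT (f : ℝ × ℝ → ℂ) (ξ : ℝ × ℝ) : ℂ :=
  ∫ x : ℝ × ℝ, Complex.exp (-(2 * Real.pi * (x.1 * ξ.1 + x.2 * ξ.2)) * Complex.I) * f x

/-- The inverse Fourier integral of a function on `ℝ²`. -/
def invFT (f : ℝ × ℝ → ℂ) (x : ℝ × ℝ) : ℂ :=
  ∫ ξ : ℝ × ℝ, Complex.exp ((2 * Real.pi * (x.1 * ξ.1 + x.2 * ξ.2)) * Complex.I) * f ξ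

/-- The multiplier `m₁(ξ,η) = ξ³/(|ξ|³ + |ξ|η² + η²)`. -/
def m₁ (ξ : ℝ × ℝ) : ℝ := ξ.1 ^ 3 / (|ξ.1| ^ 3 + |ξ.1| * ξ.2 ^ 2 + ξ.2 ^ 2)

/-- The multiplier `m₂(ξ,η) = ξ²η/(|ξ|³ + |ξ|η² + η²)`. -/
def m₂ (ξ : ℝ × ℝ) : ℝ := ξ.1 ^ 2 * ξ.2 / (|ξ.1| ^ 3 + |ξ.1| * ξ.2 ^ 2 + ξ.2 ^ 2)

/-- The character. -/
def ek (z ζ : ℝ × ℝ) : ℂ :=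
  Complex.exp ((2 * Real.pi * (z.1 * ζ.1 + z.2 * ζ.2)) * Complex.I)

lemma ek_norm (z ζ : ℝ × ℝ) : ‖ek z ζ‖ = 1 := by
  have : ek z ζ = Complex.exp (((2 * Real.pi * (z.1 * ζ.1 + z.2 * ζ.2) : ℝ) : ℂ) * Complex.I) := by
    simp [ek]
  rw [this, Complex.norm_exp_ofReal_mul_I]

lemma ek_symm (z ζ : ℝ × ℝ) : ek z ζ = ek ζ z := by
  unfold ek; congr 1; ring

lemma ek_neg_left (z ζ : ℝ × ℝ) : ek (-z) ζ = ek z (-ζ) := by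
  unfold ek; congr 1; simp

lemma ek_sub (z w ζ : ℝ × ℝ) : ek (z - w) ζ = ek z ζ * ek (-w) ζ := by
  unfold ek; rw [← Complex.exp_add]; congr 1; simp; ring

lemma ek_conj (z ζ : ℝ × ℝ) : (starRingEnd ℂ) (ek z ζ) = ek (-z) ζ := by
  unfold ek; rw [← Complex.exp_conj]; congr 1; simp [Complex.conj_ofReal, map_ofNat]; ring

lemma ek_cont : Continuous (fun p : (ℝ × ℝ) × (ℝ × ℝ) => ek p.1 p.2) := by
  unfold ek; fun_prop

lemma ek_cont_left (ζ : ℝ × ℝ) : Continuous (fun z => ek z ζ) := by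
  unfold ek; fun_prop

lemma ek_cont_right (z : ℝ × ℝ) : Continuous (fun ζ => ek z ζ) := by
  unfold ek; fun_prop

lemma invFT_eq (f : ℝ × ℝ → ℂ) (x : ℝ × ℝ) : invFT f x = ∫ ξ, ek x ξ * f ξ := rfl

lemma FT_eq (f : ℝ × ℝ → ℂ) (ξ : ℝ × ℝ) : FT f ξ = ∫ x, ek (-x) ξ * f x := by
  unfold FT ek; congr 1; ext x; congr 2; simp; ring

lemma FT_eq_invFT (f : ℝ × ℝ → ℂ) (ξ : ℝ × ℝ) : FT f ξ = invFT f (-ξ) := by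
  rw [FT_eq, invFT_eq]; congr 1; ext x; rw [ek_symm (-ξ), ek_neg_left]

lemma integrable_ek_mul {f : ℝ × ℝ → ℂ} (hf : Integrable f) (x : ℝ × ℝ) :
    Integrable (fun ξ => ek x ξ * f ξ) := by
  refine hf.bdd_mul (c := 1) (ek_cont_right x).aestronglyMeasurable ?_
  exact Filter.Eventually.of_forall fun ξ => (ek_norm _ _).le

lemma integrable_ek_mul_iff {f : ℝ × ℝ → ℂ} (x : ℝ × ℝ) :
    Integrable (fun ξ => ek x ξ * f ξ) ↔ Integrable f := by
  refine ⟨fun h => ?_, fun h => integrable_ek_mul h x⟩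
  have := integrable_ek_mul h (-x)
  refine this.congr (Filter.Eventually.of_forall fun ξ => ?_)
  show ek (-x) ξ * (ek x ξ * f ξ) = f ξ
  rw [← mul_assoc, ← ek_conj, mul_comm ((starRingEnd ℂ) _), Complex.mul_conj,
    Complex.normSq_eq_norm_sq, ek_norm]; simp

lemma invFT_norm_le (f : ℝ × ℝ → ℂ) (x : ℝ × ℝ) : ‖invFT f x‖ ≤ ∫ ξ, ‖f ξ‖ := by
  rw [invFT_eq]
  refine (norm_integral_le_integral_norm _).trans (le_of_eq ?_)
  congr 1; ext ξ; rw [norm_mul, ek_norm, one_mul]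

lemma invFT_continuous {f : ℝ × ℝ → ℂ} (hf : Integrable f) : Continuous (invFT f) := by
  show Continuous (fun x => ∫ ξ, ek x ξ * f ξ)
  refine continuous_of_dominated (bound := fun ξ => ‖f ξ‖) ?_ ?_ hf.norm ?_
  · intro x; exact (integrable_ek_mul hf x).aestronglyMeasurable
  · intro x; exact Filter.Eventually.of_forall fun ξ => by rw [norm_mul, ek_norm, one_mul]
  · exact Filter.Eventually.of_forall fun ξ => (ek_cont_left ξ).mul continuous_const

lemma gauss1 {ε : ℝ} (hε : 0 < ε) (x : ℝ) :
    ∫ η : ℝ, Complex.exp ((2 * Real.pi * (x * η)) * Complex.I) * ((Real.exp (-(ε * η ^ 2)) : ℝ) : ℂ)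
      = ((√(π / ε) * Real.exp (-(π ^ 2 * x ^ 2 / ε)) : ℝ) : ℂ) := by
  have h := fourierIntegral_gaussian (b := (ε : ℂ)) (by simpa using hε) (2 * π * x : ℂ)
  have h2 : ((π : ℂ) / ε) ^ (1 / 2 : ℂ) = ((√(π / ε) : ℝ) : ℂ) := by
    rw [Real.sqrt_eq_rpow, Complex.ofReal_cpow (by positivity)]; simp
  rw [h2] at h
  push_cast
  convert h using 2
  · ext η; congr 2
    · ring
    · ring
  · congr 1; field_simp; ring

/-- two dimensional Gaussian kernel -/
lemma gauss2 {ε : ℝ} (hε : 0 < ε) (z : ℝ × ℝ) :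
    ∫ ζ : ℝ × ℝ, ek z ζ * ((Real.exp (-(ε * ζ.1 ^ 2)) * Real.exp (-(ε * ζ.2 ^ 2)) : ℝ) : ℂ)
      = (((√(π / ε) * Real.exp (-(π ^ 2 * z.1 ^ 2 / ε))) *
        (√(π / ε) * Real.exp (-(π ^ 2 * z.2 ^ 2 / ε))) : ℝ) : ℂ) := by
  rw [Complex.ofReal_mul, ← gauss1 hε, ← gauss1 hε, ← integral_prod_mul]
  congr 1; ext ζ
  push_cast
  unfold ek
  rw [mul_add, add_mul, Complex.exp_add]; ring

lemma lintegral_gauss1 {ε : ℝ} (hε : 0 < ε) :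
    ∫⁻ x : ℝ, ENNReal.ofReal (√(π / ε) * Real.exp (-(π ^ 2 * x ^ 2 / ε))) = 1 := by
  have e : (fun x : ℝ => √(π / ε) * Real.exp (-(π ^ 2 * x ^ 2 / ε)))
      = fun x : ℝ => √(π / ε) * Real.exp (-(π ^ 2 / ε) * x ^ 2) := by
    ext x; congr 2; ring
  rw [← ofReal_integral_eq_lintegral_ofReal, e, integral_const_mul, integral_gaussian,
    ← Real.sqrt_mul (by positivity)]
  · have : π / ε * (π / (π ^ 2 / ε)) = 1 := by field_simp
    rw [this]; simp
  · rw [e]; exact (integrable_exp_neg_mul_sq (by positivity)).const_mul _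
  · exact Filter.Eventually.of_forall fun x => by positivity

lemma lintegral_gauss2 {ε : ℝ} (hε : 0 < ε) :
    ∫⁻ z : ℝ × ℝ, ENNReal.ofReal ((√(π / ε) * Real.exp (-(π ^ 2 * z.1 ^ 2 / ε))) *
        (√(π / ε) * Real.exp (-(π ^ 2 * z.2 ^ 2 / ε)))) = 1 := by
  have : ∀ z : ℝ × ℝ, ENNReal.ofReal ((√(π / ε) * Real.exp (-(π ^ 2 * z.1 ^ 2 / ε))) *
        (√(π / ε) * Real.exp (-(π ^ 2 * z.2 ^ 2 / ε)))) =
      ENNReal.ofReal (√(π / ε) * Real.exp (-(π ^ 2 * z.1 ^ 2 / ε))) *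
       ENNReal.ofReal (√(π / ε) * Real.exp (-(π ^ 2 * z.2 ^ 2 / ε))) := fun z =>
    ENNReal.ofReal_mul (by positivity)
  simp_rw [this]
  rw [Measure.volume_eq_prod, lintegral_prod_mul (f := fun x : ℝ => ENNReal.ofReal (√(π / ε) * Real.exp (-(π ^ 2 * x ^ 2 / ε))))
    (g := fun x : ℝ => ENNReal.ofReal (√(π / ε) * Real.exp (-(π ^ 2 * x ^ 2 / ε)))) (by fun_prop) (by fun_prop), lintegral_gauss1 hε]; simp


lemma plancherel_gauss {f : ℝ × ℝ → ℂ} (hf : Integrable f) {ε : ℝ} (hε : 0 < ε) :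
    ∫⁻ ζ : ℝ × ℝ, ‖invFT f ζ‖ₑ ^ 2 *
      ENNReal.ofReal (Real.exp (-(ε * ζ.1 ^ 2)) * Real.exp (-(ε * ζ.2 ^ 2))) ≤
      ∫⁻ z, ‖f z‖ₑ ^ 2 := by
  set G : ℝ × ℝ → ℝ := fun ζ => Real.exp (-(ε * ζ.1 ^ 2)) * Real.exp (-(ε * ζ.2 ^ 2)) with hG
  set γ : ℝ × ℝ → ℝ := fun z => (√(π / ε) * Real.exp (-(π ^ 2 * z.1 ^ 2 / ε))) *
        (√(π / ε) * Real.exp (-(π ^ 2 * z.2 ^ 2 / ε))) with hγ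
  have hG0 : ∀ ζ, 0 ≤ G ζ := fun ζ => by positivity
  have hGi : Integrable G := by
    have h1 : Integrable (fun x : ℝ => Real.exp (-(ε * x ^ 2))) := by
      simpa [neg_mul] using integrable_exp_neg_mul_sq hε
    exact h1.mul_prod h1
  have hγ0 : ∀ z, 0 ≤ γ z := fun z => by positivity
  have hγm : Measurable γ := by fun_prop
  have hc : Continuous (invFT f) := invFT_continuous hf
  have hI : Integrable (fun ζ => ‖invFT f ζ‖ ^ 2 * G ζ) := by
    refine hGi.bdd_mul (c := (∫ ξ, ‖f ξ‖) ^ 2) (by fun_prop) ?_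
    refine Filter.Eventually.of_forall fun ζ => ?_
    rw [norm_pow, norm_norm]
    exact pow_le_pow_left₀ (norm_nonneg _) (invFT_norm_le f ζ) 2
  -- the triple integral
  have hff : Integrable (fun q : (ℝ × ℝ) × (ℝ × ℝ) => f q.1 * (starRingEnd ℂ) (f q.2)) :=
    hf.mul_prod (Complex.conjCLE.toContinuousLinearMap.integrable_comp hf)
  have hsq : ∀ ζ, ((‖invFT f ζ‖ ^ 2 * G ζ : ℝ) : ℂ) =
      ∫ q : (ℝ × ℝ) × (ℝ × ℝ), (ek (q.1 - q.2) ζ * (f q.1 * (starRingEnd ℂ) (f q.2))) * (G ζ : ℂ) := by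
    intro ζ
    rw [integral_mul_const, Complex.ofReal_mul]
    congr 1
    have : ∀ q : (ℝ × ℝ) × (ℝ × ℝ), ek (q.1 - q.2) ζ * (f q.1 * (starRingEnd ℂ) (f q.2)) =
        (ek ζ q.1 * f q.1) * ((starRingEnd ℂ) (ek ζ q.2 * f q.2)) := by
      intro q
      rw [ek_sub, map_mul, ek_conj, ek_symm ζ q.1, ek_neg_left ζ, ek_symm ζ]; ring
    simp_rw [this]
    rw [Measure.volume_eq_prod, integral_prod_mul (fun z => ek ζ z * f z)
      (fun w => (starRingEnd ℂ) (ek ζ w * f w)), integral_conj, ← invFT_eq, Complex.mul_conj,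
      Complex.normSq_eq_norm_sq]
  have key : ((∫ ζ, ‖invFT f ζ‖ ^ 2 * G ζ : ℝ) : ℂ) =
      ∫ q : (ℝ × ℝ) × (ℝ × ℝ), (f q.1 * (starRingEnd ℂ) (f q.2)) * (γ (q.1 - q.2) : ℂ) := by
    rw [← integral_complex_ofReal]
    simp_rw [hsq]
    rw [integral_integral_swap]
    · congr 1; ext q
      rw [hγ, ← gauss2 hε, ← integral_const_mul]
      congr 1; ext ζ; simp only [hG]; ring
    · have h1 : Integrable (fun p : (ℝ × ℝ) × ((ℝ × ℝ) × (ℝ × ℝ)) =>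
          (G p.1 : ℂ) * (f p.2.1 * (starRingEnd ℂ) (f p.2.2))) := by
        exact (hGi.ofReal (𝕜 := ℂ)).mul_prod hff
      have h2 := h1.bdd_mul (c := 1) (f := fun p : (ℝ × ℝ) × ((ℝ × ℝ) × (ℝ × ℝ)) =>
        ek (p.2.1 - p.2.2) p.1) (by unfold ek; fun_prop)
        (Filter.Eventually.of_forall fun p => (ek_norm _ _).le)
      refine h2.congr (Filter.Eventually.of_forall fun p => ?_)
      simp only [Function.uncurry]; ring
  have e1 : ∫⁻ ζ : ℝ × ℝ, ‖invFT f ζ‖ₑ ^ 2 * ENNReal.ofReal (G ζ) =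
      ENNReal.ofReal (∫ ζ, ‖invFT f ζ‖ ^ 2 * G ζ) := by
    rw [ofReal_integral_eq_lintegral_ofReal hI
      (Filter.Eventually.of_forall fun ζ => mul_nonneg (by positivity) (hG0 ζ))]
    congr 1; ext ζ
    rw [ENNReal.ofReal_mul (p := ‖invFT f ζ‖ ^ 2) (by positivity), ENNReal.ofReal_pow (norm_nonneg _), ofReal_norm]
  have e2 : ENNReal.ofReal (∫ ζ, ‖invFT f ζ‖ ^ 2 * G ζ) ≤
      ∫⁻ q : (ℝ × ℝ) × (ℝ × ℝ), ‖f q.1‖ₑ * ‖f q.2‖ₑ * ENNReal.ofReal (γ (q.1 - q.2)) := by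
    have : ENNReal.ofReal (∫ ζ, ‖invFT f ζ‖ ^ 2 * G ζ) ≤
      ‖((∫ ζ, ‖invFT f ζ‖ ^ 2 * G ζ : ℝ) : ℂ)‖ₑ := by
      rw [← ofReal_norm, Complex.norm_real]
      exact ENNReal.ofReal_le_ofReal (le_abs_self _)
    refine this.trans ?_
    rw [key]
    refine (enorm_integral_le_lintegral_enorm _).trans (le_of_eq ?_)
    congr 1; ext q
    rw [enorm_mul, enorm_mul]
    congr 2
    · rw [← ofReal_norm, ← ofReal_norm]; simp
    · rw [← ofReal_norm, Complex.norm_real, Real.norm_of_nonneg (hγ0 _)]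
  have hfm : AEMeasurable (fun z => ‖f z‖ₑ ^ 2) := hf.aestronglyMeasurable.enorm.pow_const 2
  have e3 : ∫⁻ q : (ℝ × ℝ) × (ℝ × ℝ), ‖f q.1‖ₑ * ‖f q.2‖ₑ * ENNReal.ofReal (γ (q.1 - q.2)) ≤
     ∫⁻ q : (ℝ × ℝ) × (ℝ × ℝ), (2⁻¹ * (‖f q.1‖ₑ ^ 2 * ENNReal.ofReal (γ (q.1 - q.2))) +
       2⁻¹ * (‖f q.2‖ₑ ^ 2 * ENNReal.ofReal (γ (q.1 - q.2)))) := by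
    refine lintegral_mono fun q => ?_
    have : ‖f q.1‖ₑ * ‖f q.2‖ₑ ≤ 2⁻¹ * ‖f q.1‖ₑ ^ 2 + 2⁻¹ * ‖f q.2‖ₑ ^ 2 := by
      rw [← ofReal_norm, ← ofReal_norm, ← ENNReal.ofReal_pow (norm_nonneg _),
        ← ENNReal.ofReal_pow (norm_nonneg _), ← ENNReal.ofReal_mul (norm_nonneg _)]
      have h2 : (2⁻¹ : ENNReal) = ENNReal.ofReal (2⁻¹) := by
        rw [ENNReal.ofReal_inv_of_pos (by norm_num)]; simp
      rw [h2, ← ENNReal.ofReal_mul (by norm_num), ← ENNReal.ofReal_mul (by norm_num),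
        ← ENNReal.ofReal_add (by positivity) (by positivity)]
      refine ENNReal.ofReal_le_ofReal ?_
      nlinarith [sq_nonneg (‖f q.1‖ - ‖f q.2‖)]
    calc _ ≤ (2⁻¹ * ‖f q.1‖ₑ ^ 2 + 2⁻¹ * ‖f q.2‖ₑ ^ 2) * ENNReal.ofReal (γ (q.1 - q.2)) := by gcongr
      _ = _ := by ring
  have hq1 : AEMeasurable (fun q : (ℝ × ℝ) × (ℝ × ℝ) => ‖f q.1‖ₑ ^ 2 * ENNReal.ofReal (γ (q.1 - q.2)))
      (volume.prod volume) :=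
    (hfm.comp_quasiMeasurePreserving Measure.quasiMeasurePreserving_fst).mul (by fun_prop)
  have hq2 : AEMeasurable (fun q : (ℝ × ℝ) × (ℝ × ℝ) => ‖f q.2‖ₑ ^ 2 * ENNReal.ofReal (γ (q.1 - q.2)))
      (volume.prod volume) :=
    (hfm.comp_quasiMeasurePreserving Measure.quasiMeasurePreserving_snd).mul (by fun_prop)
  have i1 : ∫⁻ q : (ℝ × ℝ) × (ℝ × ℝ), ‖f q.1‖ₑ ^ 2 * ENNReal.ofReal (γ (q.1 - q.2)) =
      ∫⁻ z, ‖f z‖ₑ ^ 2 := by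
    rw [Measure.volume_eq_prod, lintegral_prod _ hq1]
    congr 1; ext z
    dsimp only
    rw [lintegral_const_mul _ (by fun_prop), lintegral_sub_left_eq_self (fun w => ENNReal.ofReal (γ w)),
      lintegral_gauss2 hε, mul_one]
  have i2 : ∫⁻ q : (ℝ × ℝ) × (ℝ × ℝ), ‖f q.2‖ₑ ^ 2 * ENNReal.ofReal (γ (q.1 - q.2)) =
      ∫⁻ z, ‖f z‖ₑ ^ 2 := by
    rw [Measure.volume_eq_prod, lintegral_prod_symm _ hq2]
    congr 1; ext z
    dsimp only
    rw [lintegral_const_mul _ (by fun_prop), lintegral_sub_right_eq_self (fun w => ENNReal.ofReal (γ w)),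
      lintegral_gauss2 hε, mul_one]
  rw [e1]
  refine e2.trans (e3.trans (le_of_eq ?_))
  rw [Measure.volume_eq_prod] at i1 i2 ⊢
  rw [lintegral_add_left' (hq1.const_mul _), lintegral_const_mul'' _ hq1, lintegral_const_mul'' _ hq2,
    i1, i2, ← add_mul, ENNReal.inv_two_add_inv_two, one_mul]

lemma plancherel_invFT {f : ℝ × ℝ → ℂ} (hf : Integrable f) :
    ∫⁻ ζ, ‖invFT f ζ‖ₑ ^ 2 ≤ ∫⁻ z, ‖f z‖ₑ ^ 2 := by
  have hc : Continuous (invFT f) := invFT_continuous hf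
  have hlim : ∀ ζ : ℝ × ℝ, Tendsto (fun n : ℕ => ‖invFT f ζ‖ₑ ^ 2 *
      ENNReal.ofReal (Real.exp (-((1 / ((n : ℝ) + 1)) * ζ.1 ^ 2)) *
        Real.exp (-((1 / ((n : ℝ) + 1)) * ζ.2 ^ 2)))) atTop (𝓝 (‖invFT f ζ‖ₑ ^ 2)) := by
    intro ζ
    have h0 := tendsto_one_div_add_atTop_nhds_zero_nat (𝕜 := ℝ)
    have h1 : Tendsto (fun n : ℕ => (Real.exp (-((1 / ((n : ℝ) + 1)) * ζ.1 ^ 2)) *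
        Real.exp (-((1 / ((n : ℝ) + 1)) * ζ.2 ^ 2)))) atTop (𝓝 (Real.exp (-(0 * ζ.1 ^ 2)) *
        Real.exp (-(0 * ζ.2 ^ 2)))) := by
      have hcc : Continuous (fun s : ℝ => Real.exp (-(s * ζ.1 ^ 2)) * Real.exp (-(s * ζ.2 ^ 2))) := by
        fun_prop
      exact (hcc.tendsto 0).comp h0
    have h2 := ENNReal.Tendsto.const_mul (a := ‖invFT f ζ‖ₑ ^ 2) (ENNReal.tendsto_ofReal h1)
      (Or.inl (by simp))
    simpa using h2
  calc ∫⁻ ζ, ‖invFT f ζ‖ₑ ^ 2 = ∫⁻ ζ : ℝ × ℝ, liminf (fun n : ℕ => ‖invFT f ζ‖ₑ ^ 2 *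
      ENNReal.ofReal (Real.exp (-((1 / ((n : ℝ) + 1)) * ζ.1 ^ 2)) *
        Real.exp (-((1 / ((n : ℝ) + 1)) * ζ.2 ^ 2)))) atTop := by
        congr 1; ext ζ; exact (hlim ζ).liminf_eq.symm
    _ ≤ liminf (fun n : ℕ => ∫⁻ ζ : ℝ × ℝ, ‖invFT f ζ‖ₑ ^ 2 *
      ENNReal.ofReal (Real.exp (-((1 / ((n : ℝ) + 1)) * ζ.1 ^ 2)) *
        Real.exp (-((1 / ((n : ℝ) + 1)) * ζ.2 ^ 2)))) atTop := by
        refine lintegral_liminf_le' fun n => ?_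
        fun_prop
    _ ≤ _ := by
        refine liminf_le_of_le (by isBoundedDefault) fun b hb => ?_
        obtain ⟨n, hn⟩ := hb.exists
        exact hn.trans (plancherel_gauss hf (by positivity))

lemma plancherel_FT {f : ℝ × ℝ → ℂ} (hf : Integrable f) :
    ∫⁻ ζ, ‖FT f ζ‖ₑ ^ 2 ≤ ∫⁻ z, ‖f z‖ₑ ^ 2 := by
  refine le_trans (le_of_eq ?_) (plancherel_invFT hf)
  simp_rw [FT_eq_invFT]
  exact lintegral_neg_eq_self (fun ζ => ‖invFT f ζ‖ₑ ^ 2)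

/-- Convolution operator. -/
def Tc (K f : ℝ × ℝ → ℂ) (z : ℝ × ℝ) : ℂ := ∫ w, K (z - w) * f w

lemma FT_norm_le (f : ℝ × ℝ → ℂ) (x : ℝ × ℝ) : ‖FT f x‖ ≤ ∫ ξ, ‖f ξ‖ := by
  rw [FT_eq_invFT]; exact invFT_norm_le _ _

lemma FT_continuous {f : ℝ × ℝ → ℂ} (hf : Integrable f) : Continuous (FT f) := by
  have : FT f = fun ξ => invFT f (-ξ) := by ext ξ; exact FT_eq_invFT f ξ
  rw [this]; exact (invFT_continuous hf).comp continuous_neg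

lemma mul_FT_integrable {M f : ℝ × ℝ → ℂ} (hM : Integrable M) (hf : Integrable f) :
    Integrable (fun ζ => M ζ * FT f ζ) := by
  have := hM.bdd_mul (c := ∫ ξ, ‖f ξ‖) (FT_continuous hf).aestronglyMeasurable
    (Filter.Eventually.of_forall fun ζ => FT_norm_le f ζ)
  simpa only [mul_comm] using this

lemma Tc_eq {M f : ℝ × ℝ → ℂ} (hM : Integrable M) (hf : Integrable f) (z : ℝ × ℝ) :
    Tc (invFT M) f z = invFT (fun ζ => M ζ * FT f ζ) z := by
  unfold Tc
  rw [invFT_eq]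
  have h1 : ∀ w, invFT M (z - w) * f w = ∫ ζ, ek (z - w) ζ * M ζ * f w := by
    intro w; rw [integral_mul_const, invFT_eq]
  have h2 : ∀ ζ, ek z ζ * (M ζ * FT f ζ) = ∫ w, ek (z - w) ζ * M ζ * f w := by
    intro ζ
    rw [FT_eq, ← integral_const_mul, ← integral_const_mul]
    congr 1; ext w; rw [ek_sub]; ring
  simp_rw [h1, h2]
  rw [integral_integral_swap]
  have h3 : Integrable (fun p : (ℝ × ℝ) × (ℝ × ℝ) => f p.1 * M p.2) := hf.mul_prod hM
  have h4 := h3.bdd_mul (c := 1) (f := fun p : (ℝ × ℝ) × (ℝ × ℝ) => ek (z - p.1) p.2)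
    (by unfold ek; fun_prop) (Filter.Eventually.of_forall fun p => (ek_norm _ _).le)
  refine h4.congr (Filter.Eventually.of_forall fun p => ?_)
  simp only [Function.uncurry]; ring

lemma Tc_L2 {M f : ℝ × ℝ → ℂ} (hM : Integrable M) (hM1 : ∀ ζ, ‖M ζ‖ ≤ 1) (hf : Integrable f) :
    ∫⁻ z, ‖Tc (invFT M) f z‖ₑ ^ 2 ≤ ∫⁻ z, ‖f z‖ₑ ^ 2 := by
  simp_rw [Tc_eq hM hf]
  refine (plancherel_invFT (mul_FT_integrable hM hf)).trans
    (le_trans (lintegral_mono fun ζ => ?_) (plancherel_FT hf))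
  gcongr
  rw [enorm_mul]
  have : ‖M ζ‖ₑ ≤ 1 := by
    rw [← ofReal_norm]; simpa using ENNReal.ofReal_le_ofReal (hM1 ζ)
  calc _ ≤ 1 * ‖FT f ζ‖ₑ := by gcongr
    _ = _ := one_mul _

/-- standing assumptions on kernels -/
structure KerOK (K : ℝ × ℝ → ℂ) : Prop where
  cont : Continuous K
  int : Integrable K
  bdd : ∃ κ : ℝ, ∀ z, ‖K z‖ ≤ κ

lemma KerOK.mul_int {K : ℝ × ℝ → ℂ} (hK : KerOK K) {f : ℝ × ℝ → ℂ} (hf : Integrable f)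
    (z : ℝ × ℝ) : Integrable (fun w => K (z - w) * f w) := by
  obtain ⟨κ, hκ⟩ := hK.bdd
  refine hf.bdd_mul (c := κ) ?_ (Filter.Eventually.of_forall fun w => hκ _)
  exact (hK.cont.comp (continuous_const.sub continuous_id)).aestronglyMeasurable

lemma KerOK.Tc_cont {K : ℝ × ℝ → ℂ} (hK : KerOK K) {f : ℝ × ℝ → ℂ} (hf : Integrable f) :
    Continuous (Tc K f) := by
  obtain ⟨κ, hκ⟩ := hK.bdd
  unfold Tc
  refine continuous_of_dominated (bound := fun w => κ * ‖f w‖) ?_ ?_ (hf.norm.const_mul κ) ?_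
  · intro z; exact (hK.mul_int hf z).aestronglyMeasurable
  · intro z; refine Filter.Eventually.of_forall fun w => ?_
    rw [norm_mul]; gcongr; exact hκ _
  · exact Filter.Eventually.of_forall fun w =>
      (hK.cont.comp (continuous_id.sub continuous_const)).mul continuous_const

lemma KerOK.Tc_bdd {K : ℝ × ℝ → ℂ} (hK : KerOK K) {f : ℝ × ℝ → ℂ} (hf : Integrable f) :
    ∃ κ : ℝ, ∀ z, ‖Tc K f z‖ ≤ κ := by
  obtain ⟨κ, hκ⟩ := hK.bdd
  refine ⟨∫ w, κ * ‖f w‖, fun z => ?_⟩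
  refine norm_integral_le_of_norm_le (hf.norm.const_mul κ) (Filter.Eventually.of_forall fun w => ?_)
  rw [norm_mul]; gcongr; exact hκ _

lemma KerOK.prod_int {K : ℝ × ℝ → ℂ} (hK : KerOK K) {f : ℝ × ℝ → ℂ} (hf : Integrable f) :
    Integrable (fun p : (ℝ × ℝ) × (ℝ × ℝ) => K (p.1 - p.2) * f p.2) (volume.prod volume) := by
  have := hf.convolution_integrand (ContinuousLinearMap.mul ℝ ℂ) hK.int
  simpa [mul_comm] using this

lemma KerOK.Tc_int {K : ℝ × ℝ → ℂ} (hK : KerOK K) {f : ℝ × ℝ → ℂ} (hf : Integrable f) :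
    Integrable (Tc K f) := (hK.prod_int hf).integral_prod_left

lemma KerOK.Tc_add {K : ℝ × ℝ → ℂ} (hK : KerOK K) {f g : ℝ × ℝ → ℂ} (hf : Integrable f)
    (hg : Integrable g) (z : ℝ × ℝ) : Tc K (fun w => f w + g w) z = Tc K f z + Tc K g z := by
  unfold Tc
  rw [← integral_add (hK.mul_int hf z) (hK.mul_int hg z)]
  congr 1; ext w; ring

/-- horizontal side length -/
def sx (j : ℤ) : ℝ := (4 : ℝ) ^ j
/-- vertical side length -/
def sy (j : ℤ) : ℝ := if 0 ≤ j then (8 : ℝ) ^ j else (4 : ℝ) ^ j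

lemma sx_pos (j : ℤ) : 0 < sx j := by unfold sx; positivity
lemma sy_pos (j : ℤ) : 0 < sy j := by unfold sy; split_ifs <;> positivity

lemma sx_succ (j : ℤ) : sx (j + 1) = sx j * ((4 : ℕ) : ℝ) := by
  unfold sx; rw [zpow_add_one₀ (by norm_num)]; norm_num

lemma sy_succ (j : ℤ) : ∃ n : ℕ, n ≤ 8 ∧ sy (j + 1) = sy j * (n : ℝ) := by
  unfold sy
  by_cases h : 0 ≤ j
  · refine ⟨8, le_rfl, ?_⟩
    rw [if_pos h, if_pos (by omega), zpow_add_one₀ (by norm_num)]; norm_num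
  · refine ⟨4, by norm_num, ?_⟩
    rw [if_neg h]
    by_cases h' : 0 ≤ j + 1
    · have : j = -1 := by omega
      subst this; norm_num
    · rw [if_neg h', zpow_add_one₀ (by norm_num)]; norm_num

/-- the index of the level `j` rectangle holding `z` -/
def idx (j : ℤ) (z : ℝ × ℝ) : ℤ × ℤ × ℤ := (j, ⌊z.1 / sx j⌋, ⌊z.2 / sy j⌋)

/-- The dyadic rectangles. -/
def RR (i : ℤ × ℤ × ℤ) : Set (ℝ × ℝ) := {z | idx i.1 z = i}

lemma mem_RR_idx (j : ℤ) (z : ℝ × ℝ) : z ∈ RR (idx j z) := rfl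

lemma RR_eq (i : ℤ × ℤ × ℤ) : RR i =
    Set.Ico (i.2.1 * sx i.1) ((i.2.1 + 1) * sx i.1) ×ˢ Set.Ico (i.2.2 * sy i.1) ((i.2.2 + 1) * sy i.1) := by
  obtain ⟨j, k, l⟩ := i
  ext z
  simp only [RR, idx, Set.mem_ofPred_eq, Prod.mk.injEq, true_and, Set.mem_prod, Set.mem_Ico,
    Int.floor_eq_iff, le_div_iff₀ (sx_pos j), le_div_iff₀ (sy_pos j), div_lt_iff₀ (sx_pos j),
    div_lt_iff₀ (sy_pos j)]

lemma RR_meas (i : ℤ × ℤ × ℤ) : MeasurableSet (RR i) := by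
  rw [RR_eq]; exact measurableSet_Ico.prod measurableSet_Ico

lemma RR_vol (i : ℤ × ℤ × ℤ) : volume (RR i) = ENNReal.ofReal (sx i.1 * sy i.1) := by
  rw [RR_eq, Measure.volume_eq_prod, Measure.prod_prod, Real.volume_Ico, Real.volume_Ico,
    ← ENNReal.ofReal_mul]
  · congr 1; ring
  · have := sx_pos i.1; nlinarith

lemma RR_vol_ne_zero (i : ℤ × ℤ × ℤ) : volume (RR i) ≠ 0 := by
  rw [RR_vol]; have := mul_pos (sx_pos i.1) (sy_pos i.1); simpa using this

lemma RR_vol_ne_top (i : ℤ × ℤ × ℤ) : volume (RR i) ≠ ∞ := by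
  rw [RR_vol]; exact ENNReal.ofReal_ne_top

/-- lower left corner -/
def corner (i : ℤ × ℤ × ℤ) : ℝ × ℝ := (i.2.1 * sx i.1, i.2.2 * sy i.1)

lemma corner_mem (i : ℤ × ℤ × ℤ) : corner i ∈ RR i := by
  rw [RR_eq]; have h1 := sx_pos i.1; have h2 := sy_pos i.1
  simp only [corner, Set.mem_prod, Set.mem_Ico]
  refine ⟨⟨le_rfl, by nlinarith⟩, le_rfl, by nlinarith⟩

lemma sub_corner {i : ℤ × ℤ × ℤ} {w : ℝ × ℝ} (hw : w ∈ RR i) :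
    |(w - corner i).1| ≤ sx i.1 ∧ |(w - corner i).2| ≤ sy i.1 := by
  rw [RR_eq] at hw
  simp only [Set.mem_prod, Set.mem_Ico] at hw
  simp only [corner, Prod.fst_sub, Prod.snd_sub]
  constructor <;> rw [abs_le] <;> constructor <;> nlinarith [sx_pos i.1, sy_pos i.1]

lemma floor_step {x y s : ℝ} (n : ℕ) (h : ⌊x / s⌋ = ⌊y / s⌋) :
    ⌊x / (s * n)⌋ = ⌊y / (s * n)⌋ := by
  rw [← div_div, ← div_div, Int.floor_div_natCast, Int.floor_div_natCast, h]

lemma idx_step {j : ℤ} {z w : ℝ × ℝ} (h : idx j z = idx j w) : idx (j + 1) z = idx (j + 1) w := by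
  simp only [idx, Prod.mk.injEq, true_and] at h ⊢
  obtain ⟨n, -, hn⟩ := sy_succ j
  rw [sx_succ, hn]
  exact ⟨floor_step 4 h.1, floor_step n h.2⟩

lemma idx_mono {j j' : ℤ} (hj : j ≤ j') {z w : ℝ × ℝ} (h : idx j z = idx j w) :
    idx j' z = idx j' w := by
  induction j', hj using Int.leInduction with
  | base => exact h
  | succ n hn ih => exact idx_step ih

lemma RR_parent_vol (i : ℤ × ℤ × ℤ) (z : ℝ × ℝ) :
    volume (RR (idx (i.1 + 1) z)) ≤ 32 * volume (RR i) := by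
  rw [RR_vol, RR_vol]
  have : (32 : ENNReal) = ENNReal.ofReal 32 := by simp
  rw [this, ← ENNReal.ofReal_mul (by norm_num)]
  refine ENNReal.ofReal_le_ofReal ?_
  obtain ⟨n, hn8, hn⟩ := sy_succ i.1
  simp only [idx]
  rw [sx_succ, hn]
  have h1 := mul_pos (sx_pos i.1) (sy_pos i.1)
  have : (n : ℝ) ≤ 8 := by exact_mod_cast hn8
  push_cast
  nlinarith

lemma RR_sub_parent {i : ℤ × ℤ × ℤ} {z : ℝ × ℝ} (hz : z ∈ RR i) : RR i ⊆ RR (idx (i.1 + 1) z) := by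
  intro w hw
  have h : idx i.1 w = idx i.1 z := by rw [show idx i.1 w = i from hw, show idx i.1 z = i from hz]
  exact idx_step h

section stopping
variable (f : ℝ × ℝ → ℂ) (l : ℝ)

/-- rectangles with large average -/
def big (i : ℤ × ℤ × ℤ) : Prop := ENNReal.ofReal l * volume (RR i) < ∫⁻ z in RR i, ‖f z‖ₑ

/-- the stopping family -/
def stopS : Set (ℤ × ℤ × ℤ) :=
  {i | big f l i ∧ ∀ z ∈ RR i, ∀ j' > i.1, ¬ big f l (idx j' z)}

lemma stop_disj : Pairwise (Function.onFun Disjoint (fun i : stopS f l => RR i.1)) := by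
  rintro ⟨i, hi⟩ ⟨i', hi'⟩ hne
  rw [Function.onFun, Set.disjoint_left]
  intro z hz hz'
  have e : idx i.1 z = i := hz
  have e' : idx i'.1 z = i' := hz'
  rcases lt_trichotomy i.1 i'.1 with h | h | h
  · exact hi.2 z hz i'.1 h (by rw [e']; exact hi'.1)
  · apply hne; apply Subtype.ext
    show i = i'
    rw [← e, ← e', h]
  · exact hi'.2 z hz' i.1 h (by rw [e]; exact hi.1)

variable {f l}

lemma stop_upper {i : ℤ × ℤ × ℤ} (hi : i ∈ stopS f l) :
    ∫⁻ z in RR i, ‖f z‖ₑ ≤ 32 * ENNReal.ofReal l * volume (RR i) := by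
  have h := hi.2 _ (corner_mem i) (i.1 + 1) (by omega)
  unfold big at h
  push Not at h
  calc _ ≤ ∫⁻ z in RR (idx (i.1 + 1) (corner i)), ‖f z‖ₑ :=
        lintegral_mono_set (RR_sub_parent (corner_mem i))
    _ ≤ _ := h
    _ ≤ ENNReal.ofReal l * (32 * volume (RR i)) := by gcongr; exact RR_parent_vol i _
    _ = _ := by ring

lemma stop_exists (hf : Integrable f) (hl : 0 < l) {z : ℝ × ℝ} {j : ℤ} (hj : big f l (idx j z)) :
    ∃ i ∈ stopS f l, z ∈ RR i := by
  have hb : ∃ b : ℤ, ∀ j, big f l (idx j z) → j ≤ b := by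
    have hfin : ∫⁻ z, ‖f z‖ₑ ≠ ∞ := hf.hasFiniteIntegral.ne
    set I := (∫⁻ z, ‖f z‖ₑ).toReal with hI
    obtain ⟨n, hn⟩ := pow_unbounded_of_one_lt (I / l) (show (1 : ℝ) < 4 by norm_num)
    refine ⟨n, fun j hj => ?_⟩
    by_contra hlt
    push Not at hlt
    have h1 : ENNReal.ofReal l * ENNReal.ofReal (sx j * sy j) < ENNReal.ofReal I := by
      rw [hI, ENNReal.ofReal_toReal hfin]
      have := hj
      unfold big at this
      rw [RR_vol] at this
      exact this.trans_le (setLIntegral_le_lintegral _ _)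
    rw [← ENNReal.ofReal_mul hl.le] at h1
    have h2 := (ENNReal.ofReal_lt_ofReal_iff_of_nonneg
      (mul_nonneg hl.le (mul_nonneg (sx_pos j).le (sy_pos j).le))).1 h1
    have h3 : (1 : ℝ) ≤ sy j := by
      unfold sy; rw [if_pos (by omega)]
      exact one_le_zpow₀ (by norm_num) (by omega)
    have h4 : (4 : ℝ) ^ n ≤ sx j := by
      unfold sx; rw [← zpow_natCast]
      exact zpow_le_zpow_right₀ (by norm_num) hlt.le
    rw [div_lt_iff₀ hl] at hn
    have h5 : (4 : ℝ) ^ n ≤ sx j * sy j := by nlinarith [sx_pos j]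
    nlinarith
  obtain ⟨J, hJ, hmax⟩ := Int.exists_greatest_of_bdd hb ⟨j, hj⟩
  refine ⟨idx J z, ⟨hJ, fun w hw j' hj' hbig => ?_⟩, mem_RR_idx J z⟩
  have e : idx J w = idx J z := hw
  have hj'' : J < j' := hj'
  rw [idx_mono hj''.le e] at hbig
  have := hmax j' hbig
  omega

lemma RR_ball {n : ℕ} (z : ℝ × ℝ) : ∃ w : ℝ × ℝ, RR (idx (-(n : ℤ) - 1) z) =ᵐ[volume]
    Metric.closedBall w ((4 : ℝ) ^ (-(n : ℤ) - 1) / 2) ∧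
    z ∈ Metric.closedBall w (1 * ((4 : ℝ) ^ (-(n : ℤ) - 1) / 2)) := by
  set j : ℤ := -(n : ℤ) - 1 with hj
  set i := idx j z with hi
  have hsy : sy j = sx j := by unfold sy sx; rw [if_neg (by omega)]
  have e4 : (4 : ℝ) ^ j = sx j := rfl
  have hs := sx_pos j
  have hball : Metric.closedBall (((i.2.1 + 1 / 2) * sx j, (i.2.2 + 1 / 2) * sx j) : ℝ × ℝ) ((4 : ℝ) ^ j / 2)
      = Set.Icc (i.2.1 * sx j) ((i.2.1 + 1) * sx j) ×ˢ Set.Icc (i.2.2 * sx j) ((i.2.2 + 1) * sx j) := by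
    rw [← closedBall_prod_same, Real.closedBall_eq_Icc, Real.closedBall_eq_Icc, e4]
    congr 2 <;> ring
  refine ⟨((i.2.1 + 1 / 2) * sx j, (i.2.2 + 1 / 2) * sx j), ?_, ?_⟩
  · rw [hball, RR_eq]
    have hi1 : i.1 = j := rfl
    rw [hi1, hsy]
    exact Measure.set_prod_ae_eq Ico_ae_eq_Icc Ico_ae_eq_Icc
  · rw [one_mul, hball]
    have := mem_RR_idx j z
    rw [RR_eq] at this
    have hi1 : (idx j z).1 = j := rfl
    rw [hi1, hsy] at this
    exact Set.prod_mono Set.Ico_subset_Icc_self Set.Ico_subset_Icc_self this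

lemma stop_ae (hf : Integrable f) (hl : 0 < l) :
    ∀ᵐ z, z ∉ ⋃ i : stopS f l, RR i.1 → ‖f z‖ ≤ l := by
  have h := IsUnifLocDoublingMeasure.ae_tendsto_average (μ := (volume : Measure (ℝ × ℝ)))
    hf.norm.locallyIntegrable 1
  filter_upwards [h] with z hz hzn
  have hnb : ∀ j, ¬ big f l (idx j z) := by
    intro j hj
    obtain ⟨i, hi, hzi⟩ := stop_exists hf hl hj
    exact hzn (Set.mem_iUnion.2 ⟨⟨i, hi⟩, hzi⟩)
  choose w hw1 hw2 using fun n : ℕ => RR_ball (n := n) z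
  have hδ : Tendsto (fun n : ℕ => (4 : ℝ) ^ (-(n : ℤ) - 1) / 2) atTop (𝓝[>] 0) := by
    rw [tendsto_nhdsWithin_iff]
    refine ⟨?_, Filter.Eventually.of_forall fun n => by simp only [Set.mem_Ioi]; positivity⟩
    have h0 := (tendsto_pow_atTop_nhds_zero_of_lt_one (r := (1 / 4 : ℝ)) (by norm_num) (by norm_num)).mul_const (1 / 8 : ℝ)
    rw [zero_mul] at h0
    refine h0.congr fun n => ?_
    rw [zpow_sub₀ (by norm_num), zpow_neg, zpow_natCast]; simp; ring
  have hlim := hz w _ hδ (Filter.Eventually.of_forall hw2)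
  refine le_of_tendsto hlim (Filter.Eventually.of_forall fun n => ?_)
  rw [← setAverage_congr (hw1 n), setAverage_eq]
  have hb := hnb (-(n : ℤ) - 1)
  unfold big at hb
  push Not at hb
  set i := idx (-(n : ℤ) - 1) z
  have hv := RR_vol_ne_zero i
  have hv' := RR_vol_ne_top i
  have e : ∫ y in RR i, ‖f y‖ = (∫⁻ y in RR i, ‖f y‖ₑ).toReal :=
    integral_norm_eq_lintegral_enorm hf.aestronglyMeasurable.restrict
  rw [e, smul_eq_mul, measureReal_def, inv_mul_le_iff₀ (ENNReal.toReal_pos hv hv')]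
  have := ENNReal.toReal_mono (ENNReal.mul_ne_top ENNReal.ofReal_ne_top hv') hb
  rw [ENNReal.toReal_mul, ENNReal.toReal_ofReal hl.le] at this
  linarith

end stopping

lemma good_exists {ι : Type} [Countable ι] (R : ι → Set (ℝ × ℝ)) (hm : ∀ i, MeasurableSet (R i))
    (hd : Pairwise (Function.onFun Disjoint R)) {f : ℝ × ℝ → ℂ}
    (hf : Integrable f) :
    ∃ g : ℝ × ℝ → ℂ, AEStronglyMeasurable g volume ∧
      (∀ i, ∀ z ∈ R i, g z = (volume (R i)).toReal⁻¹ • ∫ w in R i, f w) ∧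
      ∀ z, z ∉ ⋃ i, R i → g z = f z := by
  classical
  set av : ι → ℂ := fun i => (volume (R i)).toReal⁻¹ • ∫ w in R i, f w with hav
  set g : ℝ × ℝ → ℂ := fun z => if h : ∃ i, z ∈ R i then av h.choose else f z with hg
  have h1 : ∀ i, ∀ z ∈ R i, g z = av i := by
    intro i z hz
    have h : ∃ i, z ∈ R i := ⟨i, hz⟩
    simp only [hg, dif_pos h]
    congr 1
    by_contra hne
    exact Set.disjoint_left.1 (hd hne) h.choose_spec hz
  have h2 : ∀ z, z ∉ ⋃ i, R i → g z = f z := by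
    intro z hz
    have h : ¬ ∃ i, z ∈ R i := by simpa using hz
    simp only [hg, dif_neg h]
  refine ⟨g, ?_, h1, h2⟩
  have hU : MeasurableSet (⋃ i, R i) := MeasurableSet.iUnion hm
  have m1 : AEStronglyMeasurable g (volume.restrict (⋃ i, R i)) := by
    rw [aestronglyMeasurable_iUnion_iff]
    intro i
    refine (aestronglyMeasurable_const (b := av i)).congr ?_
    filter_upwards [ae_restrict_mem (hm i)] with z hz using (h1 i z hz).symm
  have m2 : AEStronglyMeasurable g (volume.restrict (⋃ i, R i)ᶜ) := by
    refine hf.aestronglyMeasurable.restrict.congr ?_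
    filter_upwards [ae_restrict_mem hU.compl] with z hz using (h2 z hz).symm
  have := (aestronglyMeasurable_union_iff (μ := volume)).2 ⟨m1, m2⟩
  rwa [Set.union_compl_self, Measure.restrict_univ] at this

/-- Hormander condition -/
def Horm (K : ℝ × ℝ → ℂ) (B : ℝ≥0∞) : Prop :=
  ∀ (j : ℤ) (v : ℝ × ℝ), |v.1| ≤ sx j → |v.2| ≤ sy j →
    ∫⁻ u in {u : ℝ × ℝ | 2 * sx j < |u.1| ∨ 2 * sy j < |u.2|}, ‖K (u - v) - K u‖ₑ ≤ B

/-- enlarged rectangle -/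
def star (i : ℤ × ℤ × ℤ) : Set (ℝ × ℝ) :=
  {z | |(z - corner i).1| ≤ 2 * sx i.1 ∧ |(z - corner i).2| ≤ 2 * sy i.1}

lemma star_eq (i : ℤ × ℤ × ℤ) : star i =
    Set.Icc ((corner i).1 - 2 * sx i.1) ((corner i).1 + 2 * sx i.1) ×ˢ
    Set.Icc ((corner i).2 - 2 * sy i.1) ((corner i).2 + 2 * sy i.1) := by
  ext z
  simp only [star, Set.mem_ofPred_eq, Set.mem_prod, Set.mem_Icc, abs_le, Prod.fst_sub, Prod.snd_sub]
  constructor <;> rintro ⟨⟨_, _⟩, _, _⟩ <;> refine ⟨⟨?_, ?_⟩, ?_, ?_⟩ <;> linarith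

lemma star_meas (i : ℤ × ℤ × ℤ) : MeasurableSet (star i) := by
  rw [star_eq]; exact measurableSet_Icc.prod measurableSet_Icc

lemma star_vol (i : ℤ × ℤ × ℤ) : volume (star i) = 16 * volume (RR i) := by
  have : (16 : ENNReal) = ENNReal.ofReal 16 := by simp
  have h1 := sx_pos i.1
  have h2 := sy_pos i.1
  rw [star_eq, RR_vol, Measure.volume_eq_prod, Measure.prod_prod, Real.volume_Icc, Real.volume_Icc,
    ← ENNReal.ofReal_mul (by linarith), this, ← ENNReal.ofReal_mul (by norm_num)]
  congr 1; ring

lemma horm_star {K : ℝ × ℝ → ℂ} {B : ℝ≥0∞} (hB : Horm K B) {i : ℤ × ℤ × ℤ} {w : ℝ × ℝ}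
    (hw : w ∈ RR i) : ∫⁻ z in (star i)ᶜ, ‖K (z - w) - K (z - corner i)‖ₑ ≤ B := by
  obtain ⟨a1, a2⟩ := sub_corner hw
  refine le_trans (le_of_eq ?_) (hB i.1 (w - corner i) a1 a2)
  have ha : Measurable fun u : ℝ × ℝ => |u.1| := by fun_prop
  have hb : Measurable fun u : ℝ × ℝ => |u.2| := by fun_prop
  have hm : MeasurableSet {u : ℝ × ℝ | 2 * sx i.1 < |u.1| ∨ 2 * sy i.1 < |u.2|} :=
    (measurableSet_lt measurable_const ha).union (measurableSet_lt measurable_const hb)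
  rw [← lintegral_indicator (star_meas i).compl, ← lintegral_indicator hm]
  rw [← lintegral_add_right_eq_self _ (corner i)]
  congr 1; ext u
  simp only [Set.indicator, Set.mem_compl_iff, star, Set.mem_ofPred_eq, add_sub_cancel_right, not_and_or,
    not_le]
  congr 4
  abel

lemma bad_est {K : ℝ × ℝ → ℂ} (hK : KerOK K) {B : ℝ≥0∞} (hB : Horm K B)
    (S : Set (ℤ × ℤ × ℤ)) (hd : Pairwise (Function.onFun Disjoint (fun i : S => RR i.1)))
    {b : ℝ × ℝ → ℂ} (hb : Integrable b) (hb0 : ∀ z, z ∉ ⋃ i : S, RR i.1 → b z = 0)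
    (hbm : ∀ i : S, ∫ w in RR i.1, b w = 0) :
    ∫⁻ z in (⋃ i : S, star i.1)ᶜ, ‖Tc K b z‖ₑ ≤ B * ∫⁻ w, ‖b w‖ₑ := by
  have hRm : ∀ i : S, MeasurableSet (RR i.1) := fun i => RR_meas _
  have hKc := hK.cont
  have p1 : ∀ z, ‖Tc K b z‖ₑ ≤ ∑' i : S, ∫⁻ w in RR i.1, ‖K (z - w) - K (z - corner i.1)‖ₑ * ‖b w‖ₑ := by
    intro z
    have e1 : Tc K b z = ∫ w in ⋃ i : S, RR i.1, K (z - w) * b w := by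
      unfold Tc
      rw [setIntegral_eq_integral_of_forall_compl_eq_zero]
      intro w hw; rw [hb0 w hw, mul_zero]
    rw [e1, integral_iUnion hRm hd (hK.mul_int hb z).integrableOn]
    refine (enorm_tsum_le_tsum_enorm ).trans (ENNReal.tsum_le_tsum fun i => ?_)
    have e2 : ∫ w in RR i.1, K (z - w) * b w =
        ∫ w in RR i.1, (K (z - w) - K (z - corner i.1)) * b w := by
      have e3 : ∫ w in RR i.1, K (z - corner i.1) * b w = 0 := by
        rw [integral_const_mul, hbm i, mul_zero]
      simp_rw [sub_mul]
      rw [integral_sub (hK.mul_int hb z).integrableOn (hb.const_mul _).integrableOn, e3, sub_zero]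
    rw [e2]
    refine (enorm_integral_le_lintegral_enorm _).trans (le_of_eq ?_)
    simp_rw [enorm_mul]
  have hmeas : ∀ i : S, AEMeasurable (fun p : (ℝ × ℝ) × (ℝ × ℝ) =>
      ‖K (p.1 - p.2) - K (p.1 - corner i.1)‖ₑ * ‖b p.2‖ₑ) (volume.prod volume) := by
    intro i
    have h1 : Continuous (fun p : (ℝ × ℝ) × (ℝ × ℝ) => K (p.1 - p.2) - K (p.1 - corner i.1)) := by
      fun_prop
    have h2 : AEMeasurable (fun p : (ℝ × ℝ) × (ℝ × ℝ) => ‖b p.2‖ₑ) (volume.prod volume) :=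
      hb.aestronglyMeasurable.enorm.comp_quasiMeasurePreserving
        Measure.quasiMeasurePreserving_snd
    exact h1.enorm.measurable.aemeasurable.mul h2
  have hmeas' : ∀ (i : S) (s : Set (ℝ × ℝ)), AEMeasurable (fun p : (ℝ × ℝ) × (ℝ × ℝ) =>
      ‖K (p.1 - p.2) - K (p.1 - corner i.1)‖ₑ * ‖b p.2‖ₑ)
      ((volume.restrict s).prod (volume.restrict (RR i.1))) := by
    intro i s; rw [Measure.prod_restrict]; exact (hmeas i).restrict
  calc ∫⁻ z in (⋃ i : S, star i.1)ᶜ, ‖Tc K b z‖ₑ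
      ≤ ∫⁻ z in (⋃ i : S, star i.1)ᶜ, ∑' i : S, ∫⁻ w in RR i.1, ‖K (z - w) - K (z - corner i.1)‖ₑ * ‖b w‖ₑ :=
        lintegral_mono p1
    _ = ∑' i : S, ∫⁻ z in (⋃ i : S, star i.1)ᶜ, ∫⁻ w in RR i.1, ‖K (z - w) - K (z - corner i.1)‖ₑ * ‖b w‖ₑ := by
        rw [lintegral_tsum]
        intro i
        exact (hmeas' i _).lintegral_prod_right'
    _ ≤ ∑' i : S, B * ∫⁻ w in RR i.1, ‖b w‖ₑ := by
        refine ENNReal.tsum_le_tsum fun i => ?_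
        calc _ ≤ ∫⁻ z in (star i.1)ᶜ, ∫⁻ w in RR i.1, ‖K (z - w) - K (z - corner i.1)‖ₑ * ‖b w‖ₑ := by
              refine lintegral_mono_set (Set.compl_subset_compl.2 ?_)
              exact Set.subset_iUnion (fun i : S => star i.1) i
          _ = ∫⁻ w in RR i.1, ∫⁻ z in (star i.1)ᶜ, ‖K (z - w) - K (z - corner i.1)‖ₑ * ‖b w‖ₑ :=
              lintegral_lintegral_swap (hmeas' i _)
          _ ≤ ∫⁻ w in RR i.1, B * ‖b w‖ₑ := by
              refine setLIntegral_mono_ae' (RR_meas _) (Filter.Eventually.of_forall fun w hw => ?_)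
              rw [lintegral_mul_const']
              · gcongr; exact horm_star hB hw
              · exact enorm_ne_top
          _ = _ := lintegral_const_mul'' _ hb.aestronglyMeasurable.enorm.restrict
    _ = B * ∫⁻ w in ⋃ i : S, RR i.1, ‖b w‖ₑ := by
        rw [ENNReal.tsum_mul_left, lintegral_iUnion hRm hd]
    _ ≤ _ := by gcongr; exact Measure.restrict_le_self

lemma weak11 {K : ℝ × ℝ → ℂ} (hK : KerOK K) {B : ℝ≥0∞} (hB : Horm K B)
    (hL2 : ∀ f : ℝ × ℝ → ℂ, Integrable f → ∫⁻ z, ‖Tc K f z‖ₑ ^ 2 ≤ ∫⁻ z, ‖f z‖ₑ ^ 2)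
    {f : ℝ × ℝ → ℂ} (hf : Integrable f) {l : ℝ} (hl : 0 < l) :
    ENNReal.ofReal l * volume {z | l < ‖Tc K f z‖} ≤ (144 + 4 * B) * ∫⁻ z, ‖f z‖ₑ := by
  set S := stopS f l with hS
  set L := ENNReal.ofReal l with hL
  have hL0 : L ≠ 0 := by simpa [hL] using hl
  have hLt : L ≠ ∞ := ENNReal.ofReal_ne_top
  have hd := stop_disj f l
  have hRm : ∀ i : S, MeasurableSet (RR i.1) := fun i => RR_meas _
  obtain ⟨g, hgm, hg1, hg2⟩ := good_exists (fun i : S => RR i.1) hRm hd hf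
  have hU : MeasurableSet (⋃ i : S, RR i.1) := MeasurableSet.iUnion hRm
  set F := ∫⁻ z, ‖f z‖ₑ with hF
  -- bounds for the averages
  have hav : ∀ i : S, ∀ z ∈ RR i.1, ‖g z‖ₑ * volume (RR i.1) ≤ ∫⁻ w in RR i.1, ‖f w‖ₑ := by
    intro i z hz
    have hv := RR_vol_ne_zero i.1
    have hv' := RR_vol_ne_top i.1
    rw [hg1 i z hz, enorm_smul, mul_right_comm]
    have : ‖(volume (RR i.1)).toReal⁻¹‖ₑ = (volume (RR i.1))⁻¹ := by
      rw [Real.enorm_eq_ofReal (by positivity), ENNReal.ofReal_inv_of_pos (ENNReal.toReal_pos hv hv'),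
        ENNReal.ofReal_toReal hv']
    rw [this, ENNReal.inv_mul_cancel hv hv', one_mul]
    exact enorm_integral_le_lintegral_enorm _
  have hgi : ∀ i : S, ∫⁻ z in RR i.1, ‖g z‖ₑ ≤ ∫⁻ w in RR i.1, ‖f w‖ₑ := by
    intro i
    calc ∫⁻ z in RR i.1, ‖g z‖ₑ = ∫⁻ z in RR i.1, ‖g (corner i.1)‖ₑ := by
          refine setLIntegral_congr_fun (hRm i) fun z hz => ?_
          rw [hg1 i z hz, hg1 i _ (corner_mem _)]
      _ = ‖g (corner i.1)‖ₑ * volume (RR i.1) := by rw [setLIntegral_const]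
      _ ≤ _ := hav i _ (corner_mem _)
  have hgF : ∫⁻ z, ‖g z‖ₑ ≤ F := by
    rw [hF, ← lintegral_add_compl _ hU, ← lintegral_add_compl (fun z => ‖f z‖ₑ) hU,
      lintegral_iUnion hRm hd, lintegral_iUnion hRm hd]
    refine add_le_add (ENNReal.tsum_le_tsum hgi) (le_of_eq ?_)
    refine setLIntegral_congr_fun hU.compl fun z hz => ?_
    rw [hg2 z hz]
  have hFt : F ≠ ∞ := hf.hasFiniteIntegral.ne
  have hgint : Integrable g := ⟨hgm, hgF.trans_lt hFt.lt_top⟩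
  have hgsup : ∀ᵐ z, ‖g z‖ₑ ≤ 32 * L := by
    filter_upwards [stop_ae hf hl] with z hz
    by_cases hzU : z ∈ ⋃ i : S, RR i.1
    · obtain ⟨i, hi⟩ := Set.mem_iUnion.1 hzU
      have h1 := (hav i z hi).trans (stop_upper i.2)
      exact (ENNReal.mul_le_mul_iff_left (RR_vol_ne_zero i.1) (RR_vol_ne_top i.1)).1 h1
    · rw [hg2 z hzU, ← ofReal_norm]
      calc _ ≤ L := ENNReal.ofReal_le_ofReal (hz hzU)
        _ = 1 * L := (one_mul _).symm
        _ ≤ _ := by gcongr; norm_num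
  have hg22 : ∫⁻ z, ‖g z‖ₑ ^ 2 ≤ 32 * L * F := by
    calc ∫⁻ z, ‖g z‖ₑ ^ 2 ≤ ∫⁻ z, 32 * L * ‖g z‖ₑ := by
          refine lintegral_mono_ae ?_
          filter_upwards [hgsup] with z hz
          rw [sq]; gcongr
      _ = 32 * L * ∫⁻ z, ‖g z‖ₑ := lintegral_const_mul'' _ hgm.enorm
      _ ≤ _ := by gcongr
  -- the bad part
  set b : ℝ × ℝ → ℂ := fun z => f z - g z with hbdef
  have hbint : Integrable b := hf.sub hgint
  have hbF : ∫⁻ z, ‖b z‖ₑ ≤ 2 * F := by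
    calc ∫⁻ z, ‖b z‖ₑ ≤ ∫⁻ z, (‖f z‖ₑ + ‖g z‖ₑ) := lintegral_mono fun z => enorm_sub_le
      _ = F + ∫⁻ z, ‖g z‖ₑ := lintegral_add_left' hf.aestronglyMeasurable.enorm _
      _ ≤ F + F := by gcongr
      _ = 2 * F := (two_mul _).symm
  have hb0 : ∀ z, z ∉ ⋃ i : S, RR i.1 → b z = 0 := fun z hz => by
    simp only [hbdef]; rw [hg2 z hz, sub_self]
  have hbm : ∀ i : S, ∫ w in RR i.1, b w = 0 := by
    intro i
    simp only [hbdef]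
    rw [integral_sub hf.integrableOn hgint.integrableOn]
    have : ∫ w in RR i.1, g w = ∫ w in RR i.1, f w := by
      rw [setIntegral_congr_fun (hRm i) (hg1 i), setIntegral_const, measureReal_def, smul_smul,
        mul_inv_cancel₀, one_smul]
      exact (ENNReal.toReal_pos (RR_vol_ne_zero i.1) (RR_vol_ne_top i.1)).ne'
    rw [this, sub_self]
  have hbad := bad_est hK hB S hd hbint hb0 hbm
  -- the exceptional set
  have hstar : L * volume (⋃ i : S, star i.1) ≤ 16 * F := by
    calc L * volume (⋃ i : S, star i.1) ≤ L * ∑' i : S, volume (star i.1) := by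
          gcongr; exact measure_iUnion_le _
      _ = 16 * ∑' i : S, L * volume (RR i.1) := by
          simp_rw [star_vol]
          rw [ENNReal.tsum_mul_left, ENNReal.tsum_mul_left]; ring
      _ ≤ 16 * ∑' i : S, ∫⁻ z in RR i.1, ‖f z‖ₑ := by
          gcongr with i; exact (i.2.1).le
      _ = 16 * ∫⁻ z in ⋃ i : S, RR i.1, ‖f z‖ₑ := by rw [lintegral_iUnion hRm hd]
      _ ≤ _ := by gcongr; exact setLIntegral_le_lintegral _ _
  -- level sets
  set V1 : Set (ℝ × ℝ) := {z | L / 2 ≤ ‖Tc K g z‖ₑ}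
  set V2 : Set (ℝ × ℝ) := ⋃ i : S, star i.1
  set V3 : Set (ℝ × ℝ) := {z | L / 2 ≤ ‖Tc K b z‖ₑ} ∩ V2ᶜ
  have hsub : {z | l < ‖Tc K f z‖} ⊆ (V1 ∪ V2) ∪ V3 := by
    intro z hz
    by_contra hcon
    simp only [Set.mem_union, not_or] at hcon
    obtain ⟨⟨c1, c2⟩, c3⟩ := hcon
    have c3' : ‖Tc K b z‖ₑ < L / 2 := by
      by_contra hge
      exact c3 ⟨not_lt.1 hge, c2⟩
    have c1' : ‖Tc K g z‖ₑ < L / 2 := not_le.1 c1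
    have e : Tc K f z = Tc K g z + Tc K b z := by
      rw [← hK.Tc_add hgint hbint]; congr 1; ext w; simp [hbdef]
    have h1 : L < ‖Tc K f z‖ₑ := by
      rw [← ofReal_norm]; exact (ENNReal.ofReal_lt_ofReal_iff (hl.trans hz)).2 hz
    have h2 : ‖Tc K f z‖ₑ ≤ L := by
      rw [e]
      calc _ ≤ ‖Tc K g z‖ₑ + ‖Tc K b z‖ₑ := enorm_add_le _ _
        _ ≤ L / 2 + L / 2 := add_le_add c1'.le c3'.le
        _ = L := ENNReal.add_halves L
    exact absurd h1 (not_lt.2 h2)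
  have hV1 : L * volume V1 ≤ 128 * F := by
    have h1 : (L / 2) ^ 2 * volume V1 ≤ 32 * L * F := by
      calc (L / 2) ^ 2 * volume V1 ≤ (L / 2) ^ 2 * volume {z | (L / 2) ^ 2 ≤ ‖Tc K g z‖ₑ ^ 2} := by
            gcongr
            intro z hz
            exact pow_le_pow_left' (show L / 2 ≤ ‖Tc K g z‖ₑ from hz) 2
        _ ≤ ∫⁻ z, ‖Tc K g z‖ₑ ^ 2 :=
            mul_meas_ge_le_lintegral₀ ((hK.Tc_cont hgint).enorm.measurable.pow_const 2).aemeasurable _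
        _ ≤ _ := (hL2 g hgint).trans hg22
    have h2 : (L / 2) ^ 2 * volume V1 * 4 = L * (L * volume V1) := by
      have : L / 2 * 2 = L := ENNReal.div_mul_cancel (by norm_num) (by norm_num)
      calc _ = (L / 2 * 2) * ((L / 2 * 2) * volume V1) := by ring
        _ = _ := by rw [this]
    have h3 : L * (L * volume V1) ≤ L * (128 * F) := by
      rw [← h2]
      calc _ ≤ 32 * L * F * 4 := by gcongr
        _ = _ := by ring
    exact (ENNReal.mul_le_mul_iff_right hL0 hLt).1 h3
  have hV3 : L * volume V3 ≤ 4 * B * F := by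
    have h1 : L / 2 * volume V3 ≤ B * (2 * F) := by
      have hV2m : MeasurableSet V2 := MeasurableSet.iUnion fun i => star_meas _
      calc L / 2 * volume V3 = L / 2 * (volume.restrict V2ᶜ) {z | L / 2 ≤ ‖Tc K b z‖ₑ} := by
            rw [Measure.restrict_apply' hV2m.compl]
        _ ≤ ∫⁻ z in V2ᶜ, ‖Tc K b z‖ₑ :=
            mul_meas_ge_le_lintegral₀ (hK.Tc_cont hbint).enorm.measurable.aemeasurable _
        _ ≤ B * ∫⁻ w, ‖b w‖ₑ := hbad
        _ ≤ _ := by gcongr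
    have : L / 2 * 2 = L := ENNReal.div_mul_cancel (by norm_num) (by norm_num)
    calc L * volume V3 = (L / 2 * 2) * volume V3 := by rw [this]
      _ = L / 2 * volume V3 * 2 := by ring
      _ ≤ B * (2 * F) * 2 := by gcongr
      _ = _ := by ring
  calc L * volume {z | l < ‖Tc K f z‖} ≤ L * (volume V1 + volume V2 + volume V3) := by
        gcongr
        refine (measure_mono hsub).trans ((measure_union_le _ _).trans ?_)
        gcongr; exact measure_union_le _ _
    _ = L * volume V1 + L * volume V2 + L * volume V3 := by ring
    _ ≤ 128 * F + 16 * F + 4 * B * F := by gcongr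
    _ = _ := by ring

/-- the integrand in the Marcinkiewicz argument -/
def Phi (C0 : ℝ≥0∞) (t a : ℝ) : ℝ≥0∞ :=
  2 * C0 * ENNReal.ofReal t⁻¹ * (if t < a then ENNReal.ofReal a else 0) +
    4 * ENNReal.ofReal t⁻¹ ^ 2 * (if t < a then 0 else ENNReal.ofReal a ^ 2)

lemma lint_rpow_Ioo {a s : ℝ} (ha : 0 < a) (hs : -1 < s) :
    ∫⁻ t in Set.Ioo 0 a, ENNReal.ofReal (t ^ s) = ENNReal.ofReal (a ^ (s + 1) / (s + 1)) := by
  rw [setLIntegral_congr Ioo_ae_eq_Ioc]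
  have hi : IntegrableOn (fun t : ℝ => t ^ s) (Set.Ioc 0 a) :=
    (intervalIntegrable_iff_integrableOn_Ioc_of_le ha.le).1 (intervalIntegral.intervalIntegrable_rpow' hs)
  rw [← ofReal_integral_eq_lintegral_ofReal hi]
  · rw [← intervalIntegral.integral_of_le ha.le, integral_rpow (Or.inl hs),
      Real.zero_rpow (by linarith), sub_zero]
  · filter_upwards [ae_restrict_mem measurableSet_Ioc] with t ht using Real.rpow_nonneg ht.1.le _

lemma lint_rpow_Ici {a s : ℝ} (ha : 0 < a) (hs : s < -1) :
    ∫⁻ t in Set.Ici a, ENNReal.ofReal (t ^ s) = ENNReal.ofReal (-a ^ (s + 1) / (s + 1)) := by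
  rw [setLIntegral_congr Ioi_ae_eq_Ici.symm]
  rw [← ofReal_integral_eq_lintegral_ofReal (integrableOn_Ioi_rpow_of_lt hs ha)]
  · rw [integral_Ioi_rpow_of_lt hs ha]
  · filter_upwards [ae_restrict_mem measurableSet_Ioi] with t ht using
      Real.rpow_nonneg (ha.trans ht).le _

lemma Phi_int {C0 : ℝ≥0∞} {a p : ℝ} (ha : 0 ≤ a) (hp : 1 < p) (hp2 : p < 2) :
    ∫⁻ t in Set.Ioi 0, Phi C0 t a * ENNReal.ofReal (t ^ (p - 1)) ≤
      (2 * C0 * ENNReal.ofReal (1 / (p - 1)) + 4 * ENNReal.ofReal (1 / (2 - p))) *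
        ENNReal.ofReal (a ^ p) := by
  rcases ha.eq_or_lt with rfl | ha
  · refine le_trans (le_of_eq ?_) zero_le
    rw [setLIntegral_congr_fun measurableSet_Ioi (g := fun _ => 0), lintegral_zero]
    intro t ht
    have : ¬ t < 0 := not_lt.2 (le_of_lt ht)
    simp [Phi, this]
  rw [← Set.Ioo_union_Ici_eq_Ioi ha]
  refine (lintegral_union_le _ _ _).trans ?_
  rw [add_mul]
  refine add_le_add ?_ ?_
  · calc ∫⁻ t in Set.Ioo 0 a, Phi C0 t a * ENNReal.ofReal (t ^ (p - 1))
        = ∫⁻ t in Set.Ioo 0 a, 2 * C0 * ENNReal.ofReal a * ENNReal.ofReal (t ^ (p - 2)) := by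
          refine setLIntegral_congr_fun measurableSet_Ioo fun t ht => ?_
          have e : ENNReal.ofReal (t ^ (p - 2)) = ENNReal.ofReal t⁻¹ * ENNReal.ofReal (t ^ (p - 1)) := by
            rw [← ENNReal.ofReal_mul (inv_nonneg.2 ht.1.le), ← Real.rpow_neg_one,
              ← Real.rpow_add ht.1]
            congr 2; ring
          simp only [Phi, if_pos ht.2, mul_zero, add_zero]
          rw [e]; ring
      _ = 2 * C0 * ENNReal.ofReal a * ENNReal.ofReal (a ^ (p - 1) / (p - 1)) := by
          rw [lintegral_const_mul _ (by fun_prop), lint_rpow_Ioo ha (by linarith)]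
          ring_nf
      _ = _ := by
          rw [mul_assoc, mul_assoc (2 * C0), ← ENNReal.ofReal_mul ha.le, ← ENNReal.ofReal_mul
            (by have : 0 < p - 1 := by linarith
                positivity)]
          congr 2
          have : a ^ p = a * a ^ (p - 1) := by
            rw [← Real.rpow_one_add' ha.le (by linarith)]; ring_nf
          rw [this]; ring
      _ ≤ _ := le_rfl
  · calc ∫⁻ t in Set.Ici a, Phi C0 t a * ENNReal.ofReal (t ^ (p - 1))
        = ∫⁻ t in Set.Ici a, 4 * ENNReal.ofReal (a ^ 2) * ENNReal.ofReal (t ^ (p - 3)) := by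
          refine setLIntegral_congr_fun measurableSet_Ici fun t ht => ?_
          have ht0 : 0 < t := ha.trans_le ht
          have e : ENNReal.ofReal (t ^ (p - 3)) = ENNReal.ofReal t⁻¹ ^ 2 * ENNReal.ofReal (t ^ (p - 1)) := by
            rw [← ENNReal.ofReal_pow (inv_nonneg.2 ht0.le), ← ENNReal.ofReal_mul (by positivity)]
            congr 1
            rw [show p - 3 = (p - 1) - (2 : ℕ) by push_cast; ring, Real.rpow_sub_natCast ht0.ne']
            field_simp
          simp only [Phi, if_neg (not_lt.2 (show a ≤ t from ht)), mul_zero, zero_add]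
          rw [e, ENNReal.ofReal_pow ha.le]; ring
      _ = 4 * ENNReal.ofReal (a ^ 2) * ENNReal.ofReal (-a ^ (p - 2) / (p - 2)) := by
          rw [lintegral_const_mul _ (by fun_prop), lint_rpow_Ici ha (by linarith)]
          ring_nf
      _ = _ := by
          rw [mul_assoc, mul_assoc 4, ← ENNReal.ofReal_mul (by positivity), ← ENNReal.ofReal_mul
            (by have : 0 < 2 - p := by linarith
                positivity)]
          congr 2
          have : a ^ p = a ^ 2 * a ^ (p - 2) := by
            rw [show p - 2 = p - (2 : ℕ) by push_cast; ring, Real.rpow_sub_natCast ha.ne']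
            field_simp
          have h2 : 2 - p ≠ 0 := by linarith
          have h3 : p - 2 ≠ 0 := by linarith
          rw [this, show p - 2 = -(2 - p) by ring, neg_div_neg_eq]; ring
      _ ≤ _ := le_rfl

lemma level_est {K : ℝ × ℝ → ℂ} (hK : KerOK K) {B : ℝ≥0∞} (hB : Horm K B)
    (hL2 : ∀ f : ℝ × ℝ → ℂ, Integrable f → ∫⁻ z, ‖Tc K f z‖ₑ ^ 2 ≤ ∫⁻ z, ‖f z‖ₑ ^ 2)
    {f : ℝ × ℝ → ℂ} (hfc : Continuous f) (hf : Integrable f) {t : ℝ} (ht : 0 < t) :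
    volume {z | t < ‖Tc K f z‖} ≤ ∫⁻ z, Phi (144 + 4 * B) t ‖f z‖ := by
  set C0 := 144 + 4 * B
  set E : Set (ℝ × ℝ) := {z | t < ‖f z‖} with hE
  have hEm : MeasurableSet E := measurableSet_lt measurable_const hfc.norm.measurable
  set f1 := E.indicator f with hf1
  set f2 := Eᶜ.indicator f with hf2
  have hi1 : Integrable f1 := hf.indicator hEm
  have hi2 : Integrable f2 := hf.indicator hEm.compl
  have hsum : f = fun w => f1 w + f2 w := by
    ext w; exact (congrFun (Set.indicator_self_add_compl E f) w).symm
  have ht2 : 0 < t / 2 := by linarith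
  have w1 := weak11 hK hB hL2 hi1 ht2
  have hone : ENNReal.ofReal t⁻¹ * 2 * ENNReal.ofReal (t / 2) = 1 := by
    rw [show (2 : ℝ≥0∞) = ENNReal.ofReal 2 by simp, ← ENNReal.ofReal_mul (by positivity),
      ← ENNReal.ofReal_mul (by positivity), ← ENNReal.ofReal_one]
    congr 1; field_simp
  have v1 : volume {z | t / 2 < ‖Tc K f1 z‖} ≤ 2 * C0 * ENNReal.ofReal t⁻¹ * ∫⁻ z, ‖f1 z‖ₑ := by
    calc _ = ENNReal.ofReal t⁻¹ * 2 * (ENNReal.ofReal (t / 2) * volume {z | t / 2 < ‖Tc K f1 z‖}) := by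
          rw [← mul_assoc, hone, one_mul]
      _ ≤ ENNReal.ofReal t⁻¹ * 2 * (C0 * ∫⁻ z, ‖f1 z‖ₑ) := by gcongr
      _ = _ := by ring
  have v2 : volume {z | ENNReal.ofReal (t / 2) ^ 2 ≤ ‖Tc K f2 z‖ₑ ^ 2} ≤
      4 * ENNReal.ofReal t⁻¹ ^ 2 * ∫⁻ z, ‖f2 z‖ₑ ^ 2 := by
    have h := mul_meas_ge_le_lintegral₀ (μ := volume) (f := fun z => ‖Tc K f2 z‖ₑ ^ 2)
      ((hK.Tc_cont hi2).enorm.measurable.pow_const 2).aemeasurable (ENNReal.ofReal (t / 2) ^ 2)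
    have h' := h.trans (hL2 f2 hi2)
    calc _ = (ENNReal.ofReal t⁻¹ * 2 * ENNReal.ofReal (t / 2)) ^ 2 *
          volume {z | ENNReal.ofReal (t / 2) ^ 2 ≤ ‖Tc K f2 z‖ₑ ^ 2} := by rw [hone]; simp
      _ = 4 * ENNReal.ofReal t⁻¹ ^ 2 * (ENNReal.ofReal (t / 2) ^ 2 *
          volume {z | ENNReal.ofReal (t / 2) ^ 2 ≤ ‖Tc K f2 z‖ₑ ^ 2}) := by ring
      _ ≤ _ := by gcongr
  have hsub : {z | t < ‖Tc K f z‖} ⊆ {z | t / 2 < ‖Tc K f1 z‖} ∪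
      {z | ENNReal.ofReal (t / 2) ^ 2 ≤ ‖Tc K f2 z‖ₑ ^ 2} := by
    intro z hz
    by_contra hcon
    rw [Set.mem_union, not_or] at hcon
    obtain ⟨c1, c2⟩ := hcon
    have c1' : ‖Tc K f1 z‖ ≤ t / 2 := not_lt.1 c1
    have c2' : ‖Tc K f2 z‖ ≤ t / 2 := by
      by_contra hh
      refine c2 ?_
      have h5 : ENNReal.ofReal (t / 2) ≤ ‖Tc K f2 z‖ₑ := by
        rw [← ofReal_norm]; exact ENNReal.ofReal_le_ofReal (not_le.1 hh).le
      exact pow_le_pow_left' h5 2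
    have e : Tc K f z = Tc K f1 z + Tc K f2 z := by
      conv_lhs => rw [hsum]
      exact hK.Tc_add hi1 hi2 z
    have hz' : t < ‖Tc K f z‖ := hz
    rw [e] at hz'
    linarith [norm_add_le (Tc K f1 z) (Tc K f2 z)]
  have n1 : ∀ z, ‖f1 z‖ₑ = if t < ‖f z‖ then ENNReal.ofReal ‖f z‖ else 0 := by
    intro z
    simp only [hf1, Set.indicator]
    split_ifs with h1 h2 h2
    · rw [ofReal_norm]
    · exact absurd h1 h2
    · exact absurd h2 h1
    · simp
  have n2 : ∀ z, ‖f2 z‖ₑ ^ 2 = if t < ‖f z‖ then 0 else ENNReal.ofReal ‖f z‖ ^ 2 := by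
    intro z
    simp only [hf2, Set.indicator]
    split_ifs with h1 h2 h2
    · exact absurd h2 h1
    · rw [ofReal_norm]
    · simp
    · exact absurd h2 h1
  refine (measure_mono hsub).trans ((measure_union_le _ _).trans ((add_le_add v1 v2).trans ?_))
  rw [← lintegral_const_mul'' _ hi1.aestronglyMeasurable.enorm,
    ← lintegral_const_mul'' _ (hi2.aestronglyMeasurable.enorm.pow_const 2),
    ← lintegral_add_left' (hi1.aestronglyMeasurable.enorm.const_mul _)]
  refine lintegral_mono fun z => le_of_eq ?_
  simp only [Phi, n1, n2]

lemma enorm_rpow_eq (x : ℂ) {p : ℝ} (hp : 0 ≤ p) : ‖x‖ₑ ^ p = ENNReal.ofReal (‖x‖ ^ p) := by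
  rw [← ofReal_norm, ENNReal.ofReal_rpow_of_nonneg (norm_nonneg _) hp]

lemma interp {p : ℝ} (hp : 1 < p) (hp2 : p < 2) {K : ℝ × ℝ → ℂ} (hK : KerOK K) {B : ℝ≥0∞} (hB : Horm K B)
    (hL2 : ∀ f : ℝ × ℝ → ℂ, Integrable f → ∫⁻ z, ‖Tc K f z‖ₑ ^ 2 ≤ ∫⁻ z, ‖f z‖ₑ ^ 2)
    {f : ℝ × ℝ → ℂ} (hfc : Continuous f) (hf : Integrable f) :
    ∫⁻ z, ‖Tc K f z‖ₑ ^ p ≤ (ENNReal.ofReal p * (2 * (144 + 4 * B) * ENNReal.ofReal (1 / (p - 1)) +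
      4 * ENNReal.ofReal (1 / (2 - p)))) * ∫⁻ z, ‖f z‖ₑ ^ p := by
  have hp0 : 0 ≤ p := by linarith
  simp_rw [enorm_rpow_eq _ hp0]
  rw [lintegral_rpow_eq_lintegral_meas_lt_mul volume (Filter.Eventually.of_forall fun z => norm_nonneg _)
    (hK.Tc_cont hf).norm.measurable.aemeasurable (by linarith), mul_assoc]
  refine mul_le_mul_right ?_ _
  have hPm : Measurable (fun q : ℝ × (ℝ × ℝ) => Phi (144 + 4 * B) q.1 ‖f q.2‖ * ENNReal.ofReal (q.1 ^ (p - 1))) := by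
    have hs : MeasurableSet {q : ℝ × (ℝ × ℝ) | q.1 < ‖f q.2‖} :=
      measurableSet_lt measurable_fst (hfc.norm.measurable.comp measurable_snd)
    have hfm := hfc.norm.measurable
    unfold Phi
    refine Measurable.mul (Measurable.add (Measurable.mul (by fun_prop) ?_)
      (Measurable.mul (by fun_prop) ?_)) (by fun_prop)
    · exact Measurable.ite hs (by fun_prop) (by fun_prop)
    · exact Measurable.ite hs (by fun_prop) (by fun_prop)
  calc ∫⁻ t in Set.Ioi 0, volume {z | t < ‖Tc K f z‖} * ENNReal.ofReal (t ^ (p - 1))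
      ≤ ∫⁻ t in Set.Ioi 0, ∫⁻ z, Phi (144 + 4 * B) t ‖f z‖ * ENNReal.ofReal (t ^ (p - 1)) := by
        refine setLIntegral_mono' measurableSet_Ioi fun t ht => ?_
        rw [lintegral_mul_const' _ _ ENNReal.ofReal_ne_top]
        gcongr
        exact level_est hK hB hL2 hfc hf ht
    _ = ∫⁻ z, ∫⁻ t in Set.Ioi 0, Phi (144 + 4 * B) t ‖f z‖ * ENNReal.ofReal (t ^ (p - 1)) :=
        lintegral_lintegral_swap hPm.aemeasurable
    _ ≤ ∫⁻ z, (2 * (144 + 4 * B) * ENNReal.ofReal (1 / (p - 1)) + 4 * ENNReal.ofReal (1 / (2 - p))) *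
        ENNReal.ofReal (‖f z‖ ^ p) := lintegral_mono fun z => Phi_int (norm_nonneg _) hp hp2
    _ = _ := by
        have hfm := hfc.norm.measurable
        rw [lintegral_const_mul _ (by fun_prop)]

lemma dual {p q : ℝ} (hp : 2 < p) (hpq : p.HolderConjugate q) {C : ℝ≥0∞} {K : ℝ × ℝ → ℂ} (hK : KerOK K)
    (hodd : ∀ z, K (-z) = - K z)
    (hq : ∀ g : ℝ × ℝ → ℂ, Continuous g → Integrable g →
      ∫⁻ z, ‖Tc K g z‖ₑ ^ q ≤ C * ∫⁻ z, ‖g z‖ₑ ^ q)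
    {f : ℝ × ℝ → ℂ} (hf : Integrable f) :
    ∫⁻ z, ‖Tc K f z‖ₑ ^ p ≤ C ^ (p / q) * ∫⁻ z, ‖f z‖ₑ ^ p := by
  set h := Tc K f with hh
  have hhc : Continuous h := hK.Tc_cont hf
  have hhi : Integrable h := hK.Tc_int hf
  obtain ⟨κ, hκ⟩ := hK.Tc_bdd hf
  have hκ0 : 0 ≤ κ := (norm_nonneg _).trans (hκ 0)
  set g : ℝ × ℝ → ℂ := fun z => ((‖h z‖ ^ (p - 2) : ℝ) : ℂ) * (starRingEnd ℂ) (h z) with hg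
  have hgc : Continuous g := by
    refine (Complex.continuous_ofReal.comp (hhc.norm.rpow_const fun z => Or.inr (by linarith))).mul ?_
    exact Complex.continuous_conj.comp hhc
  have hp0 : 0 < p := by linarith
  have hgn : ∀ z, ‖g z‖ = ‖h z‖ ^ (p - 1) := by
    intro z
    simp only [hg]
    rw [norm_mul, Complex.norm_real, Real.norm_of_nonneg (by positivity), Complex.norm_conj]
    rw [← Real.rpow_add_one' (norm_nonneg _) (by linarith)]; ring_nf
  have hgi : Integrable g := by
    refine Integrable.mono' (hhi.norm.const_mul (κ ^ (p - 2))) hgc.aestronglyMeasurable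
      (Filter.Eventually.of_forall fun z => ?_)
    simp only [hg]
    rw [norm_mul, Complex.norm_real, Real.norm_of_nonneg (by positivity), Complex.norm_conj]
    have := hκ z
    gcongr
  have hhg : ∀ z, h z * g z = ((‖h z‖ ^ p : ℝ) : ℂ) := by
    intro z
    simp only [hg]
    rw [mul_left_comm, Complex.mul_conj, ← Complex.ofReal_mul, Complex.normSq_eq_norm_sq]
    congr 1
    rw [← Real.rpow_add_natCast' (norm_nonneg _) (by push_cast; linarith)]
    congr 1; push_cast; ring
  have hpint : Integrable (fun z => ‖h z‖ ^ p) := by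
    refine Integrable.mono' (hgi.norm.const_mul κ) (hhc.norm.rpow_const fun z => Or.inr hp0.le).aestronglyMeasurable
      (Filter.Eventually.of_forall fun z => ?_)
    rw [Real.norm_of_nonneg (by positivity), hgn]
    calc ‖h z‖ ^ p = ‖h z‖ * ‖h z‖ ^ (p - 1) := by
          rw [← Real.rpow_one_add' (norm_nonneg _) (by linarith)]; ring_nf
      _ ≤ _ := by gcongr; exact hκ z
  -- duality
  have hdual : ∫ z, h z * g z = - ∫ w, f w * Tc K g w := by
    have hIntg : Integrable (fun r : (ℝ × ℝ) × (ℝ × ℝ) => (K (r.1 - r.2) * f r.2) * g r.1)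
        (volume.prod volume) := by
      refine (hK.prod_int hf).mul_bdd (c := κ ^ (p - 1)) ?_ ?_
      · exact (hgc.comp continuous_fst).aestronglyMeasurable
      · refine Filter.Eventually.of_forall fun r => ?_
        rw [hgn]
        have := hκ r.1
        gcongr
        linarith
    calc ∫ z, h z * g z = ∫ z, ∫ w, (K (z - w) * f w) * g z := by
          congr 1; ext z; rw [integral_mul_const]; rfl
      _ = ∫ w, ∫ z, (K (z - w) * f w) * g z := integral_integral_swap hIntg
      _ = ∫ w, - (f w * Tc K g w) := by
          congr 1; ext w
          unfold Tc
          rw [← integral_const_mul, ← integral_neg]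
          congr 1; ext z
          rw [← neg_sub w z, hodd]; ring
      _ = _ := integral_neg _
  set I := ∫⁻ z, ‖h z‖ₑ ^ p with hI
  set A := ∫⁻ z, ‖f z‖ₑ ^ p with hA
  have hIeq : I = ENNReal.ofReal (∫ z, ‖h z‖ ^ p) := by
    rw [ofReal_integral_eq_lintegral_ofReal hpint (Filter.Eventually.of_forall fun z => by positivity), hI]
    simp_rw [enorm_rpow_eq _ hp0.le]
  have hIt : I ≠ ∞ := by rw [hIeq]; exact ENNReal.ofReal_ne_top
  have hq0 : 0 < q := hpq.symm.pos
  have hgq : ∫⁻ z, ‖g z‖ₑ ^ q = I := by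
    rw [hI]; congr 1; ext z
    rw [enorm_rpow_eq _ hq0.le, enorm_rpow_eq _ hp0.le, hgn, ← Real.rpow_mul (norm_nonneg _)]
    congr 2
    have := hpq.sub_one_mul_conj
    exact this
  have hmain : I ≤ A ^ (1 / p) * (C * I) ^ (1 / q) := by
    have e1 : I = ‖∫ z, h z * g z‖ₑ := by
      rw [hIeq]
      simp_rw [hhg]
      rw [integral_complex_ofReal, ← ofReal_norm, Complex.norm_real, Real.norm_of_nonneg
        (integral_nonneg fun z => by positivity)]
    have e2 : I = ‖∫ w, f w * Tc K g w‖ₑ := by rw [e1, hdual, enorm_neg]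
    refine e2.le.trans ?_
    refine (enorm_integral_le_lintegral_enorm _).trans ?_
    simp_rw [enorm_mul]
    refine (ENNReal.lintegral_mul_le_Lp_mul_Lq volume hpq hf.aestronglyMeasurable.enorm
      (hK.Tc_cont hgi).enorm.measurable.aemeasurable).trans ?_
    rw [← hgq]
    gcongr
    exact hq g hgc hgi
  by_cases hI0 : I = 0
  · rw [hI0]; exact zero_le
  have hsplit : I = I ^ (1 / p) * I ^ (1 / q) := by
    rw [← ENNReal.rpow_add _ _ hI0 hIt]
    have := hpq.inv_add_inv_eq_one
    rw [one_div, one_div, this, ENNReal.rpow_one]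
  have h2 : I ^ (1 / p) * I ^ (1 / q) ≤ (A ^ (1 / p) * C ^ (1 / q)) * I ^ (1 / q) := by
    rw [← hsplit]
    rw [ENNReal.mul_rpow_of_nonneg _ _ (by positivity), ← mul_assoc] at hmain
    exact hmain
  have h3 : I ^ (1 / p) ≤ A ^ (1 / p) * C ^ (1 / q) := by
    refine (ENNReal.mul_le_mul_iff_left ?_ ?_).1 h2
    · simp [hI0, hIt]
    · exact ENNReal.rpow_ne_top_of_nonneg (by positivity) hIt
  have h4 := ENNReal.rpow_le_rpow h3 hp0.le
  rw [← ENNReal.rpow_mul, ENNReal.mul_rpow_of_nonneg _ _ hp0.le, ← ENNReal.rpow_mul, ← ENNReal.rpow_mul,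
    one_div_mul_cancel hp0.ne', ENNReal.rpow_one, ENNReal.rpow_one] at h4
  refine h4.trans (le_of_eq ?_)
  rw [mul_comm]; congr 2; ring

/-- The Calderon-Zygmund theorem for our kernels. -/
theorem cz_main {p : ℝ} (hp : 1 < p) {B : ℝ≥0∞} (hBt : B ≠ ∞) : ∃ C : ℝ≥0∞, C ≠ ∞ ∧
    ∀ K : ℝ × ℝ → ℂ, KerOK K → Horm K B → (∀ z, K (-z) = - K z) →
    (∀ f : ℝ × ℝ → ℂ, Integrable f → ∫⁻ z, ‖Tc K f z‖ₑ ^ 2 ≤ ∫⁻ z, ‖f z‖ₑ ^ 2) →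
    ∀ f : ℝ × ℝ → ℂ, Continuous f → Integrable f →
      ∫⁻ z, ‖Tc K f z‖ₑ ^ p ≤ C * ∫⁻ z, ‖f z‖ₑ ^ p := by
  have key : ∀ q : ℝ, (ENNReal.ofReal q * (2 * (144 + 4 * B) * ENNReal.ofReal (1 / (q - 1)) +
      4 * ENNReal.ofReal (1 / (2 - q)))) ≠ ∞ := by
    intro q
    have h4 : (4 : ℝ≥0∞) * B ≠ ∞ := ENNReal.mul_ne_top (by norm_num) hBt
    refine ENNReal.mul_ne_top ENNReal.ofReal_ne_top (ENNReal.add_ne_top.2 ⟨?_, ?_⟩)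
    · refine ENNReal.mul_ne_top (ENNReal.mul_ne_top (by norm_num) (ENNReal.add_ne_top.2 ⟨by norm_num, h4⟩))
        ENNReal.ofReal_ne_top
    · exact ENNReal.mul_ne_top (by norm_num) ENNReal.ofReal_ne_top
  rcases lt_trichotomy p 2 with h | h | h
  · exact ⟨_, key p, fun K hK hB _ hL2 f hfc hf => interp hp h hK hB hL2 hfc hf⟩
  · refine ⟨1, by norm_num, fun K hK hB _ hL2 f hfc hf => ?_⟩
    subst h
    simp only [ENNReal.rpow_ofNat, one_mul]
    exact hL2 f hf
  · have hpq := Real.HolderConjugate.conjExponent hp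
    set q := Real.conjExponent p with hqd
    have hq1 : 1 < q := hpq.symm.lt
    have hq2 : q < 2 := by
      rw [hqd, Real.conjExponent, div_lt_iff₀ (by linarith)]; linarith
    refine ⟨_, ENNReal.rpow_ne_top_of_nonneg (y := p / q) (by positivity) (key q), fun K hK hB hodd hL2 f hfc hf => ?_⟩
    exact dual h hpq hK hodd (fun g hgc hg => interp hq1 hq2 hK hB hL2 hgc hg) hf

/-- L1 normalized bump of width s -/
def qq (s x : ℝ) : ℝ := s⁻¹ / (1 + (x / s) ^ 2)

lemma qq_nonneg {s : ℝ} (hs : 0 < s) (x : ℝ) : 0 ≤ qq s x := by unfold qq; positivity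

lemma qq_meas (s : ℝ) : Measurable (fun x => ENNReal.ofReal (qq s x)) := by unfold qq; fun_prop

lemma qq_int {s : ℝ} (hs : 0 < s) : ∫⁻ x, ENNReal.ofReal (qq s x) = ENNReal.ofReal π := by
  have h1 : Integrable (fun x : ℝ => qq s x) := by
    unfold qq
    have := (integrable_inv_one_add_sq.comp_div hs.ne').const_mul s⁻¹
    simpa [div_eq_mul_inv] using this
  rw [← ofReal_integral_eq_lintegral_ofReal h1 (Filter.Eventually.of_forall fun x => qq_nonneg hs x)]
  congr 1
  unfold qq
  simp_rw [div_eq_mul_inv (s⁻¹)]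
  rw [integral_const_mul, Measure.integral_comp_div (fun x : ℝ => (1 + x ^ 2)⁻¹) s,
    integral_univ_inv_one_add_sq, abs_of_pos hs, smul_eq_mul]
  field_simp

lemma qq_shift {s : ℝ} (hs : 0 < s) (v : ℝ) : ∫⁻ x, ENNReal.ofReal (qq s (x - v)) = ENNReal.ofReal π := by
  rw [lintegral_sub_right_eq_self (fun x => ENNReal.ofReal (qq s x)), qq_int hs]

lemma qq_half {s X : ℝ} (hs : 0 < s) (hX : 0 < X) :
    ∫⁻ x in Set.Ioi X, ENNReal.ofReal (qq s x) ≤ ENNReal.ofReal (s / X) := by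
  have hi := (integrableOn_Ioi_rpow_of_lt (show (-2 : ℝ) < -1 by norm_num) hX).const_mul s
  calc ∫⁻ x in Set.Ioi X, ENNReal.ofReal (qq s x)
      ≤ ∫⁻ x in Set.Ioi X, ENNReal.ofReal (s * x ^ (-2 : ℝ)) := by
        refine setLIntegral_mono' measurableSet_Ioi fun x hx => ENNReal.ofReal_le_ofReal ?_
        have hx0 : 0 < x := hX.trans hx
        rw [Real.rpow_neg hx0.le, Real.rpow_two]
        unfold qq
        rw [div_le_iff₀ (by positivity)]
        have : s⁻¹ = s * (x ^ 2)⁻¹ * (x / s) ^ 2 := by field_simp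
        calc s⁻¹ = s * (x ^ 2)⁻¹ * (x / s) ^ 2 := this
          _ ≤ _ := by gcongr; linarith
    _ = ENNReal.ofReal (s / X) := by
        rw [← ofReal_integral_eq_lintegral_ofReal hi]
        · rw [integral_const_mul, integral_Ioi_rpow_of_lt (by norm_num) hX]
          congr 1
          rw [show (-2 : ℝ) + 1 = -1 by norm_num, Real.rpow_neg_one]; field_simp
        · filter_upwards [ae_restrict_mem measurableSet_Ioi] with t ht
          have : 0 < t := hX.trans ht
          simp only [Pi.zero_apply]; positivity

lemma qq_tail {s X : ℝ} (hs : 0 < s) (hX : 0 < X) :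
    ∫⁻ x in {x : ℝ | X < |x|}, ENNReal.ofReal (qq s x) ≤ 2 * ENNReal.ofReal (s / X) := by
  have hset : {x : ℝ | X < |x|} = Set.Ioi X ∪ Set.Iio (-X) := by
    ext x
    simp only [Set.mem_union, Set.mem_Ioi, Set.mem_Iio, Set.mem_ofPred_eq, lt_abs]
    constructor <;> rintro (h | h)
    · left; exact h
    · right; linarith
    · left; exact h
    · right; linarith
  rw [hset, two_mul]
  refine (lintegral_union_le _ _ _).trans (add_le_add (qq_half hs hX) ?_)
  refine le_trans (le_of_eq ?_) (qq_half hs hX)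
  rw [← lintegral_indicator measurableSet_Iio, ← lintegral_indicator measurableSet_Ioi,
    ← lintegral_neg_eq_self]
  congr 1; ext x
  have : qq s (-x) = qq s x := by unfold qq; rw [neg_div, neg_sq]
  simp [Set.indicator, this]

/-- profile of width s and size κ -/
structure Prof (a : ℝ → ℂ) (κ s : ℝ) : Prop where
  s_pos : 0 < s
  κ_nonneg : 0 ≤ κ
  size : ∀ x, ‖a x‖ ≤ κ * qq s x
  smooth : ∀ x v, |v| ≤ s → ‖a (x - v) - a x‖ ≤ κ * (|v| / s) * qq s x

/-- anisotropic dilation -/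
def Yf (r : ℝ) : ℝ := r * √(1 + r)

lemma Yf_pos {r : ℝ} (hr : 0 < r) : 0 < Yf r := by unfold Yf; positivity

lemma Yf_mono {r X : ℝ} (hr : 0 < r) (h : r ≤ X) : Yf r * X ≤ r * Yf X := by
  unfold Yf
  have : √(1 + r) ≤ √(1 + X) := Real.sqrt_le_sqrt (by linarith)
  nlinarith [mul_nonneg (hr.le) (sub_nonneg.2 this), mul_nonneg (mul_nonneg hr.le (hr.le.trans h)) (sub_nonneg.2 this)]

lemma sy_le (j : ℤ) : sy j ≤ Yf (sx j) := by
  have h4 := sx_pos j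
  unfold Yf
  have hle : sy j / sx j ≤ √(1 + sx j) := by
    refine Real.le_sqrt_of_sq_le ?_
    rw [div_pow, div_le_iff₀ (by positivity)]
    unfold sx sy at *
    split_ifs with h
    · have e : ((8 : ℝ) ^ j) ^ 2 = (4 ^ j) * (4 ^ j) ^ 2 := by
        rw [sq, sq, ← mul_zpow, ← mul_zpow, ← mul_zpow]; norm_num
      rw [e]; nlinarith [sq_nonneg ((4 : ℝ) ^ j)]
    · nlinarith [sq_nonneg ((4 : ℝ) ^ j), pow_pos h4 3]
  rw [div_le_iff₀ h4] at hle
  linarith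

lemma le_sy (j : ℤ) : Yf (sx j) ≤ 2 * sy j := by
  have h4 := sx_pos j
  have h5 := sy_pos j
  unfold Yf
  have hle : √(1 + sx j) ≤ 2 * (sy j / sx j) := by
    refine Real.sqrt_le_iff.2 ⟨by positivity, ?_⟩
    rw [mul_pow, div_pow, ← mul_div_assoc, le_div_iff₀ (by positivity)]
    unfold sx sy at *
    split_ifs with h
    · have e : ((8 : ℝ) ^ j) ^ 2 = (4 ^ j) * (4 ^ j) ^ 2 := by
        rw [sq, sq, ← mul_zpow, ← mul_zpow, ← mul_zpow]; norm_num
      have h1 : (1 : ℝ) ≤ 4 ^ j := one_le_zpow₀ (by norm_num) h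
      rw [e]; nlinarith [sq_nonneg ((4 : ℝ) ^ j), pow_pos h4 2]
    · have h1 : (4 : ℝ) ^ j ≤ 1 := zpow_le_one_of_nonpos₀ (by norm_num) (by lia)
      nlinarith [pow_pos h4 2]
  calc _ ≤ sx j * (2 * (sy j / sx j)) := by gcongr
    _ = _ := by field_simp

lemma enorm_le_of {x : ℂ} {c : ℝ} (h : ‖x‖ ≤ c) : ‖x‖ₑ ≤ ENNReal.ofReal c := by
  rw [← ofReal_norm]; exact ENNReal.ofReal_le_ofReal h

lemma lint_prod {f g : ℝ → ℝ≥0∞} (hf : Measurable f) (hg : Measurable g) :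
    ∫⁻ u : ℝ × ℝ, f u.1 * g u.2 = (∫⁻ x, f x) * ∫⁻ y, g y := by
  rw [Measure.volume_eq_prod]
  exact lintegral_prod_mul hf.aemeasurable hg.aemeasurable

section piece
variable {a b : ℝ → ℂ} {κ μ r : ℝ}

lemma piece_int (ha : Prof a κ r) (hb : Prof b μ (Yf r)) :
    ∫⁻ u : ℝ × ℝ, ‖a u.1 * b u.2‖ₑ ≤ ENNReal.ofReal (κ * μ) * ENNReal.ofReal (π * π) := by
  have hκ := ha.κ_nonneg
  have hμ := hb.κ_nonneg
  calc ∫⁻ u : ℝ × ℝ, ‖a u.1 * b u.2‖ₑ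
      ≤ ∫⁻ u : ℝ × ℝ, ENNReal.ofReal (κ * μ) * (ENNReal.ofReal (qq r u.1) * ENNReal.ofReal (qq (Yf r) u.2)) := by
        refine lintegral_mono fun u => ?_
        rw [← ENNReal.ofReal_mul (qq_nonneg ha.s_pos _), ← ENNReal.ofReal_mul (by positivity)]
        refine enorm_le_of ?_
        rw [norm_mul]
        have := ha.size u.1
        have := hb.size u.2
        have := qq_nonneg ha.s_pos u.1
        calc _ ≤ (κ * qq r u.1) * (μ * qq (Yf r) u.2) := by gcongr
          _ = _ := by ring
    _ = _ := by
        rw [lintegral_const_mul' _ _ ENNReal.ofReal_ne_top, lint_prod (qq_meas _) (qq_meas _), qq_int ha.s_pos,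
          qq_int hb.s_pos, ENNReal.ofReal_mul Real.pi_pos.le]

/-- smooth regime -/
lemma piece_smooth (ha : Prof a κ r) (hb : Prof b μ (Yf r)) {v : ℝ × ℝ} {δ : ℝ} (h1 : |v.1| ≤ δ * r)
    (h2 : |v.2| ≤ δ * Yf r) (hδ : δ ≤ 1) (hδ0 : 0 ≤ δ) :
    ∫⁻ u : ℝ × ℝ, ‖a (u.1 - v.1) * b (u.2 - v.2) - a u.1 * b u.2‖ₑ ≤
      ENNReal.ofReal (κ * μ * δ) * (2 * ENNReal.ofReal (π * π)) := by
  have hκ := ha.κ_nonneg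
  have hμ := hb.κ_nonneg
  have hr := ha.s_pos
  have hY := hb.s_pos
  have h1r : |v.1| ≤ r := h1.trans (by nlinarith)
  have h2r : |v.2| ≤ Yf r := h2.trans (by nlinarith)
  have h1d : |v.1| / r ≤ δ := by rw [div_le_iff₀ hr]; exact h1
  have h2d : |v.2| / Yf r ≤ δ := by rw [div_le_iff₀ hY]; exact h2
  calc ∫⁻ u : ℝ × ℝ, ‖a (u.1 - v.1) * b (u.2 - v.2) - a u.1 * b u.2‖ₑ
      ≤ ∫⁻ u : ℝ × ℝ, ENNReal.ofReal (κ * μ * δ) * (ENNReal.ofReal (qq r u.1) * ENNReal.ofReal (qq (Yf r) (u.2 - v.2)) +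
          ENNReal.ofReal (qq r u.1) * ENNReal.ofReal (qq (Yf r) u.2)) := by
        refine lintegral_mono fun u => ?_
        have p1 := qq_nonneg ha.s_pos u.1
        have p2 := qq_nonneg hb.s_pos u.2
        have p3 := qq_nonneg hb.s_pos (u.2 - v.2)
        rw [← ENNReal.ofReal_mul p1, ← ENNReal.ofReal_mul p1, ← ENNReal.ofReal_add (by positivity) (by positivity),
          ← ENNReal.ofReal_mul (by positivity)]
        refine enorm_le_of ?_
        have e : a (u.1 - v.1) * b (u.2 - v.2) - a u.1 * b u.2 =
          (a (u.1 - v.1) - a u.1) * b (u.2 - v.2) + a u.1 * (b (u.2 - v.2) - b u.2) := by ring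
        rw [e]
        refine (norm_add_le _ _).trans ?_
        rw [norm_mul, norm_mul]
        have q1 := ha.size u.1
        have q2 := hb.size (u.2 - v.2)
        have q3 := ha.smooth u.1 v.1 h1r
        have q4 := hb.smooth u.2 v.2 h2r
        calc _ ≤ (κ * (|v.1| / r) * qq r u.1) * (μ * qq (Yf r) (u.2 - v.2)) +
              (κ * qq r u.1) * (μ * (|v.2| / Yf r) * qq (Yf r) u.2) := by gcongr
          _ ≤ (κ * δ * qq r u.1) * (μ * qq (Yf r) (u.2 - v.2)) +
              (κ * qq r u.1) * (μ * δ * qq (Yf r) u.2) := by gcongr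
          _ = _ := by ring
    _ = _ := by
        rw [lintegral_const_mul' _ _ ENNReal.ofReal_ne_top]
        congr 1
        have m1 := qq_meas r
        have m2 := qq_meas (Yf r)
        have m3 : Measurable (fun x => ENNReal.ofReal (qq (Yf r) (x - v.2))) :=
          m2.comp (measurable_id.sub_const _)
        rw [lintegral_add_left (by
          exact (m1.comp measurable_fst).mul (m3.comp measurable_snd)), lint_prod m1 m3, lint_prod m1 m2,
          qq_int hr, qq_int hY, qq_shift hY, ENNReal.ofReal_mul Real.pi_pos.le, two_mul]

lemma piece_tail0 (ha : Prof a κ r) (hb : Prof b μ (Yf r)) {X Z δ : ℝ} (hX : 0 < X) (hZ : 0 < Z)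
    (h1 : r ≤ δ * X) (h2 : Yf r ≤ δ * Z) :
    ∫⁻ u in {u : ℝ × ℝ | X < |u.1| ∨ Z < |u.2|}, ‖a u.1 * b u.2‖ₑ ≤
      ENNReal.ofReal (κ * μ * δ) * (4 * ENNReal.ofReal π) := by
  have hκ := ha.κ_nonneg
  have hμ := hb.κ_nonneg
  have hr := ha.s_pos
  have hY := hb.s_pos
  have hδ : 0 ≤ δ := by
    by_contra hh
    nlinarith [not_le.1 hh]
  have h1d : r / X ≤ δ := by rw [div_le_iff₀ hX]; exact h1
  have h2d : Yf r / Z ≤ δ := by rw [div_le_iff₀ hZ]; exact h2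
  have m1 := qq_meas r
  have m2 := qq_meas (Yf r)
  have hX1 : MeasurableSet {x : ℝ | X < |x|} := measurableSet_lt measurable_const (by fun_prop)
  have hZ1 : MeasurableSet {x : ℝ | Z < |x|} := measurableSet_lt measurable_const (by fun_prop)
  set fa : ℝ → ℝ≥0∞ := fun x => ENNReal.ofReal (qq r x) with hfa
  set fb : ℝ → ℝ≥0∞ := fun x => ENNReal.ofReal (qq (Yf r) x) with hfb
  have hpt : ∀ u : ℝ × ℝ, ({u : ℝ × ℝ | X < |u.1| ∨ Z < |u.2|}).indicator (fun u => ‖a u.1 * b u.2‖ₑ) u ≤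
      ENNReal.ofReal (κ * μ) * (({x : ℝ | X < |x|}).indicator fa u.1 * fb u.2 +
        fa u.1 * ({x : ℝ | Z < |x|}).indicator fb u.2) := by
    intro u
    by_cases hu : X < |u.1| ∨ Z < |u.2|
    · rw [Set.indicator_of_mem (show u ∈ {u : ℝ × ℝ | X < |u.1| ∨ Z < |u.2|} from hu)]
      have hb1 : ‖a u.1 * b u.2‖ₑ ≤ ENNReal.ofReal (κ * μ) * (fa u.1 * fb u.2) := by
        rw [hfa, hfb, ← ENNReal.ofReal_mul (qq_nonneg ha.s_pos _), ← ENNReal.ofReal_mul (by positivity)]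
        refine enorm_le_of ?_
        rw [norm_mul]
        have := ha.size u.1
        have := hb.size u.2
        have := qq_nonneg ha.s_pos u.1
        calc _ ≤ (κ * qq r u.1) * (μ * qq (Yf r) u.2) := by gcongr
          _ = _ := by ring
      refine hb1.trans ?_
      gcongr
      rcases hu with hu | hu
      · rw [Set.indicator_of_mem (show u.1 ∈ {x : ℝ | X < |x|} from hu)]
        exact le_self_add
      · rw [Set.indicator_of_mem (show u.2 ∈ {x : ℝ | Z < |x|} from hu)]
        exact le_add_self
    · rw [Set.indicator_of_notMem (show u ∉ {u : ℝ × ℝ | X < |u.1| ∨ Z < |u.2|} from hu)]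
      exact zero_le
  have hS : MeasurableSet {u : ℝ × ℝ | X < |u.1| ∨ Z < |u.2|} :=
    (measurable_fst hX1).union (measurable_snd hZ1)
  rw [← lintegral_indicator hS]
  refine (lintegral_mono hpt).trans ?_
  rw [lintegral_const_mul' _ _ ENNReal.ofReal_ne_top, lintegral_add_left (by
    exact ((m1.indicator hX1).comp measurable_fst).mul (m2.comp measurable_snd)),
    lint_prod (m1.indicator hX1) m2, lint_prod m1 (m2.indicator hZ1), lintegral_indicator hX1,
    lintegral_indicator hZ1]
  have t1 : ∫⁻ x in {x : ℝ | X < |x|}, fa x ≤ 2 * ENNReal.ofReal δ :=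
    (qq_tail hr hX).trans (by gcongr)
  have t2 : ∫⁻ x in {x : ℝ | Z < |x|}, fb x ≤ 2 * ENNReal.ofReal δ :=
    (qq_tail hY hZ).trans (by gcongr)
  have i1 : ∫⁻ x, fa x = ENNReal.ofReal π := qq_int hr
  have i2 : ∫⁻ x, fb x = ENNReal.ofReal π := qq_int hY
  rw [i1, i2]
  calc _ ≤ ENNReal.ofReal (κ * μ) * (2 * ENNReal.ofReal δ * ENNReal.ofReal π + ENNReal.ofReal π * (2 * ENNReal.ofReal δ)) := by
        gcongr
    _ = _ := by rw [ENNReal.ofReal_mul (p := κ * μ) (by positivity)]; ring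

lemma piece_tail (ham : Measurable a) (hbm : Measurable b) (ha : Prof a κ r) (hb : Prof b μ (Yf r)) {X Z δ : ℝ} (hX : 0 < X) (hZ : 0 < Z)
    (h1 : r ≤ δ * X) (h2 : Yf r ≤ δ * Z) {v : ℝ × ℝ} (hv1 : |v.1| ≤ X) (hv2 : |v.2| ≤ Z) :
    ∫⁻ u in {u : ℝ × ℝ | 2 * X < |u.1| ∨ 2 * Z < |u.2|}, ‖a (u.1 - v.1) * b (u.2 - v.2) - a u.1 * b u.2‖ₑ ≤
      ENNReal.ofReal (κ * μ * δ) * (8 * ENNReal.ofReal π) := by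
  have hX2 : MeasurableSet {x : ℝ | 2 * X < |x|} := measurableSet_lt measurable_const (by fun_prop)
  have hZ2 : MeasurableSet {x : ℝ | 2 * Z < |x|} := measurableSet_lt measurable_const (by fun_prop)
  have hX1 : MeasurableSet {x : ℝ | X < |x|} := measurableSet_lt measurable_const (by fun_prop)
  have hZ1 : MeasurableSet {x : ℝ | Z < |x|} := measurableSet_lt measurable_const (by fun_prop)
  set S1 : Set (ℝ × ℝ) := {u : ℝ × ℝ | X < |u.1| ∨ Z < |u.2|} with hS1
  set S2 : Set (ℝ × ℝ) := {u : ℝ × ℝ | 2 * X < |u.1| ∨ 2 * Z < |u.2|} with hS2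
  have mS1 : MeasurableSet S1 := (measurable_fst hX1).union (measurable_snd hZ1)
  have mS2 : MeasurableSet S2 := (measurable_fst hX2).union (measurable_snd hZ2)
  set k : ℝ × ℝ → ℝ≥0∞ := fun u => ‖a u.1 * b u.2‖ₑ with hk
  have hkm : Measurable k := ((ham.comp measurable_fst).mul (hbm.comp measurable_snd)).enorm
  have base : ∫⁻ u, S1.indicator k u ≤ ENNReal.ofReal (κ * μ * δ) * (4 * ENNReal.ofReal π) := by
    rw [lintegral_indicator mS1]; exact piece_tail0 ha hb hX hZ h1 h2
  have hpt : ∀ u, S2.indicator (fun u => ‖a (u.1 - v.1) * b (u.2 - v.2) - a u.1 * b u.2‖ₑ) u ≤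
      S1.indicator k (u - v) + S1.indicator k u := by
    intro u
    by_cases hu : u ∈ S2
    · have hu1 : u ∈ S1 := by
        rcases hu with hu | hu
        · left; linarith
        · right; linarith
      have hu2 : u - v ∈ S1 := by
        rcases hu with hu | hu
        · left; have := abs_sub_abs_le_abs_sub u.1 v.1; simp only [Prod.fst_sub]; linarith
        · right; have := abs_sub_abs_le_abs_sub u.2 v.2; simp only [Prod.snd_sub]; linarith
      rw [Set.indicator_of_mem hu, Set.indicator_of_mem hu1, Set.indicator_of_mem hu2]
      exact enorm_sub_le
    · rw [Set.indicator_of_notMem hu]; exact zero_le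
  rw [← lintegral_indicator mS2]
  refine (lintegral_mono hpt).trans ?_
  rw [lintegral_add_right _ (hkm.indicator mS1), lintegral_sub_right_eq_self (fun u => S1.indicator k u) v]
  calc _ ≤ ENNReal.ofReal (κ * μ * δ) * (4 * ENNReal.ofReal π) + ENNReal.ofReal (κ * μ * δ) * (4 * ENNReal.ofReal π) :=
        add_le_add base base
    _ = _ := by ring
end piece

/-- family of product pieces -/
structure Fam (a b : ℝ → ℝ → ℂ) (C : ℝ) : Prop where
  am : Measurable (fun q : ℝ × ℝ => a q.1 q.2)
  bm : Measurable (fun q : ℝ × ℝ => b q.1 q.2)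
  C_nonneg : 0 ≤ C
  prof : ∀ r, 0 < r → ∃ κ μ : ℝ, Prof (a r) κ r ∧ Prof (b r) μ (Yf r) ∧ κ * μ ≤ C / r

/-- the superposition kernel -/
def Kfam (a b : ℝ → ℝ → ℂ) (α β : ℝ) (z : ℝ × ℝ) : ℂ := ∫ r in Set.Ioc α β, a r z.1 * b r z.2

lemma le_Yf {r : ℝ} (hr : 0 < r) : r ≤ Yf r := by
  unfold Yf
  have : 1 ≤ √(1 + r) := Real.one_le_sqrt.2 (by linarith)
  nlinarith

lemma qq_le {s : ℝ} (hs : 0 < s) (x : ℝ) : qq s x ≤ s⁻¹ := by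
  unfold qq
  exact div_le_self (by positivity) (by nlinarith [sq_nonneg (x / s)])

section fam
variable {a b : ℝ → ℝ → ℂ} {C : ℝ}

lemma Fam.int_r (h : Fam a b C) {α β : ℝ} (hα : 0 < α) (z : ℝ × ℝ) :
    IntegrableOn (fun r => a r z.1 * b r z.2) (Set.Ioc α β) := by
  have hC := h.C_nonneg
  refine Measure.integrableOn_of_bounded (M := C / α * (α⁻¹ * α⁻¹)) (by simp) ?_ ?_
  · refine Measurable.aestronglyMeasurable (Measurable.mul ?_ ?_)
    · exact h.am.comp (measurable_id.prodMk measurable_const)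
    · exact h.bm.comp (measurable_id.prodMk measurable_const)
  · filter_upwards [ae_restrict_mem measurableSet_Ioc] with r hr
    have hr0 : 0 < r := hα.trans hr.1
    obtain ⟨κ, μ, pa, pb, hk⟩ := h.prof r hr0
    have h1 := pa.size z.1
    have h2 := pb.size z.2
    have h3 := qq_le pa.s_pos z.1
    have h4 := qq_le pb.s_pos z.2
    have := pa.κ_nonneg
    have := pb.κ_nonneg
    have := qq_nonneg pa.s_pos z.1
    have := qq_nonneg pb.s_pos z.2
    have h5 : (Yf r)⁻¹ ≤ α⁻¹ := inv_anti₀ hα (hr.1.le.trans (le_Yf hr0))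
    have h6 : r⁻¹ ≤ α⁻¹ := inv_anti₀ hα hr.1.le
    rw [norm_mul]
    calc _ ≤ (κ * qq r z.1) * (μ * qq (Yf r) z.2) := by gcongr
      _ ≤ (κ * α⁻¹) * (μ * α⁻¹) := by
          have h7 := h3.trans h6
          have h8 := h4.trans h5
          gcongr
      _ = (κ * μ) * (α⁻¹ * α⁻¹) := by ring
      _ ≤ (C / r) * (α⁻¹ * α⁻¹) := by gcongr
      _ ≤ _ := by gcongr; exact hr.1.le

lemma Fam.meas_diff (h : Fam a b C) (v : ℝ × ℝ) : Measurable (fun q : (ℝ × ℝ) × ℝ =>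
    ‖a q.2 (q.1.1 - v.1) * b q.2 (q.1.2 - v.2) - a q.2 q.1.1 * b q.2 q.1.2‖ₑ) := by
  have am := h.am
  have bm := h.bm
  refine Measurable.enorm (((?_ : Measurable _).mul ?_).sub ((?_ : Measurable _).mul ?_))
  · exact am.comp (measurable_snd.prodMk ((measurable_fst.comp measurable_fst).sub_const _))
  · exact bm.comp (measurable_snd.prodMk ((measurable_snd.comp measurable_fst).sub_const _))
  · exact am.comp (measurable_snd.prodMk (measurable_fst.comp measurable_fst))
  · exact bm.comp (measurable_snd.prodMk (measurable_snd.comp measurable_fst))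

lemma Fam.horm (h : Fam a b C) {α β : ℝ} (hα : 0 < α) :
    Horm (Kfam a b α β) (ENNReal.ofReal C * (16 * ENNReal.ofReal π + 2 * ENNReal.ofReal (π * π))) := by
  intro j v hv1 hv2
  have hC := h.C_nonneg
  set X := sx j with hX
  set Z := sy j with hZ
  have hX0 : 0 < X := sx_pos j
  have hZ0 : 0 < Z := sy_pos j
  have hXZ : Z ≤ Yf X := sy_le j
  have hXZ' : Yf X ≤ 2 * Z := le_sy j
  set S2 : Set (ℝ × ℝ) := {u : ℝ × ℝ | 2 * X < |u.1| ∨ 2 * Z < |u.2|} with hS2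
  set D : ℝ × ℝ → ℝ → ℂ := fun u r => a r (u.1 - v.1) * b r (u.2 - v.2) - a r u.1 * b r u.2 with hD
  have hDm := h.meas_diff v
  have ar : ∀ r, Measurable (a r) := fun r => h.am.comp (measurable_const.prodMk measurable_id)
  have br : ∀ r, Measurable (b r) := fun r => h.bm.comp (measurable_const.prodMk measurable_id)
  calc ∫⁻ u in S2, ‖Kfam a b α β (u - v) - Kfam a b α β u‖ₑ
      ≤ ∫⁻ u in S2, ∫⁻ r in Set.Ioc α β, ‖D u r‖ₑ := by
        refine lintegral_mono fun u => ?_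
        unfold Kfam
        rw [← integral_sub (h.int_r hα (u - v)) (h.int_r hα u)]
        exact enorm_integral_le_lintegral_enorm _
    _ = ∫⁻ r in Set.Ioc α β, ∫⁻ u in S2, ‖D u r‖ₑ :=
        lintegral_lintegral_swap hDm.aemeasurable
    _ ≤ ∫⁻ r in Set.Ioi 0, ∫⁻ u in S2, ‖D u r‖ₑ :=
        lintegral_mono_set fun r hr => hα.trans hr.1
    _ ≤ (∫⁻ r in Set.Ioo 0 X, ∫⁻ u in S2, ‖D u r‖ₑ) + ∫⁻ r in Set.Ici X, ∫⁻ u in S2, ‖D u r‖ₑ := by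
        rw [← Set.Ioo_union_Ici_eq_Ioi hX0]; exact lintegral_union_le _ _ _
    _ ≤ ENNReal.ofReal C * (16 * ENNReal.ofReal π) + ENNReal.ofReal C * (2 * ENNReal.ofReal (π * π)) := by
        refine add_le_add ?_ ?_
        · calc ∫⁻ r in Set.Ioo 0 X, ∫⁻ u in S2, ‖D u r‖ₑ
              ≤ ∫⁻ r in Set.Ioo 0 X, ENNReal.ofReal (C * (2 / X)) * (8 * ENNReal.ofReal π) := by
                refine setLIntegral_mono' measurableSet_Ioo fun r hr => ?_
                obtain ⟨κ, μ, pa, pb, hk⟩ := h.prof r hr.1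
                have hr0 := hr.1
                have hd1 : r ≤ (2 * r / X) * X := by rw [div_mul_cancel₀ _ hX0.ne']; linarith
                have hd2 : Yf r ≤ (2 * r / X) * Z := by
                  rw [div_mul_eq_mul_div, le_div_iff₀ hX0]
                  calc _ ≤ r * Yf X := Yf_mono hr.1 hr.2.le
                    _ ≤ r * (2 * Z) := by gcongr
                    _ = _ := by ring
                refine (piece_tail (ar r) (br r) pa pb hX0 hZ0 hd1 hd2 hv1 hv2).trans ?_
                refine mul_le_mul_left (ENNReal.ofReal_le_ofReal ?_) _
                calc κ * μ * (2 * r / X) ≤ C / r * (2 * r / X) := by gcongr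
                  _ = _ := by field_simp
            _ = _ := by
                rw [setLIntegral_const, Real.volume_Ioo, sub_zero]
                calc ENNReal.ofReal (C * (2 / X)) * (8 * ENNReal.ofReal π) * ENNReal.ofReal X
                    = (ENNReal.ofReal (C * (2 / X)) * ENNReal.ofReal X) * (8 * ENNReal.ofReal π) := by ring
                  _ = (ENNReal.ofReal C * ENNReal.ofReal 2) * (8 * ENNReal.ofReal π) := by
                      rw [← ENNReal.ofReal_mul (by positivity), ← ENNReal.ofReal_mul hC]
                      congr 2; field_simp
                  _ = _ := by
                      rw [show ENNReal.ofReal 2 = 2 by simp]; ring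
            _ ≤ _ := le_rfl
        · calc ∫⁻ r in Set.Ici X, ∫⁻ u in S2, ‖D u r‖ₑ
              ≤ ∫⁻ r in Set.Ici X, ENNReal.ofReal (C * X) * (2 * ENNReal.ofReal (π * π)) *
                  ENNReal.ofReal (r ^ (-2 : ℝ)) := by
                refine setLIntegral_mono' measurableSet_Ici fun r hr => ?_
                have hr' : X ≤ r := hr
                have hr0 : 0 < r := hX0.trans_le hr
                obtain ⟨κ, μ, pa, pb, hk⟩ := h.prof r hr0
                have hd1 : |v.1| ≤ (X / r) * r := by rw [div_mul_cancel₀ _ hr0.ne']; exact hv1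
                have hd2 : |v.2| ≤ (X / r) * Yf r := by
                  rw [div_mul_eq_mul_div, le_div_iff₀ hr0]
                  calc _ ≤ Yf X * r := by gcongr; linarith
                    _ ≤ _ := Yf_mono hX0 hr'
                refine (setLIntegral_le_lintegral _ _).trans ?_
                refine (piece_smooth pa pb hd1 hd2 ((div_le_one hr0).2 hr') (by positivity)).trans ?_
                rw [mul_right_comm (ENNReal.ofReal (C * X)), ← ENNReal.ofReal_mul (by positivity)]
                refine mul_le_mul_left (ENNReal.ofReal_le_ofReal ?_) _
                rw [Real.rpow_neg hr0.le, Real.rpow_two]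
                calc κ * μ * (X / r) ≤ C / r * (X / r) := by gcongr
                  _ = _ := by field_simp
            _ = _ := by
                rw [lintegral_const_mul _ (by fun_prop), lint_rpow_Ici hX0 (by norm_num), mul_right_comm,
                  ← ENNReal.ofReal_mul (by positivity)]
                congr 2
                rw [show (-2 : ℝ) + 1 = -1 by norm_num, Real.rpow_neg_one]; field_simp
            _ ≤ _ := le_rfl
    _ = _ := by ring

lemma Fam.int_K (h : Fam a b C) {α β : ℝ} (hα : 0 < α) (hKm : AEStronglyMeasurable (Kfam a b α β) volume) :
    Integrable (Kfam a b α β) := by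
  have hC := h.C_nonneg
  refine ⟨hKm, ?_⟩
  have hm : Measurable (fun q : (ℝ × ℝ) × ℝ => ‖a q.2 q.1.1 * b q.2 q.1.2‖ₑ) := by
    refine Measurable.enorm ((?_ : Measurable _).mul ?_)
    · exact h.am.comp (measurable_snd.prodMk (measurable_fst.comp measurable_fst))
    · exact h.bm.comp (measurable_snd.prodMk (measurable_snd.comp measurable_fst))
  have key : ∫⁻ u, ‖Kfam a b α β u‖ₑ ≤ ENNReal.ofReal (C / α) * ENNReal.ofReal (π * π) * ENNReal.ofReal (β - α) := by
    calc ∫⁻ u, ‖Kfam a b α β u‖ₑ ≤ ∫⁻ u : ℝ × ℝ, ∫⁻ r in Set.Ioc α β, ‖a r u.1 * b r u.2‖ₑ :=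
          lintegral_mono fun u => enorm_integral_le_lintegral_enorm _
      _ = ∫⁻ r in Set.Ioc α β, ∫⁻ u : ℝ × ℝ, ‖a r u.1 * b r u.2‖ₑ :=
          lintegral_lintegral_swap hm.aemeasurable
      _ ≤ ∫⁻ r in Set.Ioc α β, ENNReal.ofReal (C / α) * ENNReal.ofReal (π * π) := by
          refine setLIntegral_mono' measurableSet_Ioc fun r hr => ?_
          obtain ⟨κ, μ, pa, pb, hk⟩ := h.prof r (hα.trans hr.1)
          refine (piece_int pa pb).trans ?_
          gcongr
          refine hk.trans ?_
          gcongr; exact hr.1.le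
      _ = _ := by rw [setLIntegral_const, Real.volume_Ioc]
  exact key.trans_lt (ENNReal.mul_lt_top (ENNReal.mul_lt_top ENNReal.ofReal_lt_top ENNReal.ofReal_lt_top)
    ENNReal.ofReal_lt_top)
end fam

def rho (r u : ℝ) : ℝ := (1 + r) / (r + u)
def EE (r u : ℝ) : ℝ := u ^ 3 * rho r u
def th (r u : ℝ) : ℝ := u / (r + u)
def GG (r : ℝ) (k : ℕ) (u : ℝ) : ℝ := u ^ k * rho r u * rexp (-EE r u)
def q1 (r : ℝ) (n : ℕ) (u : ℝ) : ℝ := (n + 2 - th r u) - (3 - th r u) * EE r u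
def q2 (r : ℝ) (n : ℕ) (u : ℝ) : ℝ := (q1 r n u - 1) * q1 r n u +
  (-(th r u * (1 - th r u)) + th r u * (1 - th r u) * EE r u - (3 - th r u) ^ 2 * EE r u)

section half
variable {r u : ℝ}

lemma rho_pos (hr : 0 < r) (hu : 0 ≤ u) : 0 < rho r u := by unfold rho; positivity
lemma EE_nonneg (hr : 0 < r) (hu : 0 ≤ u) : 0 ≤ EE r u := by
  have := rho_pos hr hu
  unfold EE; positivity
lemma th_nonneg (hr : 0 < r) (hu : 0 ≤ u) : 0 ≤ th r u := by unfold th; positivity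
lemma th_le (hr : 0 < r) (hu : 0 ≤ u) : th r u ≤ 1 := by
  unfold th; rw [div_le_one (by positivity)]; linarith
lemma GG_nonneg (hr : 0 < r) (hu : 0 ≤ u) (k : ℕ) : 0 ≤ GG r k u := by
  have := rho_pos hr hu
  unfold GG; positivity

lemma hE_deriv (hr : 0 < r) (hu : 0 < u) : HasDerivAt (EE r) (EE r u * (3 - th r u) / u) u := by
  have hne : r + u ≠ 0 := by positivity
  have h1 : HasDerivAt (fun u : ℝ => r + u) 1 u := by simpa using (hasDerivAt_id u).const_add r
  have h2 := (hasDerivAt_pow 3 u).mul ((hasDerivAt_const u (1 + r)).div h1 hne)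
  refine h2.congr_deriv ?_
  simp only [EE, rho, th, Pi.div_apply]
  field_simp
  norm_num
  ring

lemma hth_deriv (hr : 0 < r) (hu : 0 < u) : HasDerivAt (th r) (th r u * (1 - th r u) / u) u := by
  have hne : r + u ≠ 0 := by positivity
  have h1 : HasDerivAt (fun u : ℝ => r + u) 1 u := by simpa using (hasDerivAt_id u).const_add r
  have h2 := (hasDerivAt_id u).div h1 hne
  refine h2.congr_deriv ?_
  simp only [th, id]
  field_simp

lemma hrho_deriv (hr : 0 < r) (hu : 0 < u) : HasDerivAt (rho r) (-(rho r u * th r u / u)) u := by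
  have hne : r + u ≠ 0 := by positivity
  have h1 : HasDerivAt (fun u : ℝ => r + u) 1 u := by simpa using (hasDerivAt_id u).const_add r
  have h2 := (hasDerivAt_const u (1 + r)).div h1 hne
  refine h2.congr_deriv ?_
  simp only [th, rho]
  field_simp
  ring

lemma hG_deriv (hr : 0 < r) (hu : 0 < u) (k : ℕ) : HasDerivAt (GG r (k + 1))
    (GG r k u * ((k + 1 : ℝ) - th r u - (3 - th r u) * EE r u)) u := by
  have h2 := ((hasDerivAt_pow (k + 1) u).mul (hrho_deriv hr hu)).mul (hE_deriv hr hu).neg.exp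
  refine h2.congr_deriv ?_
  simp only [GG, Pi.neg_apply, Pi.mul_apply]
  push_cast
  simp only [Nat.add_sub_cancel, pow_succ]
  field_simp
  ring

lemma hF1 (hr : 0 < r) (hu : 0 < u) (n : ℕ) : HasDerivAt (GG r (n + 2)) (GG r (n + 1) u * q1 r n u) u := by
  refine (hG_deriv hr hu (n + 1)).congr_deriv ?_
  simp only [q1]; push_cast; ring

lemma hF2 (hr : 0 < r) (hu : 0 < u) (n : ℕ) :
    HasDerivAt (fun u => GG r (n + 1) u * q1 r n u) (GG r n u * q2 r n u) u := by
  have hq : HasDerivAt (q1 r n) ((-(th r u * (1 - th r u)) + th r u * (1 - th r u) * EE r u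
      - (3 - th r u) ^ 2 * EE r u) / u) u := by
    have h3 := ((hth_deriv hr hu).const_sub ((n : ℝ) + 2)).sub
      (((hth_deriv hr hu).const_sub 3).mul (hE_deriv hr hu))
    refine h3.congr_deriv ?_
    field_simp
    ring
  refine ((hG_deriv hr hu n).mul hq).congr_deriv ?_
  have e : GG r (n + 1) u = u * GG r n u := by simp only [GG, pow_succ]; ring
  rw [e]
  simp only [q2]
  have : q1 r n u - 1 = (n + 1 : ℝ) - th r u - (3 - th r u) * EE r u := by simp only [q1]; ring
  rw [this]
  field_simp

lemma q1_bd (hr : 0 < r) (hu : 0 ≤ u) {n : ℕ} (hn : n ≤ 2) : |q1 r n u| ≤ 4 + 3 * EE r u := by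
  have h1 := th_nonneg hr hu
  have h2 := th_le hr hu
  have h3 := EE_nonneg hr hu
  have h4 : (n : ℝ) ≤ 2 := by exact_mod_cast hn
  have h5 : (0 : ℝ) ≤ n := by positivity
  have h6 := mul_nonneg h1 h3
  have h7 := mul_nonneg (sub_nonneg.2 h2) h3
  rw [abs_le]; unfold q1; constructor <;> nlinarith

lemma q2_bd (hr : 0 < r) (hu : 0 ≤ u) {n : ℕ} (hn : n ≤ 2) :
    |q2 r n u| ≤ 21 + 37 * EE r u + 9 * EE r u ^ 2 := by
  have h0 := q1_bd hr hu hn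
  have h1 := th_nonneg hr hu
  have h2 := th_le hr hu
  have h3 := EE_nonneg hr hu
  unfold q2
  set q := q1 r n u
  set t := th r u
  set E := EE r u
  have a1 : |(q - 1) * q| ≤ (4 + 3 * E) ^ 2 + (4 + 3 * E) := by
    have e : (q - 1) * q = q ^ 2 - q := by ring
    rw [e]
    refine (abs_sub _ _).trans ?_
    rw [abs_pow]
    gcongr
  have a2 : |-(t * (1 - t)) + t * (1 - t) * E - (3 - t) ^ 2 * E| ≤ 1 + 10 * E := by
    have b1 : 0 ≤ t * (1 - t) := mul_nonneg h1 (by linarith)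
    have b2 : t * (1 - t) ≤ 1 := by nlinarith
    have b3 : (3 - t) ^ 2 ≤ 9 := by nlinarith
    have b4 : 0 ≤ (3 - t) ^ 2 := sq_nonneg _
    have b5 := mul_nonneg b1 h3
    have b6 := mul_nonneg b4 h3
    have b7 := mul_le_mul_of_nonneg_right b2 h3
    have b8 := mul_le_mul_of_nonneg_right b3 h3
    rw [abs_le]; constructor <;> linarith
  refine (abs_add_le _ _).trans ((add_le_add a1 a2).trans ?_)
  nlinarith

lemma q2_bd0 (hr : 0 < r) (hu : 0 ≤ u) (hE : EE r u ≤ 1) :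
    |q2 r 0 u| ≤ 2 * (1 - th r u) ^ 2 + 34 * EE r u := by
  have h1 := th_nonneg hr hu
  have h2 := th_le hr hu
  have h3 := EE_nonneg hr hu
  unfold q2 q1
  set t := th r u
  set E := EE r u
  set R := -2 * (2 - t) * (3 - t) + (3 - t) ^ 2 * E + (3 - t) + t * (1 - t) - (3 - t) ^ 2 with hR
  have e : (((0 : ℕ) : ℝ) + 2 - t - (3 - t) * E - 1) * (((0 : ℕ) : ℝ) + 2 - t - (3 - t) * E) +
      (-(t * (1 - t)) + t * (1 - t) * E - (3 - t) ^ 2 * E) = 2 * (1 - t) ^ 2 + E * R := by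
    rw [hR]; push_cast; ring
  rw [e]
  have hRb : |R| ≤ 34 := by
    have b3 : (3 - t) ^ 2 ≤ 9 := by nlinarith
    have b4 : 0 ≤ (3 - t) ^ 2 := sq_nonneg _
    have b5 : (3 - t) ^ 2 * E ≤ 9 := by nlinarith
    have b6 := mul_nonneg b4 h3
    have b7 : 0 ≤ (2 - t) * (3 - t) := by nlinarith
    have b8 : (2 - t) * (3 - t) ≤ 6 := by nlinarith
    have b9 : 0 ≤ t * (1 - t) := mul_nonneg h1 (by linarith)
    have b10 : t * (1 - t) ≤ 1 := by nlinarith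
    rw [abs_le, hR]; constructor <;> nlinarith
  refine (abs_add_le _ _).trans ?_
  rw [abs_mul E R, abs_of_nonneg h3, abs_of_nonneg (by positivity : (0 : ℝ) ≤ 2 * (1 - t) ^ 2)]
  nlinarith

lemma urho_le (hr : 0 < r) (hu : 0 ≤ u) (hu1 : u ≤ 1) : u * rho r u ≤ 1 := by
  unfold rho; rw [← mul_div_assoc, div_le_one (by positivity)]; nlinarith

lemma EE_le (hr : 0 < r) (hu : 0 ≤ u) (hu1 : u ≤ 1) : EE r u ≤ u ^ 2 := by
  have := urho_le hr hu hu1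
  have e : EE r u = u ^ 2 * (u * rho r u) := by unfold EE; ring
  rw [e]; nlinarith [sq_nonneg u]

lemma le_EE (hr : 0 < r) (hu1 : 1 ≤ u) : u ^ 2 ≤ EE r u := by
  have h : 1 ≤ u * rho r u := by
    unfold rho; rw [← mul_div_assoc, one_le_div (by positivity)]; nlinarith
  have e : EE r u = u ^ 2 * (u * rho r u) := by unfold EE; ring
  rw [e]; nlinarith [sq_nonneg u]

lemma pow_exp_le {x : ℝ} (hx : 0 ≤ x) (k : ℕ) : x ^ k * rexp (-x) ≤ k.factorial := by
  have h := Real.pow_div_factorial_le_exp x hx k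
  rw [Real.exp_neg, ← div_eq_mul_inv, div_le_iff₀ (Real.exp_pos x)]
  rw [div_le_iff₀ (by positivity)] at h
  linarith

lemma GG_small (hr : 0 < r) (hu : 0 ≤ u) (hu1 : u ≤ 1) (k : ℕ) : GG r (k + 1) u ≤ 1 := by
  have h1 := urho_le hr hu hu1
  have h2 := rho_pos hr hu
  have h3 : rexp (-EE r u) ≤ 1 := Real.exp_le_one_iff.2 (neg_nonpos.2 (EE_nonneg hr hu))
  have h4 : u ^ k ≤ 1 := pow_le_one₀ hu hu1
  have e : GG r (k + 1) u = u ^ k * (u * rho r u) * rexp (-EE r u) := by unfold GG; ring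
  rw [e]
  have h5 : 0 ≤ u * rho r u := by positivity
  calc u ^ k * (u * rho r u) * rexp (-EE r u) ≤ 1 * 1 * 1 := by gcongr
    _ = 1 := by norm_num

lemma GG_big (hr : 0 < r) (hu1 : 1 ≤ u) {k : ℕ} (hk : k ≤ 3) : GG r k u ≤ EE r u * rexp (-EE r u) := by
  have h2 := rho_pos hr (zero_le_one.trans hu1)
  unfold GG
  have : u ^ k * rho r u ≤ EE r u := by unfold EE; gcongr
  gcongr

lemma inv_EE (hr : 0 < r) (hu1 : 1 ≤ u) {c : ℝ} {x : ℝ} (hx : EE r u * x ≤ c) (hc : 0 ≤ c) :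
    x ≤ c / u ^ 2 := by
  have h := le_EE hr hu1
  have hu : 0 < u ^ 2 := by positivity
  rw [le_div_iff₀ hu]
  rcases le_or_gt x 0 with h0 | h0
  · nlinarith
  · nlinarith

lemma F_big (hr : 0 < r) (hu1 : 1 ≤ u) {n : ℕ} (hn : n ≤ 2) : GG r (n + 2) u ≤ 6 / u ^ 2 := by
  have hu0 : 0 ≤ u := zero_le_one.trans hu1
  have hE := EE_nonneg hr hu0
  have hle := le_EE hr hu1
  have p3 := pow_exp_le hE 3
  norm_num [Nat.factorial] at p3
  refine inv_EE hr hu1 ?_ (by norm_num)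
  have e1 : GG r (n + 2) u ≤ u * GG r 3 u := by
    have h2 := rho_pos hr hu0
    have e : u * GG r 3 u = u ^ 4 * rho r u * rexp (-EE r u) := by unfold GG; ring
    rw [e]; unfold GG; gcongr
    lia
  have e2 := GG_big hr hu1 (le_refl 3)
  have e3 : u ≤ EE r u := by nlinarith
  have e4 := Real.exp_pos (-EE r u)
  have g3 := GG_nonneg hr hu0 3
  calc EE r u * GG r (n + 2) u ≤ EE r u * (EE r u * (EE r u * rexp (-EE r u))) := by
        refine mul_le_mul_of_nonneg_left (e1.trans ?_) hE
        gcongr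
    _ = EE r u ^ 3 * rexp (-EE r u) := by ring
    _ ≤ 6 := p3

lemma F1_big (hr : 0 < r) (hu1 : 1 ≤ u) {n : ℕ} (hn : n ≤ 2) : |GG r (n + 1) u * q1 r n u| ≤ 26 / u ^ 2 := by
  have hu0 : 0 ≤ u := zero_le_one.trans hu1
  have hE := EE_nonneg hr hu0
  have p3 := pow_exp_le hE 3
  have p2 := pow_exp_le hE 2
  norm_num [Nat.factorial] at p3 p2
  refine inv_EE hr hu1 ?_ (by norm_num)
  have e2 := GG_big hr hu1 (show n + 1 ≤ 3 by lia)
  have e3 := q1_bd hr hu0 hn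
  rw [abs_mul, abs_of_nonneg (GG_nonneg hr hu0 _)]
  calc EE r u * (GG r (n + 1) u * |q1 r n u|) ≤ EE r u * ((EE r u * rexp (-EE r u)) * (4 + 3 * EE r u)) := by
        gcongr
    _ = 4 * (EE r u ^ 2 * rexp (-EE r u)) + 3 * (EE r u ^ 3 * rexp (-EE r u)) := by ring
    _ ≤ 26 := by linarith

lemma F2_big (hr : 0 < r) (hu1 : 1 ≤ u) {n : ℕ} (hn : n ≤ 2) : |GG r n u * q2 r n u| ≤ 480 / u ^ 2 := by
  have hu0 : 0 ≤ u := zero_le_one.trans hu1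
  have hE := EE_nonneg hr hu0
  have p4 := pow_exp_le hE 4
  have p3 := pow_exp_le hE 3
  have p2 := pow_exp_le hE 2
  norm_num [Nat.factorial] at p3 p2 p4
  refine inv_EE hr hu1 ?_ (by norm_num)
  have e2 := GG_big hr hu1 (show n ≤ 3 by lia)
  have e3 := q2_bd hr hu0 hn
  rw [abs_mul, abs_of_nonneg (GG_nonneg hr hu0 _)]
  calc EE r u * (GG r n u * |q2 r n u|) ≤ EE r u * ((EE r u * rexp (-EE r u)) * (21 + 37 * EE r u + 9 * EE r u ^ 2)) := by
        gcongr
    _ = 21 * (EE r u ^ 2 * rexp (-EE r u)) + 37 * (EE r u ^ 3 * rexp (-EE r u)) +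
          9 * (EE r u ^ 4 * rexp (-EE r u)) := by ring
    _ ≤ 480 := by linarith

lemma F2_small (hr : 0 < r) (hu : 0 < u) (hu1 : u ≤ 1) {n : ℕ} (hn : n ≤ 2) :
    |GG r n u * q2 r n u| ≤ 67 + 2 * ((1 + r) * r ^ 2 / (r + u) ^ 3) := by
  have hE := EE_nonneg hr hu.le
  have hE2 := EE_le hr hu.le hu1
  have hE1 : EE r u ≤ 1 := hE2.trans (pow_le_one₀ hu.le hu1)
  have hx : 0 ≤ 2 * ((1 + r) * r ^ 2 / (r + u) ^ 3) := by positivity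
  rw [abs_mul, abs_of_nonneg (GG_nonneg hr hu.le _)]
  rcases n with _ | n
  · have h := q2_bd0 hr hu.le hE1
    have h3 : rexp (-EE r u) ≤ 1 := Real.exp_le_one_iff.2 (neg_nonpos.2 hE)
    have h4 := rho_pos hr hu.le
    have e0 : GG r 0 u ≤ rho r u := by
      unfold GG; rw [pow_zero, one_mul]; nlinarith
    have e1 : rho r u * (2 * (1 - th r u) ^ 2) = 2 * ((1 + r) * r ^ 2 / (r + u) ^ 3) := by
      unfold rho th; field_simp; ring
    have e2 : rho r u * EE r u ≤ 1 := by
      have h5 := urho_le hr hu.le hu1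
      calc rho r u * EE r u = u * (u * rho r u) * (u * rho r u) := by unfold EE; ring
        _ ≤ 1 * 1 * 1 := by gcongr
        _ = 1 := by norm_num
    calc GG r 0 u * |q2 r 0 u| ≤ rho r u * (2 * (1 - th r u) ^ 2 + 34 * EE r u) := by gcongr
      _ = rho r u * (2 * (1 - th r u) ^ 2) + 34 * (rho r u * EE r u) := by ring
      _ ≤ _ := by rw [e1]; linarith
  · have h := q2_bd hr hu.le hn
    have h1 := GG_small hr hu.le hu1 n
    have h2 : |q2 r (n + 1) u| ≤ 67 := h.trans (by nlinarith)
    calc GG r (n + 1) u * |q2 r (n + 1) u| ≤ 1 * 67 := by gcongr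
      _ ≤ 67 + 2 * ((1 + r) * r ^ 2 / (r + u) ^ 3) := by linarith
end half

lemma int_inv_sq (c : ℝ) : IntegrableOn (fun u : ℝ => c / u ^ 2) (Set.Ioi 1) ∧
    ∫ u in Set.Ioi (1 : ℝ), c / u ^ 2 = c := by
  have e : ∀ u ∈ Set.Ioi (1 : ℝ), c / u ^ 2 = c * u ^ (-2 : ℝ) := by
    intro u hu
    have h0 : 0 < u := zero_lt_one.trans hu
    rw [Real.rpow_neg h0.le, Real.rpow_two, div_eq_mul_inv]
  constructor
  · refine IntegrableOn.congr_fun ?_ (fun u hu => (e u hu).symm) measurableSet_Ioi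
    exact (integrableOn_Ioi_rpow_of_lt (by norm_num) one_pos).const_mul c
  · rw [setIntegral_congr_fun measurableSet_Ioi e, integral_const_mul,
      integral_Ioi_rpow_of_lt (by norm_num) one_pos]
    norm_num

lemma split_bound {f g : ℝ → ℝ} {c₁ c₂ : ℝ} (hf : Measurable f)
    (hg : IntegrableOn g (Set.Ioc 0 1)) (hgi : ∫ u in Set.Ioc (0 : ℝ) 1, g u ≤ c₁)
    (h1 : ∀ u, 0 < u → u ≤ 1 → |f u| ≤ g u) (h2 : ∀ u, 1 ≤ u → |f u| ≤ c₂ / u ^ 2) :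
    IntegrableOn f (Set.Ioi 0) ∧ ∫ u in Set.Ioi (0 : ℝ), |f u| ≤ c₁ + c₂ := by
  obtain ⟨i2, v2⟩ := int_inv_sq c₂
  have a1 : IntegrableOn f (Set.Ioc 0 1) := by
    refine Integrable.mono' hg hf.aestronglyMeasurable ?_
    exact (ae_restrict_iff' measurableSet_Ioc).2 (Eventually.of_forall fun u hu => h1 u hu.1 hu.2)
  have a2 : IntegrableOn f (Set.Ioi 1) := by
    refine Integrable.mono' i2 hf.aestronglyMeasurable ?_
    exact (ae_restrict_iff' measurableSet_Ioi).2 (Eventually.of_forall fun u hu => h2 u (le_of_lt hu))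
  have eU : Set.Ioc (0 : ℝ) 1 ∪ Set.Ioi 1 = Set.Ioi 0 := Set.Ioc_union_Ioi_eq_Ioi zero_le_one
  rw [← eU]
  refine ⟨a1.union a2, ?_⟩
  rw [setIntegral_union (Set.Ioc_disjoint_Ioi le_rfl) measurableSet_Ioi a1.abs a2.abs]
  refine add_le_add ?_ ?_
  · refine le_trans ?_ hgi
    exact setIntegral_mono_on a1.abs hg measurableSet_Ioc fun u hu => h1 u hu.1 hu.2
  · rw [← v2]
    exact setIntegral_mono_on a2.abs i2 measurableSet_Ioi fun u hu => h2 u (le_of_lt hu)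

lemma GG_meas2 (k : ℕ) : Measurable fun q : ℝ × ℝ => GG q.1 k q.2 := by
  unfold GG EE rho; fun_prop
lemma GG_meas (r : ℝ) (k : ℕ) : Measurable (GG r k) := by
  unfold GG EE rho; fun_prop
lemma q1_meas (r : ℝ) (k : ℕ) : Measurable (q1 r k) := by
  unfold q1 EE rho th; fun_prop
lemma q2_meas (r : ℝ) (k : ℕ) : Measurable (q2 r k) := by
  unfold q2 q1 EE rho th; fun_prop

lemma F_int {r : ℝ} (hr : 0 < r) {n : ℕ} (hn : n ≤ 2) : IntegrableOn (GG r (n + 2)) (Set.Ioi 0) ∧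
    ∫ u in Set.Ioi (0 : ℝ), |GG r (n + 2) u| ≤ 7 := by
  have h := split_bound (f := GG r (n + 2)) (g := fun _ => 1) (c₁ := 1) (c₂ := 6) (GG_meas r _)
    (by simp) (by simp)
    (fun u h0 h1 => by rw [abs_of_nonneg (GG_nonneg hr h0.le _)]; exact GG_small hr h0.le h1 _)
    (fun u h1 => by
      rw [abs_of_nonneg (GG_nonneg hr (zero_le_one.trans h1) _)]; exact F_big hr h1 hn)
  exact ⟨h.1, h.2.trans (by norm_num)⟩

lemma F2_int {r : ℝ} (hr : 0 < r) {n : ℕ} (hn : n ≤ 2) :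
    IntegrableOn (fun u => GG r n u * q2 r n u) (Set.Ioi 0) ∧
    ∫ u in Set.Ioi (0 : ℝ), |GG r n u * q2 r n u| ≤ 560 := by
  have hc : ContinuousOn (fun u : ℝ => 67 + 2 * ((1 + r) * r ^ 2 / (r + u) ^ 3)) (Set.Icc 0 1) := by
    intro u hu
    have : (r + u) ^ 3 ≠ 0 := by have := hu.1; positivity
    refine ContinuousAt.continuousWithinAt ?_
    fun_prop (disch := assumption)
  have hd : ∀ u ∈ Set.uIcc (0 : ℝ) 1, HasDerivAt (fun u : ℝ => 67 * u - (1 + r) * r ^ 2 / (r + u) ^ 2)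
      (67 + 2 * ((1 + r) * r ^ 2 / (r + u) ^ 3)) u := by
    intro u hu
    rw [Set.uIcc_of_le zero_le_one] at hu
    have h0 : 0 < r + u := by have := hu.1; positivity
    have h1 : HasDerivAt (fun u : ℝ => r + u) 1 u := by simpa using (hasDerivAt_id u).const_add r
    have h2 := ((hasDerivAt_id u).const_mul 67).sub
      ((hasDerivAt_const u ((1 + r) * r ^ 2)).div (h1.pow 2) (pow_pos h0 2).ne')
    refine h2.congr_deriv ?_
    simp
    field_simp
    ring
  have hii : IntervalIntegrable (fun u : ℝ => 67 + 2 * ((1 + r) * r ^ 2 / (r + u) ^ 3)) volume 0 1 := by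
    refine ContinuousOn.intervalIntegrable ?_
    rwa [Set.uIcc_of_le zero_le_one]
  have hval := intervalIntegral.integral_eq_sub_of_hasDerivAt hd hii
  rw [intervalIntegral.integral_of_le zero_le_one] at hval
  have h := split_bound (f := fun u => GG r n u * q2 r n u)
    (g := fun u => 67 + 2 * ((1 + r) * r ^ 2 / (r + u) ^ 3)) (c₁ := 69) (c₂ := 480)
    ((GG_meas r _).mul (q2_meas r _))
    ((intervalIntegrable_iff_integrableOn_Ioc_of_le zero_le_one).1 hii)
    (by
      rw [hval]
      have e : (1 + r) * r ^ 2 / (r + 0) ^ 2 = 1 + r := by field_simp; ring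
      have e2 : r - 1 ≤ (1 + r) * r ^ 2 / (r + 1) ^ 2 := by
        rw [le_div_iff₀ (by positivity)]; nlinarith
      rw [e]; linarith)
    (fun u h0 h1 => F2_small hr h0 h1 hn)
    (fun u h1 => F2_big hr h1 hn)
  exact ⟨h.1, h.2.trans (by norm_num)⟩

lemma GG_cont0 {r : ℝ} (hr : 0 < r) (k : ℕ) : ContinuousAt (GG r k) 0 := by
  have : r + 0 ≠ 0 := by positivity
  unfold GG EE rho
  fun_prop (disch := assumption)

lemma q1_cont0 {r : ℝ} (hr : 0 < r) (k : ℕ) : ContinuousAt (q1 r k) 0 := by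
  have : r + 0 ≠ 0 := by positivity
  unfold q1 EE rho th
  fun_prop (disch := assumption)

lemma tendsto_of_sq {f : ℝ → ℝ} {c : ℝ} (h : ∀ u, 1 ≤ u → |f u| ≤ c / u ^ 2) : Tendsto f atTop (𝓝 0) := by
  refine squeeze_zero_norm' (a := fun u : ℝ => c / u ^ 2) ?_ ?_
  · filter_upwards [eventually_ge_atTop 1] with u hu using h u hu
  · exact Tendsto.div_atTop tendsto_const_nhds (tendsto_pow_atTop (by norm_num))

lemma osc_bound {F F1 F2 : ℝ → ℝ} (hF0 : ContinuousAt F 0) (hF10 : ContinuousAt F1 0)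
    (z0 : F 0 = 0) (z1 : F1 0 = 0)
    (hd : ∀ u, 0 < u → HasDerivAt F (F1 u) u) (hd1 : ∀ u, 0 < u → HasDerivAt F1 (F2 u) u)
    (ht : Tendsto F atTop (𝓝 0)) (ht1 : Tendsto F1 atTop (𝓝 0))
    (hi : IntegrableOn F (Set.Ioi 0)) (hi2 : IntegrableOn F2 (Set.Ioi 0)) {x : ℝ} (hx : x ≠ 0) :
    ‖∫ u in Set.Ioi (0 : ℝ), Complex.exp ((2 * π * (x * u)) * Complex.I) * (F u : ℂ)‖ ≤
      (∫ u in Set.Ioi (0 : ℝ), |F2 u|) / (2 * π * x) ^ 2 := by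
  set e : ℝ → ℂ := fun u => Complex.exp ((2 * π * (x * u)) * Complex.I) with he
  set ω : ℂ := 2 * π * x * Complex.I with hω
  have hω0 : ω ≠ 0 := by
    rw [hω]; simp [hx, Real.pi_ne_zero]
  have hωi : ω⁻¹ * ω = 1 := inv_mul_cancel₀ hω0
  have en : ∀ u, ‖e u‖ = 1 := by
    intro u
    have : ((2 * π * (x * u)) * Complex.I : ℂ) = ((2 * π * (x * u) : ℝ) : ℂ) * Complex.I := by push_cast; ring
    rw [he]; simp only [this, Complex.norm_exp_ofReal_mul_I]
  have ec : Continuous e := by rw [he]; fun_prop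
  have ed : ∀ u : ℝ, HasDerivAt e (ω * e u) u := by
    intro u
    have h1 : HasDerivAt (fun u : ℝ => (u : ℂ)) 1 u := Complex.ofRealCLM.hasDerivAt
    have h2 := (((h1.const_mul (x : ℂ)).const_mul (2 * π : ℂ)).mul_const Complex.I).cexp
    refine h2.congr_deriv ?_
    rw [hω, he]; ring
  have I1 : IntegrableOn (fun u => e u * (F u : ℂ)) (Set.Ioi 0) := by
    refine (hi.ofReal (𝕜 := ℂ)).bdd_mul (c := 1) ec.aestronglyMeasurable (Eventually.of_forall fun u => (en u).le)
  have I2 : IntegrableOn (fun u => e u * (F2 u : ℂ)) (Set.Ioi 0) := by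
    refine (hi2.ofReal (𝕜 := ℂ)).bdd_mul (c := 1) ec.aestronglyMeasurable (Eventually.of_forall fun u => (en u).le)
  have zt : ∀ G : ℝ → ℝ, Tendsto G atTop (𝓝 0) → Tendsto (fun u => e u * (G u : ℂ)) atTop (𝓝 0) := by
    intro G hG
    refine squeeze_zero_norm (a := fun u => ‖G u‖) (fun u => ?_) (by simpa using hG.norm)
    rw [norm_mul, en, one_mul, Complex.norm_real]
  have hn : ‖ω‖ ^ 2 = (2 * π * x) ^ 2 := by
    rw [hω, norm_mul, Complex.norm_I, mul_one, ← sq_abs (2 * π * x)]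
    congr 1
    have : (2 * π * x : ℂ) = ((2 * π * x : ℝ) : ℂ) := by push_cast; ring
    rw [this, Complex.norm_real]; rfl
  change ‖∫ u in Set.Ioi (0 : ℝ), e u * (F u : ℂ)‖ ≤ _
  clear_value e ω
  have hlim : Tendsto (fun u => ω⁻¹ * (e u * (F u : ℂ)) - (ω⁻¹) ^ 2 * (e u * (F1 u : ℂ))) atTop (𝓝 0) := by
    have := ((zt F ht).const_mul ω⁻¹).sub ((zt F1 ht1).const_mul (ω⁻¹ ^ 2))
    rwa [mul_zero, mul_zero, sub_zero] at this
  have key := integral_Ioi_of_hasDerivAt_of_tendsto (a := (0 : ℝ)) (m := (0 : ℂ))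
    (f := fun u => ω⁻¹ * (e u * (F u : ℂ)) - (ω⁻¹) ^ 2 * (e u * (F1 u : ℂ)))
    (f' := fun u => e u * (F u : ℂ) - (ω⁻¹) ^ 2 * (e u * (F2 u : ℂ)))
    (by
      refine ContinuousAt.continuousWithinAt ?_
      have c1 : ContinuousAt (fun u => (F u : ℂ)) 0 := Complex.continuous_ofReal.continuousAt.comp hF0
      have c2 : ContinuousAt (fun u => (F1 u : ℂ)) 0 := Complex.continuous_ofReal.continuousAt.comp hF10
      exact ((ec.continuousAt.mul c1).const_mul _).sub ((ec.continuousAt.mul c2).const_mul _))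
    (by
      intro u hu
      have h1 := ((ed u).mul (hd u hu).ofReal_comp).const_mul ω⁻¹
      have h2 := ((ed u).mul (hd1 u hu).ofReal_comp).const_mul (ω⁻¹ ^ 2)
      refine (h1.sub h2).congr_deriv ?_
      linear_combination (e u * (F u : ℂ) - ω⁻¹ * (e u * (F1 u : ℂ))) * hωi)
    (I1.sub (I2.const_mul _))
    hlim
  simp only [z0, z1] at key
  rw [integral_sub I1 (I2.const_mul _), integral_const_mul] at key
  have key2 : ∫ u in Set.Ioi (0 : ℝ), e u * (F u : ℂ) = ω⁻¹ ^ 2 * ∫ u in Set.Ioi (0 : ℝ), e u * (F2 u : ℂ) := by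
    have : (0 : ℂ) - (ω⁻¹ * (e 0 * ((0 : ℝ) : ℂ)) - ω⁻¹ ^ 2 * (e 0 * ((0 : ℝ) : ℂ))) = 0 := by simp
    rw [this] at key
    exact sub_eq_zero.1 key
  rw [key2, norm_mul, norm_pow, norm_inv]
  rw [inv_pow, hn, div_eq_inv_mul]
  refine mul_le_mul_of_nonneg_left ?_ (by positivity)
  refine (norm_integral_le_integral_norm _).trans (le_of_eq ?_)
  refine integral_congr_ae (Eventually.of_forall fun u => ?_)
  simp [en]

/-- the half-line oscillatory integral -/
def HH (r : ℝ) (n : ℕ) (x : ℝ) : ℂ :=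
  ∫ u in Set.Ioi (0 : ℝ), Complex.exp ((2 * π * (x * u)) * Complex.I) * (GG r (n + 2) u : ℂ)

lemma HH_bd {r : ℝ} (hr : 0 < r) {n : ℕ} (hn : n ≤ 2) (x : ℝ) : ‖HH r n x‖ ≤ 600 / (1 + x ^ 2) := by
  obtain ⟨i0, v0⟩ := F_int hr hn
  obtain ⟨i2, v2⟩ := F2_int hr hn
  have b0 : ‖HH r n x‖ ≤ 7 := by
    refine (norm_integral_le_integral_norm _).trans (le_trans (le_of_eq ?_) v0)
    refine integral_congr_ae (Eventually.of_forall fun u => ?_)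
    have : ((2 * π * (x * u)) * Complex.I : ℂ) = ((2 * π * (x * u) : ℝ) : ℂ) * Complex.I := by push_cast; ring
    simp only [norm_mul, this, Complex.norm_exp_ofReal_mul_I, one_mul, Complex.norm_real, Real.norm_eq_abs]
  have b2 : ‖HH r n x‖ * x ^ 2 ≤ 560 := by
    rcases eq_or_ne x 0 with rfl | hx
    · norm_num
    have h := osc_bound (F := GG r (n + 2)) (F1 := fun u => GG r (n + 1) u * q1 r n u)
      (F2 := fun u => GG r n u * q2 r n u) (GG_cont0 hr _) ((GG_cont0 hr _).mul (q1_cont0 hr _))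
      (by simp [GG]) (by simp [GG]) (fun u hu => hF1 hr hu n) (fun u hu => hF2 hr hu n)
      (tendsto_of_sq (c := 6) fun u h1 => by
        rw [abs_of_nonneg (GG_nonneg hr (zero_le_one.trans h1) _)]; exact F_big hr h1 hn)
      (tendsto_of_sq (c := 26) fun u h1 => F1_big hr h1 hn) i0 i2 hx
    have hx2 : 0 < x ^ 2 := by positivity
    change ‖HH r n x‖ ≤ _ at h
    have hpi : 1 ≤ (2 * π) ^ 2 := by nlinarith [Real.pi_gt_three]
    rw [le_div_iff₀ (by positivity)] at h
    have h4 := norm_nonneg (HH r n x)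
    have h5 : ‖HH r n x‖ * x ^ 2 * 1 ≤ ‖HH r n x‖ * x ^ 2 * (2 * π) ^ 2 :=
      mul_le_mul_of_nonneg_left hpi (by positivity)
    nlinarith
  rw [le_div_iff₀ (by positivity)]
  linarith

lemma HH_deriv {r : ℝ} (hr : 0 < r) {n : ℕ} (hn : n ≤ 1) (x : ℝ) :
    HasDerivAt (HH r n) (2 * π * Complex.I * HH r (n + 1) x) x := by
  obtain ⟨i0, v0⟩ := F_int hr (show n ≤ 2 by lia)
  obtain ⟨i1, v1⟩ := F_int hr (show n + 1 ≤ 2 by lia)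
  have en : ∀ x u : ℝ, ‖Complex.exp ((2 * π * (x * u)) * Complex.I)‖ = 1 := by
    intro x u
    have : ((2 * π * (x * u)) * Complex.I : ℂ) = ((2 * π * (x * u) : ℝ) : ℂ) * Complex.I := by push_cast; ring
    simp only [this, Complex.norm_exp_ofReal_mul_I]
  have ec : ∀ x : ℝ, Continuous fun u : ℝ => Complex.exp ((2 * π * (x * u)) * Complex.I) := by
    intro x; fun_prop
  have m0 : ∀ k, Measurable fun u => ((GG r k u : ℝ) : ℂ) := fun k =>
    Complex.measurable_ofReal.comp (GG_meas r k)
  have h := hasDerivAt_integral_of_dominated_loc_of_deriv_le (μ := volume.restrict (Set.Ioi (0 : ℝ)))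
    (F := fun (x : ℝ) u => Complex.exp ((2 * π * (x * u)) * Complex.I) * (GG r (n + 2) u : ℂ))
    (F' := fun (x : ℝ) u => 2 * π * Complex.I * (Complex.exp ((2 * π * (x * u)) * Complex.I) * (GG r (n + 1 + 2) u : ℂ)))
    (x₀ := x) (s := Set.univ) (bound := fun u => 2 * π * |GG r (n + 1 + 2) u|) Filter.univ_mem
    (Eventually.of_forall fun y => ((ec y).measurable.mul (m0 _)).aestronglyMeasurable)
    ((i0.ofReal (𝕜 := ℂ)).bdd_mul (c := 1) (ec x).aestronglyMeasurable
      (Eventually.of_forall fun u => (en x u).le))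
    (((ec x).measurable.mul (m0 _)).const_mul _).aestronglyMeasurable
    (Eventually.of_forall fun u y _ => by
      simp only [norm_mul, en, one_mul, Complex.norm_real, Complex.norm_I, mul_one, Real.norm_eq_abs]
      rw [abs_of_pos Real.pi_pos]; simp)
    (i1.abs.const_mul _)
    (Eventually.of_forall fun u y _ => by
      have h1 : HasDerivAt (fun u : ℝ => (u : ℂ)) 1 y := Complex.ofRealCLM.hasDerivAt
      have h2 := ((((h1.mul_const (u : ℂ)).const_mul (2 * π : ℂ)).mul_const Complex.I).cexp).mul_const
        (GG r (n + 2) u : ℂ)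
      refine h2.congr_deriv ?_
      have e : GG r (n + 1 + 2) u = u * GG r (n + 2) u := by unfold GG; ring
      rw [e]; push_cast; ring)
  refine h.2.congr_deriv ?_
  rw [integral_const_mul]; rfl

lemma qq_shift3 {s x y : ℝ} (hs : 0 < s) (h : |x - y| ≤ s) : qq s y ≤ 3 * qq s x := by
  unfold qq
  have hd : |(x - y) / s| ≤ 1 := by rw [abs_div, abs_of_pos hs, div_le_one hs]; exact h
  have e : x / s = y / s + (x - y) / s := by ring
  have h2 : ((x - y) / s) ^ 2 ≤ 1 := by
    have := sq_abs ((x - y) / s)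
    nlinarith [abs_nonneg ((x - y) / s)]
  have h3 : 1 + (x / s) ^ 2 ≤ 3 * (1 + (y / s) ^ 2) := by
    rw [e]; nlinarith [sq_nonneg (y / s - (x - y) / s)]
  rw [← mul_div_assoc, div_le_div_iff₀ (by positivity) (by positivity)]
  have : 0 < s⁻¹ := by positivity
  nlinarith

lemma prof_of_deriv {a a' : ℝ → ℂ} {κ s : ℝ} (hs : 0 < s) (hκ : 0 ≤ κ)
    (h : ∀ x, ‖a x‖ ≤ κ * qq s x) (hd : ∀ x, HasDerivAt a (a' x) x)
    (h' : ∀ x, ‖a' x‖ ≤ κ / s * qq s x) : Prof a (3 * κ) s := by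
  refine ⟨hs, by positivity, fun x => ?_, fun x v hv => ?_⟩
  · have := qq_nonneg hs x
    refine (h x).trans ?_
    nlinarith [mul_nonneg hκ this]
  · have hb := (convex_closedBall x s).norm_image_sub_le_of_norm_hasDerivWithin_le (f := a) (f' := a')
      (C := 3 * (κ / s * qq s x)) (x := x) (y := x - v)
      (fun y _ => (hd y).hasDerivWithinAt)
      (fun y hy => by
        refine (h' y).trans ?_
        have : |x - y| ≤ s := by
          rw [Metric.mem_closedBall, Real.dist_eq, abs_sub_comm] at hy; exact hy
        have h1 := qq_shift3 hs this
        have h2 : 0 ≤ κ / s := by positivity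
        nlinarith [mul_le_mul_of_nonneg_left h1 h2])
      (Metric.mem_closedBall_self hs.le)
      (by rw [Metric.mem_closedBall, Real.dist_eq]; simpa using hv)
    refine hb.trans (le_of_eq ?_)
    have : ‖x - v - x‖ = |v| := by rw [Real.norm_eq_abs]; simp
    rw [this]; ring

lemma prof_scale {h h' : ℝ → ℂ} {c s : ℝ} {k : ℂ} (hs : 0 < s) (hc : 0 ≤ c)
    (hb : ∀ x, ‖h x‖ ≤ c / (1 + x ^ 2)) (hd : ∀ x, HasDerivAt h (h' x) x)
    (hb' : ∀ x, ‖h' x‖ ≤ c / (1 + x ^ 2)) :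
    Prof (fun x => k * h (x / s)) (3 * (‖k‖ * c * s)) s := by
  refine prof_of_deriv (a' := fun x => k * ((s⁻¹ : ℝ) • h' (x / s))) hs (by positivity) (fun x => ?_) (fun x => ?_) (fun x => ?_)
  · rw [norm_mul]
    refine (mul_le_mul_of_nonneg_left (hb _) (norm_nonneg k)).trans (le_of_eq ?_)
    unfold qq; field_simp
  · have h1 : HasDerivAt (fun x : ℝ => x / s) s⁻¹ x := by
      simpa [div_eq_mul_inv] using (hasDerivAt_id x).mul_const s⁻¹
    exact ((hd (x / s)).scomp x h1).const_mul k
  · rw [norm_mul, norm_smul, Real.norm_eq_abs, abs_of_pos (inv_pos.2 hs)]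
    refine (mul_le_mul_of_nonneg_left (mul_le_mul_of_nonneg_left (hb' _) (inv_pos.2 hs).le) (norm_nonneg k)).trans (le_of_eq ?_)
    unfold qq; field_simp

def tt (r : ℝ) : ℝ := r ^ 2 + r ^ 3
def ww (r : ℝ) : ℝ := 2 * r + 3 * r ^ 2

lemma tt_pos {r : ℝ} (hr : 0 < r) : 0 < tt r := by unfold tt; positivity
lemma ww_pos {r : ℝ} (hr : 0 < r) : 0 < ww r := by unfold ww; positivity
lemma Yf_sq {r : ℝ} (hr : 0 < r) : Yf r ^ 2 = tt r := by
  unfold Yf tt; rw [mul_pow, Real.sq_sqrt (by positivity)]; ring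
lemma ww_tt {r : ℝ} (hr : 0 < r) : ww r / tt r ≤ 3 / r := by
  rw [div_le_div_iff₀ (tt_pos hr) hr]; unfold ww tt; nlinarith [pow_pos hr 2, pow_pos hr 3]

lemma exp_bd (x : ℝ) : (1 + x ^ 2) ^ 2 * rexp (-(π ^ 2 * x ^ 2)) ≤ 5 ∧
    (1 + x ^ 2) * (π ^ 2 * x ^ 2) * rexp (-(π ^ 2 * x ^ 2)) ≤ 3 := by
  have hpi : 1 ≤ π ^ 2 := by nlinarith [Real.pi_gt_three]
  have hx : x ^ 2 ≤ π ^ 2 * x ^ 2 := by nlinarith [sq_nonneg x]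
  have hx0 := sq_nonneg x
  set y := π ^ 2 * x ^ 2
  have hy : 0 ≤ y := hx0.trans hx
  have p0 := pow_exp_le hy 0
  have p1 := pow_exp_le hy 1
  have p2 := pow_exp_le hy 2
  norm_num [Nat.factorial] at p0 p1 p2
  have p0' : rexp (-y) ≤ 1 := Real.exp_le_one_iff.2 (by linarith)
  have e0 := Real.exp_pos (-y)
  constructor
  · calc (1 + x ^ 2) ^ 2 * rexp (-y) ≤ (1 + y) ^ 2 * rexp (-y) := by gcongr
      _ = rexp (-y) + 2 * (y * rexp (-y)) + y ^ 2 * rexp (-y) := by ring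
      _ ≤ 5 := by linarith
  · calc (1 + x ^ 2) * y * rexp (-y) ≤ (1 + y) * y * rexp (-y) := by gcongr
      _ = (y * rexp (-y)) + y ^ 2 * rexp (-y) := by ring
      _ ≤ 3 := by linarith

def g1 (x : ℝ) : ℂ := ((rexp (-(π ^ 2 * x ^ 2)) : ℝ) : ℂ)
def g1' (x : ℝ) : ℂ := ((-(2 * π ^ 2 * x) * rexp (-(π ^ 2 * x ^ 2)) : ℝ) : ℂ)
def g2 (x : ℝ) : ℂ := ((x * rexp (-(π ^ 2 * x ^ 2)) : ℝ) : ℂ)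
def g2' (x : ℝ) : ℂ := (((1 - 2 * (π ^ 2 * x ^ 2)) * rexp (-(π ^ 2 * x ^ 2)) : ℝ) : ℂ)

lemma g0_deriv (x : ℝ) : HasDerivAt (fun x : ℝ => rexp (-(π ^ 2 * x ^ 2)))
    (-(2 * π ^ 2 * x) * rexp (-(π ^ 2 * x ^ 2))) x := by
  refine (((hasDerivAt_pow 2 x).const_mul (π ^ 2)).neg.exp).congr_deriv ?_
  simp; ring

lemma g1_deriv (x : ℝ) : HasDerivAt g1 (g1' x) x := (g0_deriv x).ofReal_comp
lemma g2_deriv (x : ℝ) : HasDerivAt g2 (g2' x) x := by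
  refine HasDerivAt.ofReal_comp (f := fun x : ℝ => x * rexp (-(π ^ 2 * x ^ 2))) ?_
  refine ((hasDerivAt_id x).mul (g0_deriv x)).congr_deriv ?_
  simp; ring

lemma pi_sq_lt : π ^ 2 < 10 := by nlinarith [Real.pi_lt_d2, Real.pi_gt_three]

lemma g1_bd (x : ℝ) : ‖g1 x‖ ≤ 100 / (1 + x ^ 2) := by
  obtain ⟨h1, h2⟩ := exp_bd x
  have e0 := Real.exp_pos (-(π ^ 2 * x ^ 2))
  rw [g1, Complex.norm_real, Real.norm_eq_abs, abs_of_pos e0, le_div_iff₀ (by positivity)]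
  nlinarith [mul_nonneg (sq_nonneg x) e0.le, mul_nonneg (sq_nonneg (x ^ 2)) e0.le]

lemma aux_x (x : ℝ) : |x| * rexp (-(π ^ 2 * x ^ 2)) * (1 + x ^ 2) ≤ 5 := by
  obtain ⟨h1, h2⟩ := exp_bd x
  have e0 := Real.exp_pos (-(π ^ 2 * x ^ 2))
  have hx : |x| ≤ 1 + x ^ 2 := by
    have := sq_abs x
    nlinarith [sq_nonneg (|x| - 1)]
  calc |x| * rexp (-(π ^ 2 * x ^ 2)) * (1 + x ^ 2) ≤ (1 + x ^ 2) * rexp (-(π ^ 2 * x ^ 2)) * (1 + x ^ 2) := by gcongr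
    _ = (1 + x ^ 2) ^ 2 * rexp (-(π ^ 2 * x ^ 2)) := by ring
    _ ≤ 5 := h1

lemma g1_bd' (x : ℝ) : ‖g1' x‖ ≤ 100 / (1 + x ^ 2) := by
  have h := aux_x x
  have e0 := Real.exp_pos (-(π ^ 2 * x ^ 2))
  rw [g1', Complex.norm_real, Real.norm_eq_abs, abs_mul, abs_of_pos e0, abs_neg, abs_mul,
    abs_of_pos (by positivity : (0 : ℝ) < 2 * π ^ 2), le_div_iff₀ (by positivity)]
  have hp := pi_sq_lt
  have h0 : 0 ≤ |x| * rexp (-(π ^ 2 * x ^ 2)) * (1 + x ^ 2) := by positivity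
  calc 2 * π ^ 2 * |x| * rexp (-(π ^ 2 * x ^ 2)) * (1 + x ^ 2)
      = 2 * π ^ 2 * (|x| * rexp (-(π ^ 2 * x ^ 2)) * (1 + x ^ 2)) := by ring
    _ ≤ 2 * 10 * 5 := by gcongr
    _ = 100 := by norm_num

lemma g2_bd (x : ℝ) : ‖g2 x‖ ≤ 100 / (1 + x ^ 2) := by
  have h := aux_x x
  have e0 := Real.exp_pos (-(π ^ 2 * x ^ 2))
  rw [g2, Complex.norm_real, Real.norm_eq_abs, abs_mul, abs_of_pos e0, le_div_iff₀ (by positivity)]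
  linarith

lemma g2_bd' (x : ℝ) : ‖g2' x‖ ≤ 100 / (1 + x ^ 2) := by
  obtain ⟨h1, h2⟩ := exp_bd x
  have e0 := Real.exp_pos (-(π ^ 2 * x ^ 2))
  have h3 : |1 - 2 * (π ^ 2 * x ^ 2)| ≤ 1 + 2 * (π ^ 2 * x ^ 2) := by
    have : 0 ≤ π ^ 2 * x ^ 2 := by positivity
    rw [abs_le]; constructor <;> linarith
  rw [g2', Complex.norm_real, Real.norm_eq_abs, abs_mul, abs_of_pos e0, le_div_iff₀ (by positivity)]
  have h4 : 0 ≤ x ^ 2 * (1 + x ^ 2) * rexp (-(π ^ 2 * x ^ 2)) := by positivity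
  calc |1 - 2 * (π ^ 2 * x ^ 2)| * rexp (-(π ^ 2 * x ^ 2)) * (1 + x ^ 2)
      ≤ (1 + 2 * (π ^ 2 * x ^ 2)) * rexp (-(π ^ 2 * x ^ 2)) * (1 + x ^ 2) := by gcongr
    _ ≤ 100 := by nlinarith

/-- symmetrised kernel -/
def HS (ε : ℝ) (r : ℝ) (n : ℕ) (x : ℝ) : ℂ := HH r n x + (ε : ℂ) * HH r n (-x)

lemma HS_bd {ε r : ℝ} (hε : |ε| ≤ 1) (hr : 0 < r) {n : ℕ} (hn : n ≤ 2) (x : ℝ) :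
    ‖HS ε r n x‖ ≤ 1200 / (1 + x ^ 2) := by
  have h1 := HH_bd hr hn x
  have h2 := HH_bd hr hn (-x)
  rw [neg_sq] at h2
  refine (norm_add_le _ _).trans ?_
  rw [norm_mul, Complex.norm_real, Real.norm_eq_abs]
  have : |ε| * ‖HH r n (-x)‖ ≤ 1 * ‖HH r n (-x)‖ := by gcongr
  have e : 1200 / (1 + x ^ 2) = 600 / (1 + x ^ 2) + 600 / (1 + x ^ 2) := by ring
  rw [e]; linarith

lemma HS_deriv {ε r : ℝ} (hr : 0 < r) {n : ℕ} (hn : n ≤ 1) (x : ℝ) :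
    HasDerivAt (HS ε r n) (2 * π * Complex.I * HS (-ε) r (n + 1) x) x := by
  have h1 := HH_deriv hr hn x
  have h2 := ((HH_deriv hr hn (-x)).scomp x (hasDerivAt_neg x)).const_mul (ε : ℂ)
  refine (h1.add h2).congr_deriv ?_
  simp only [HS]
  push_cast
  simp
  ring

lemma HS_bd' {ε r : ℝ} (hε : |ε| ≤ 1) (hr : 0 < r) {n : ℕ} (hn : n ≤ 1) (x : ℝ) :
    ‖2 * π * Complex.I * HS (-ε) r (n + 1) x‖ ≤ 8400 / (1 + x ^ 2) := by
  have h := HS_bd (ε := -ε) (by rwa [abs_neg]) hr (show n + 1 ≤ 2 by lia) x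
  rw [norm_mul]
  have e : ‖(2 * π * Complex.I : ℂ)‖ ≤ 7 := by
    simp only [norm_mul, Complex.norm_I, Complex.norm_real, Real.norm_eq_abs, abs_of_pos Real.pi_pos]
    have := Real.pi_lt_d2
    norm_num at this ⊢
    linarith
  calc _ ≤ 7 * (1200 / (1 + x ^ 2)) := mul_le_mul e h (norm_nonneg _) (by norm_num)
    _ = 8400 / (1 + x ^ 2) := by ring

lemma HS_prof {ε r : ℝ} (hε : |ε| ≤ 1) (hr : 0 < r) {n : ℕ} (hn : n ≤ 1) (k : ℂ) :
    Prof (fun x => k * HS ε r n (x / r)) (3 * (‖k‖ * 8400 * r)) r := by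
  refine prof_scale hr (by norm_num) (fun x => ?_) (fun x => HS_deriv hr hn x) (fun x => HS_bd' hε hr hn x)
  refine (HS_bd hε hr (by lia) x).trans ?_
  gcongr; norm_num

lemma HH_meas (n : ℕ) : Measurable fun q : ℝ × ℝ => HH q.1 n q.2 := by
  have : StronglyMeasurable fun q : (ℝ × ℝ) × ℝ =>
      Complex.exp ((2 * π * (q.1.2 * q.2)) * Complex.I) * (GG q.1.1 (n + 2) q.2 : ℂ) := by
    refine Measurable.stronglyMeasurable ?_
    refine Measurable.mul (by fun_prop) ?_
    exact Complex.measurable_ofReal.comp ((GG_meas2 (n + 2)).comp (by fun_prop : Measurable fun q : (ℝ × ℝ) × ℝ => (q.1.1, q.2)))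
  exact (this.integral_prod_right (ν := volume.restrict (Set.Ioi (0 : ℝ)))).measurable

lemma HS_meas (ε : ℝ) (n : ℕ) : Measurable fun q : ℝ × ℝ => HS ε q.1 n (q.2 / q.1) := by
  unfold HS
  refine ((HH_meas n).comp (by fun_prop : Measurable fun q : ℝ × ℝ => (q.1, q.2 / q.1))).add ?_
  exact ((HH_meas n).comp (by fun_prop : Measurable fun q : ℝ × ℝ => (q.1, -(q.2 / q.1)))).const_mul _

def ka1 (r : ℝ) : ℝ := ww r * (1 / tt r / r)
def ka2 (r : ℝ) : ℝ := ww r * (r / tt r / r)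
def kb1 (r : ℝ) : ℝ := √π / Yf r
def kb2 (r : ℝ) : ℝ := π * √π / Yf r ^ 2
def a1 (r x : ℝ) : ℂ := (ka1 r : ℂ) * HS (-1) r 1 (x / r)
def a2 (r x : ℝ) : ℂ := (ka2 r : ℂ) * HS 1 r 0 (x / r)
def b1 (r y : ℝ) : ℂ := (kb1 r : ℂ) * g1 (y / Yf r)
def b2 (r y : ℝ) : ℂ := ((kb2 r : ℂ) * Complex.I) * g2 (y / Yf r)

lemma sqrt_pi_le : √π ≤ 2 := by
  rw [Real.sqrt_le_left (by norm_num)]; linarith [Real.pi_lt_d2]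

lemma fam1 : Fam a1 b1 (3 * 8400 * (3 * 100 * 2) * 3) := by
  refine ⟨?_, ?_, by norm_num, fun r hr => ?_⟩
  · unfold a1
    refine Measurable.mul ?_ (HS_meas _ _)
    unfold ka1 ww tt; fun_prop
  · unfold b1 kb1 g1 Yf; fun_prop
  · have hY := Yf_pos hr
    refine ⟨_, _, HS_prof (by norm_num) hr (by norm_num) _,
      prof_scale hY (by norm_num) g1_bd g1_deriv g1_bd', ?_⟩
    rw [Complex.norm_real, Complex.norm_real, Real.norm_eq_abs, Real.norm_eq_abs]
    have ht := tt_pos hr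
    have hw := ww_pos hr
    have k1 : |ka1 r| * r = ww r / tt r := by
      rw [abs_of_pos (by unfold ka1; positivity)]; unfold ka1; field_simp
    have k2 : |kb1 r| * Yf r = √π := by
      rw [abs_of_pos (by unfold kb1; positivity)]; unfold kb1; field_simp
    calc 3 * (|ka1 r| * 8400 * r) * (3 * (|kb1 r| * 100 * Yf r))
        = 3 * 8400 * (3 * 100 * (|kb1 r| * Yf r)) * (|ka1 r| * r) := by ring
      _ ≤ 3 * 8400 * (3 * 100 * 2) * (3 / r) := by
          rw [k1, k2]
          have := ww_tt hr
          have := sqrt_pi_le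
          gcongr
      _ = _ := by ring

lemma fam2 : Fam a2 b2 (3 * 8400 * (3 * 100 * 8) * 3) := by
  refine ⟨?_, ?_, by norm_num, fun r hr => ?_⟩
  · unfold a2
    refine Measurable.mul ?_ (HS_meas _ _)
    unfold ka2 ww tt; fun_prop
  · unfold b2 kb2 g2 Yf; fun_prop
  · have hY := Yf_pos hr
    refine ⟨_, _, HS_prof (by norm_num) hr (by norm_num) _,
      prof_scale hY (by norm_num) g2_bd g2_deriv g2_bd', ?_⟩
    rw [norm_mul, Complex.norm_I, mul_one, Complex.norm_real, Complex.norm_real, Real.norm_eq_abs, Real.norm_eq_abs]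
    have ht := tt_pos hr
    have hw := ww_pos hr
    have k1 : |ka2 r| * r = (ww r / tt r) * r := by
      rw [abs_of_pos (by unfold ka2; positivity)]; unfold ka2; field_simp
    have k2 : |kb2 r| * Yf r = π * √π / Yf r := by
      rw [abs_of_pos (by unfold kb2; positivity)]; unfold kb2; field_simp
    have hpp : π * √π ≤ 8 := by
      have := sqrt_pi_le
      have := Real.pi_lt_d2
      calc π * √π ≤ 4 * 2 := by gcongr; linarith
        _ = 8 := by norm_num
    have hrY : r ≤ Yf r := le_Yf hr
    calc 3 * (|ka2 r| * 8400 * r) * (3 * (|kb2 r| * 100 * Yf r))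
        = 3 * 8400 * (3 * 100 * (|kb2 r| * Yf r)) * (|ka2 r| * r) := by ring
      _ ≤ 3 * 8400 * (3 * 100 * (8 / r)) * ((3 / r) * r) := by
          rw [k1, k2]
          have := ww_tt hr
          gcongr
      _ = _ := by field_simp

def Sr (σ A : ℝ → ℝ) (r ξ : ℝ) : ℝ := σ ξ * rexp (-(tt r * A ξ))
def Tr (τ : ℝ → ℝ) (r η : ℝ) : ℝ := τ η * rexp (-(tt r * η ^ 2))

structure SymD (σ τ A : ℝ → ℝ) (a b : ℝ → ℝ → ℂ) : Prop where
  σm : Measurable σ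
  τm : Measurable τ
  Am : Measurable A
  A_nonneg : ∀ ξ, 0 ≤ A ξ
  A_even : ∀ ξ, A (-ξ) = A ξ
  odd : ∀ ξ η, σ (-ξ) * τ (-η) = -(σ ξ * τ η)
  bound : ∀ ξ η, |σ ξ * τ η| ≤ A ξ + η ^ 2
  hS : ∀ r, 0 < r → Integrable (Sr σ A r)
  hT : ∀ r, 0 < r → Integrable (Tr τ r)
  ha : ∀ r, 0 < r → ∀ x, a r x = ww r * ∫ ξ : ℝ, Complex.exp ((2 * π * (x * ξ)) * Complex.I) * (Sr σ A r ξ : ℂ)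
  hb : ∀ r, 0 < r → ∀ x, b r x = ∫ ξ : ℝ, Complex.exp ((2 * π * (x * ξ)) * Complex.I) * (Tr τ r ξ : ℂ)

def mm (σ τ A : ℝ → ℝ) (ζ : ℝ × ℝ) : ℝ := σ ζ.1 * τ ζ.2 / (A ζ.1 + ζ.2 ^ 2)
def ex (A : ℝ → ℝ) (r : ℝ) (ζ : ℝ × ℝ) : ℝ := rexp (-(tt r * (A ζ.1 + ζ.2 ^ 2)))
def MM (σ τ A : ℝ → ℝ) (α β : ℝ) (ζ : ℝ × ℝ) : ℂ := ((mm σ τ A ζ * (ex A α ζ - ex A β ζ) : ℝ) : ℂ)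

lemma tt_mono {α r : ℝ} (hα : 0 ≤ α) (h : α ≤ r) : tt α ≤ tt r := by unfold tt; gcongr
lemma tt_deriv (r : ℝ) : HasDerivAt tt (ww r) r := by
  refine ((hasDerivAt_pow 2 r).add (hasDerivAt_pow 3 r)).congr_deriv ?_
  unfold ww; norm_num

variable {σ τ A : ℝ → ℝ} {a b : ℝ → ℝ → ℂ}

lemma SymD.D_nonneg (h : SymD σ τ A a b) (ζ : ℝ × ℝ) : 0 ≤ A ζ.1 + ζ.2 ^ 2 := by
  have := h.A_nonneg ζ.1
  positivity

lemma SymD.mm_mul (h : SymD σ τ A a b) (ζ : ℝ × ℝ) : mm σ τ A ζ * (A ζ.1 + ζ.2 ^ 2) = σ ζ.1 * τ ζ.2 := by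
  unfold mm
  rcases eq_or_ne (A ζ.1 + ζ.2 ^ 2) 0 with h0 | h0
  · have := h.bound ζ.1 ζ.2
    rw [h0] at this
    rw [h0, mul_zero, abs_eq_zero.1 (le_antisymm this (abs_nonneg _))]
  · field_simp

lemma SymD.mm_le (h : SymD σ τ A a b) (ζ : ℝ × ℝ) : |mm σ τ A ζ| ≤ 1 := by
  have hD := h.D_nonneg ζ
  unfold mm
  rw [abs_div, abs_of_nonneg hD]
  exact div_le_one_of_le₀ (h.bound _ _) hD

lemma SymD.ex_diff (h : SymD σ τ A a b) {α β : ℝ} (hα : 0 < α) (hab : α ≤ β) (ζ : ℝ × ℝ) :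
    |ex A α ζ - ex A β ζ| ≤ 1 := by
  have hD := h.D_nonneg ζ
  have ht := tt_mono hα.le hab
  have h0 := tt_pos hα
  have h1 : ex A α ζ ≤ 1 := Real.exp_le_one_iff.2 (by nlinarith)
  have h2 : 0 < ex A β ζ := Real.exp_pos _
  have h3 : ex A β ζ ≤ ex A α ζ := Real.exp_le_exp.2 (by nlinarith)
  rw [abs_le]; constructor <;> linarith

lemma SymD.MM_le_mm (h : SymD σ τ A a b) {α β : ℝ} (hα : 0 < α) (hab : α ≤ β) (ζ : ℝ × ℝ) :
    ‖MM σ τ A α β ζ‖ ≤ |mm σ τ A ζ| := by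
  rw [MM, Complex.norm_real, Real.norm_eq_abs, abs_mul]
  exact mul_le_of_le_one_right (abs_nonneg _) (h.ex_diff hα hab ζ)

lemma SymD.MM_odd (h : SymD σ τ A a b) (α β : ℝ) (ζ : ℝ × ℝ) : MM σ τ A α β (-ζ) = - MM σ τ A α β ζ := by
  simp only [MM, mm, ex, Prod.fst_neg, Prod.snd_neg, h.odd, h.A_even, neg_sq]
  push_cast; ring

def PP (σ τ A : ℝ → ℝ) (ζ : ℝ × ℝ) (r : ℝ) : ℝ := ww r * (Sr σ A r ζ.1 * Tr τ r ζ.2)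

lemma PP_cont (ζ : ℝ × ℝ) : Continuous (PP σ τ A ζ) := by
  unfold PP Sr Tr ww tt; fun_prop

lemma SymD.MM_eq (h : SymD σ τ A a b) {α β : ℝ} (hab : α ≤ β) (ζ : ℝ × ℝ) :
    MM σ τ A α β ζ = ∫ r in Set.Ioc α β, ((PP σ τ A ζ r : ℝ) : ℂ) := by
  rw [integral_complex_ofReal, MM]
  congr 1
  rw [← intervalIntegral.integral_of_le hab]
  rw [intervalIntegral.integral_eq_sub_of_hasDerivAt (f := fun r => -(mm σ τ A ζ * ex A r ζ)) (f' := PP σ τ A ζ)]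
  · ring
  · intro r _
    have h1 := (((tt_deriv r).mul_const (A ζ.1 + ζ.2 ^ 2)).neg.exp.const_mul (mm σ τ A ζ)).neg
    refine h1.congr_deriv ?_
    have h2 := h.mm_mul ζ
    have e : rexp (-(tt r * (A ζ.1 + ζ.2 ^ 2))) = rexp (-(tt r * A ζ.1)) * rexp (-(tt r * ζ.2 ^ 2)) := by
      rw [← Real.exp_add]; congr 1; ring
    simp only [PP, Sr, Tr, Pi.neg_apply]
    rw [e]
    linear_combination (ww r * (rexp (-(tt r * A ζ.1)) * rexp (-(tt r * ζ.2 ^ 2)))) * h2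
  · exact (PP_cont ζ).intervalIntegrable _ _

lemma SymD.PP_meas (h : SymD σ τ A a b) : Measurable fun q : (ℝ × ℝ) × ℝ => PP σ τ A q.1 q.2 := by
  have h1 := h.σm
  have h2 := h.τm
  have h3 := h.Am
  unfold PP Sr Tr ww tt; fun_prop

lemma SymD.PP_int (h : SymD σ τ A a b) {α β : ℝ} (hα : 0 < α) :
    Integrable (fun q : (ℝ × ℝ) × ℝ => ((PP σ τ A q.1 q.2 : ℝ) : ℂ))
      ((volume : Measure (ℝ × ℝ)).prod (volume.restrict (Set.Ioc α β))) := by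
  have hc : Integrable (fun _ : ℝ => ww β) (volume.restrict (Set.Ioc α β)) := by
    exact integrable_const _
  have hdom := ((h.hS α hα).mul_prod (h.hT α hα)).mul_prod hc
  refine Integrable.mono' hdom.norm (Complex.measurable_ofReal.comp h.PP_meas).aestronglyMeasurable ?_
  have em : ((volume : Measure (ℝ × ℝ)).prod ((volume : Measure ℝ).restrict (Set.Ioc α β))) =
      ((volume : Measure (ℝ × ℝ)).prod (volume : Measure ℝ)).restrict (Set.univ ×ˢ Set.Ioc α β) := by
    rw [← Measure.prod_restrict, Measure.restrict_univ]
  rw [em, ae_restrict_iff' (MeasurableSet.univ.prod measurableSet_Ioc)]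
  refine Eventually.of_forall fun q hq => ?_
  have hq2 : q.2 ∈ Set.Ioc α β := hq.2
  have hr : 0 < q.2 := hα.trans hq2.1
  have ht := tt_mono hα.le hq2.1.le
  have hw : ww q.2 ≤ ww β := by
    have := hq2.2
    unfold ww; gcongr
  have hA := h.A_nonneg q.1.1
  have w0 := ww_pos hr
  rw [Complex.norm_real, PP]
  simp only [Real.norm_eq_abs, abs_mul, Sr, Tr, Real.abs_exp]
  rw [abs_of_pos w0, abs_of_pos (w0.trans_le hw)]
  rw [mul_comm]
  gcongr

lemma SymD.MM_int (h : SymD σ τ A a b) {α β : ℝ} (hα : 0 < α) (hab : α ≤ β) :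
    Integrable (MM σ τ A α β) := by
  refine (h.PP_int (β := β) hα).integral_prod_left.congr (Eventually.of_forall fun ζ => ?_)
  exact (h.MM_eq hab ζ).symm

lemma SymD.invFT_MM (h : SymD σ τ A a b) {α β : ℝ} (hα : 0 < α) (hab : α ≤ β) :
    invFT (MM σ τ A α β) = Kfam a b α β := by
  funext z
  rw [invFT_eq]
  unfold Kfam
  have hIntg : Integrable (Function.uncurry fun (ζ : ℝ × ℝ) (r : ℝ) => ek z ζ * ((PP σ τ A ζ r : ℝ) : ℂ))
      ((volume : Measure (ℝ × ℝ)).prod (volume.restrict (Set.Ioc α β))) := by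
    refine (h.PP_int hα).bdd_mul (c := 1) ?_ (Eventually.of_forall fun q => (ek_norm _ _).le)
    exact ((ek_cont_right z).comp continuous_fst).aestronglyMeasurable
  calc ∫ ζ, ek z ζ * MM σ τ A α β ζ
      = ∫ ζ, ∫ r in Set.Ioc α β, ek z ζ * ((PP σ τ A ζ r : ℝ) : ℂ) := by
        congr 1; ext ζ
        rw [h.MM_eq hab ζ, integral_const_mul]
    _ = ∫ r in Set.Ioc α β, ∫ ζ, ek z ζ * ((PP σ τ A ζ r : ℝ) : ℂ) := integral_integral_swap hIntg
    _ = _ := by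
        refine setIntegral_congr_fun measurableSet_Ioc fun r hr => ?_
        have hr0 : 0 < r := hα.trans hr.1
        rw [h.ha r hr0, h.hb r hr0, mul_assoc, ← integral_prod_mul, ← integral_const_mul]
        congr 1; ext ζ
        simp only [PP, ek]
        rw [mul_add, add_mul, Complex.exp_add]; push_cast; ring

lemma SymD.ker (h : SymD σ τ A a b) {C : ℝ} (hF : Fam a b C) {α β : ℝ} (hα : 0 < α) (hab : α ≤ β) :
    KerOK (Kfam a b α β) ∧ (∀ z, Kfam a b α β (-z) = - Kfam a b α β z) ∧
    (∀ f : ℝ × ℝ → ℂ, Integrable f → ∫⁻ z, ‖Tc (Kfam a b α β) f z‖ₑ ^ 2 ≤ ∫⁻ z, ‖f z‖ₑ ^ 2) := by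
  have hM := h.MM_int hα hab
  have hc : Continuous (Kfam a b α β) := by rw [← h.invFT_MM hα hab]; exact invFT_continuous hM
  refine ⟨⟨hc, hF.int_K hα hc.aestronglyMeasurable, ?_⟩, ?_, ?_⟩
  · rw [← h.invFT_MM hα hab]; exact ⟨_, invFT_norm_le _⟩
  · intro z
    rw [← h.invFT_MM hα hab, invFT_eq, invFT_eq, ← integral_neg, ← integral_neg_eq_self]
    congr 1; ext ζ
    rw [h.MM_odd, ek_neg_left, neg_neg]; ring
  · intro f hf
    rw [← h.invFT_MM hα hab]
    exact Tc_L2 hM (fun ζ => (h.MM_le_mm hα hab ζ).trans (h.mm_le ζ)) hf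

lemma SymD.MM_lim (h : SymD σ τ A a b) (ζ : ℝ × ℝ) :
    Tendsto (fun N : ℕ => MM σ τ A (1 / ((N : ℝ) + 1)) ((N : ℝ) + 1) ζ) atTop (𝓝 (mm σ τ A ζ : ℂ)) := by
  refine (Complex.continuous_ofReal.tendsto _).comp ?_
  have hD := h.D_nonneg ζ
  have t1 : Tendsto (fun N : ℕ => tt (1 / ((N : ℝ) + 1))) atTop (𝓝 0) := by
    have h0 : Tendsto (fun N : ℕ => 1 / ((N : ℝ) + 1)) atTop (𝓝 0) := tendsto_one_div_add_atTop_nhds_zero_nat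
    have : Tendsto tt (𝓝 0) (𝓝 (tt 0)) := by
      have : Continuous tt := by unfold tt; fun_prop
      exact this.tendsto 0
    have e : tt 0 = 0 := by unfold tt; norm_num
    rw [e] at this
    exact this.comp h0
  have t2 : Tendsto (fun N : ℕ => tt ((N : ℝ) + 1)) atTop atTop := by
    refine tendsto_atTop_mono (f := fun N : ℕ => (N : ℝ)) (fun N => ?_) tendsto_natCast_atTop_atTop
    have : (0 : ℝ) ≤ N := by positivity
    unfold tt; nlinarith [pow_nonneg this 2, pow_nonneg this 3]
  rcases hD.eq_or_lt with h0 | h0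
  · have : mm σ τ A ζ = 0 := by unfold mm; rw [← h0]; simp
    simp [this]
  · have e1 : Tendsto (fun N : ℕ => ex A (1 / ((N : ℝ) + 1)) ζ) atTop (𝓝 1) := by
      have := (Real.continuous_exp.tendsto _).comp (t1.mul_const (A ζ.1 + ζ.2 ^ 2)).neg
      simpa [Function.comp_def, ex] using this
    have e2 : Tendsto (fun N : ℕ => ex A ((N : ℝ) + 1) ζ) atTop (𝓝 0) := by
      refine Real.tendsto_exp_atBot.comp ?_
      exact tendsto_neg_atTop_atBot.comp (t2.atTop_mul_const h0)
    simpa using (e1.sub e2).const_mul (mm σ τ A ζ)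

theorem SymD.main (h : SymD σ τ A a b) {C : ℝ} (hF : Fam a b C) {p : ℝ} (hp : 1 < p) :
    ∃ C' : ℝ≥0∞, C' ≠ ∞ ∧ ∀ f : ℝ × ℝ → ℂ, Continuous f → Integrable f →
      ∫⁻ z, ‖invFT (fun ζ => (mm σ τ A ζ : ℂ) * FT f ζ) z‖ₑ ^ p ≤ C' * ∫⁻ z, ‖f z‖ₑ ^ p := by
  obtain ⟨C', hC', hcz⟩ := cz_main hp (B := ENNReal.ofReal C * (16 * ENNReal.ofReal π + 2 * ENNReal.ofReal (π * π)))
    (by finiteness)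
  refine ⟨C', hC', fun f hfc hf => ?_⟩
  have hp0 : 0 < p := by linarith
  by_cases hi : Integrable (fun ζ => (mm σ τ A ζ : ℂ) * FT f ζ)
  swap
  · have : ∀ z, invFT (fun ζ => (mm σ τ A ζ : ℂ) * FT f ζ) z = 0 := by
      intro z
      rw [invFT_eq]
      exact integral_undef (fun hh => hi ((integrable_ek_mul_iff z).1 hh))
    simp [this, hp0]
  have hα : ∀ N : ℕ, (0 : ℝ) < 1 / ((N : ℝ) + 1) := fun N => by positivity
  have hab : ∀ N : ℕ, 1 / ((N : ℝ) + 1) ≤ (N : ℝ) + 1 := fun N => by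
    have : (0 : ℝ) ≤ N := by positivity
    rw [div_le_iff₀ (by positivity)]; nlinarith
  set K : ℕ → ℝ × ℝ → ℂ := fun N => Kfam a b (1 / ((N : ℝ) + 1)) ((N : ℝ) + 1) with hK
  have hk := fun N => h.ker hF (hα N) (hab N)
  have hbd : ∀ N, ∫⁻ z, ‖Tc (K N) f z‖ₑ ^ p ≤ C' * ∫⁻ z, ‖f z‖ₑ ^ p := fun N =>
    hcz (K N) (hk N).1 (hF.horm (hα N)) (hk N).2.1 (hk N).2.2 f hfc hf
  have hlim : ∀ z, Tendsto (fun N => Tc (K N) f z) atTop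
      (𝓝 (invFT (fun ζ => (mm σ τ A ζ : ℂ) * FT f ζ) z)) := by
    intro z
    have e : ∀ N, Tc (K N) f z = ∫ ζ, ek z ζ * (MM σ τ A (1 / ((N : ℝ) + 1)) ((N : ℝ) + 1) ζ * FT f ζ) := by
      intro N
      rw [hK]; simp only
      rw [← h.invFT_MM (hα N) (hab N), Tc_eq (h.MM_int (hα N) (hab N)) hf, invFT_eq]
    simp only [e]
    rw [invFT_eq]
    refine tendsto_integral_of_dominated_convergence (fun ζ => ‖(mm σ τ A ζ : ℂ) * FT f ζ‖) ?_ hi.norm ?_ ?_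
    · intro N
      exact (integrable_ek_mul (mul_FT_integrable (h.MM_int (hα N) (hab N)) hf) z).aestronglyMeasurable
    · intro N
      refine Eventually.of_forall fun ζ => ?_
      rw [norm_mul, ek_norm, one_mul, norm_mul, norm_mul, Complex.norm_real]
      exact mul_le_mul_of_nonneg_right (h.MM_le_mm (hα N) (hab N) ζ) (norm_nonneg _)
    · refine Eventually.of_forall fun ζ => ?_
      exact ((h.MM_lim ζ).mul_const _).const_mul _
  have hlim2 : ∀ z, ‖invFT (fun ζ => (mm σ τ A ζ : ℂ) * FT f ζ) z‖ₑ ^ p =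
      liminf (fun N => ‖Tc (K N) f z‖ₑ ^ p) atTop := by
    intro z
    refine (Tendsto.liminf_eq ?_).symm
    exact (ENNReal.continuous_rpow_const.tendsto _).comp ((continuous_enorm.tendsto _).comp (hlim z))
  calc ∫⁻ z, ‖invFT (fun ζ => (mm σ τ A ζ : ℂ) * FT f ζ) z‖ₑ ^ p
      = ∫⁻ z, liminf (fun N => ‖Tc (K N) f z‖ₑ ^ p) atTop := lintegral_congr hlim2
    _ ≤ liminf (fun N => ∫⁻ z, ‖Tc (K N) f z‖ₑ ^ p) atTop := by
        refine lintegral_liminf_le fun N => ?_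
        exact ((hk N).1.Tc_cont hf).measurable.enorm.pow_const p
    _ ≤ C' * ∫⁻ z, ‖f z‖ₑ ^ p := by
        refine (liminf_le_liminf (v := fun _ => C' * ∫⁻ z, ‖f z‖ₑ ^ p) (Eventually.of_forall hbd)).trans ?_
        simp

/-- one dimensional character -/
def e1 (x ξ : ℝ) : ℂ := Complex.exp ((2 * π * (x * ξ)) * Complex.I)

lemma e1_norm (x ξ : ℝ) : ‖e1 x ξ‖ = 1 := by
  have : ((2 * π * (x * ξ)) * Complex.I : ℂ) = ((2 * π * (x * ξ) : ℝ) : ℂ) * Complex.I := by push_cast; ring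
  rw [e1, this, Complex.norm_exp_ofReal_mul_I]

lemma e1_cont (x : ℝ) : Continuous (e1 x) := by unfold e1; fun_prop

lemma e1_int {S : ℝ → ℝ} (hS : Integrable S) (x : ℝ) : Integrable fun ξ => e1 x ξ * (S ξ : ℂ) :=
  (hS.ofReal (𝕜 := ℂ)).bdd_mul (c := 1) (e1_cont x).aestronglyMeasurable
    (Eventually.of_forall fun u => (e1_norm x u).le)

lemma line_int {S : ℝ → ℝ} {r c ε : ℝ} {n : ℕ} (hr : 0 < r) (hn : n ≤ 2)
    (h1 : ∀ ξ, 0 < ξ → S ξ = c * GG r (n + 2) (r * ξ)) (h2 : ∀ ξ, S (-ξ) = ε * S ξ) :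
    Integrable S ∧ ∀ x, ∫ ξ, e1 x ξ * (S ξ : ℂ) = ((c / r : ℝ) : ℂ) * HS ε r n (x / r) := by
  set U : ℝ → ℝ := (Set.Ioi (0 : ℝ)).indicator (fun ξ => c * GG r (n + 2) (r * ξ)) with hU
  have hUi : Integrable U := by
    rw [hU, integrable_indicator_iff measurableSet_Ioi]
    have := (integrableOn_Ioi_comp_mul_left_iff (GG r (n + 2)) 0 hr).2 (by rw [mul_zero]; exact (F_int hr hn).1)
    exact this.const_mul c
  have hSU : ∀ᵐ ξ : ℝ, S ξ = U ξ + ε * U (-ξ) := by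
    filter_upwards [Measure.ae_ne volume (0 : ℝ)] with ξ hξ
    rcases lt_or_gt_of_ne hξ with h0 | h0
    · have a1 : U ξ = 0 := Set.indicator_of_notMem (by simp [h0.le]) _
      have a2 : U (-ξ) = c * GG r (n + 2) (r * -ξ) := Set.indicator_of_mem (by simpa using h0) _
      rw [a1, a2, ← h1 (-ξ) (by linarith), ← h2, neg_neg, zero_add]
    · have a1 : U (-ξ) = 0 := Set.indicator_of_notMem (by simp [h0.le]) _
      have a2 : U ξ = c * GG r (n + 2) (r * ξ) := Set.indicator_of_mem (by simpa using h0) _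
      rw [a1, a2, ← h1 ξ h0, mul_zero, add_zero]
  have hUn : Integrable fun ξ => U (-ξ) := hUi.comp_neg
  have hJ : ∀ x, ∫ ξ, e1 x ξ * (U ξ : ℂ) = ((c / r : ℝ) : ℂ) * HH r n (x / r) := by
    intro x
    have q1 : ∀ ξ, e1 x ξ * (U ξ : ℂ) = (Set.Ioi (0 : ℝ)).indicator
        (fun ξ => (c : ℂ) * (e1 (x / r) (r * ξ) * (GG r (n + 2) (r * ξ) : ℂ))) ξ := by
      intro ξ
      by_cases hξ : ξ ∈ Set.Ioi (0 : ℝ)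
      · rw [hU, Set.indicator_of_mem hξ, Set.indicator_of_mem hξ]
        have : e1 (x / r) (r * ξ) = e1 x ξ := by
          unfold e1; congr 3; push_cast
          have : (r : ℂ) ≠ 0 := by exact_mod_cast hr.ne'
          field_simp
        rw [this]; push_cast; ring
      · rw [hU, Set.indicator_of_notMem hξ, Set.indicator_of_notMem hξ]; simp
    simp only [q1]
    rw [integral_indicator measurableSet_Ioi, integral_const_mul,
      integral_comp_mul_left_Ioi (fun u => e1 (x / r) u * (GG r (n + 2) u : ℂ)) 0 hr, mul_zero]
    have : HH r n (x / r) = ∫ u in Set.Ioi (0 : ℝ), e1 (x / r) u * (GG r (n + 2) u : ℂ) := rfl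
    rw [← this, Complex.real_smul]; push_cast; ring
  refine ⟨(hUi.add (hUn.const_mul ε)).congr (hSU.mono fun ξ h => h.symm), fun x => ?_⟩
  have hJn : ∫ ξ, e1 x ξ * (U (-ξ) : ℂ) = ((c / r : ℝ) : ℂ) * HH r n (-(x / r)) := by
    rw [← integral_neg_eq_self, ← neg_div, ← hJ]
    congr 1; ext ξ
    rw [neg_neg]; congr 1
    unfold e1; push_cast; congr 1; ring
  calc ∫ ξ, e1 x ξ * (S ξ : ℂ) = ∫ ξ, (e1 x ξ * (U ξ : ℂ) + ε * (e1 x ξ * (U (-ξ) : ℂ))) := by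
        refine integral_congr_ae (hSU.mono fun ξ h => ?_)
        simp only [h]; push_cast; ring
    _ = _ := by
        rw [integral_add (e1_int hUi x) ((e1_int hUn x).const_mul _), integral_const_mul, hJ, hJn, HS]
        ring

def A0 (ξ : ℝ) : ℝ := |ξ| ^ 3 / (1 + |ξ|)
def s1 (ξ : ℝ) : ℝ := ξ ^ 3 / (1 + |ξ|)
def s2 (ξ : ℝ) : ℝ := ξ ^ 2 / (1 + |ξ|)

lemma tA {r ξ : ℝ} (hr : 0 < r) (hξ : 0 < ξ) : tt r * A0 ξ = EE r (r * ξ) := by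
  unfold tt A0 EE rho; rw [abs_of_pos hξ]; field_simp

lemma Sr1_eq {r ξ : ℝ} (hr : 0 < r) (hξ : 0 < ξ) : Sr s1 A0 r ξ = 1 / tt r * GG r (1 + 2) (r * ξ) := by
  unfold Sr GG; rw [tA hr hξ, ← mul_assoc]; congr 1
  unfold s1 tt rho; rw [abs_of_pos hξ]; field_simp; ring

lemma Sr2_eq {r ξ : ℝ} (hr : 0 < r) (hξ : 0 < ξ) : Sr s2 A0 r ξ = r / tt r * GG r (0 + 2) (r * ξ) := by
  unfold Sr GG; rw [tA hr hξ, ← mul_assoc]; congr 1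
  unfold s2 tt rho; rw [abs_of_pos hξ]; field_simp; ring

lemma Sr1_neg (r ξ : ℝ) : Sr s1 A0 r (-ξ) = (-1) * Sr s1 A0 r ξ := by
  unfold Sr s1 A0; rw [abs_neg]; ring
lemma Sr2_neg (r ξ : ℝ) : Sr s2 A0 r (-ξ) = 1 * Sr s2 A0 r ξ := by
  unfold Sr s2 A0; rw [abs_neg]; ring

lemma gauss_int {t : ℝ} (ht : 0 < t) : Integrable (fun η : ℝ => rexp (-(t * η ^ 2))) ∧
    Integrable (fun η : ℝ => η * rexp (-(t * η ^ 2))) := by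
  have h1 := integrable_exp_neg_mul_sq ht
  have h2 := integrable_mul_exp_neg_mul_sq ht
  simp only [neg_mul] at h1 h2
  exact ⟨h1, h2⟩

lemma gauss_mul {t : ℝ} (ht : 0 < t) (y : ℝ) :
    ∫ η : ℝ, e1 y η * ((η * rexp (-(t * η ^ 2)) : ℝ) : ℂ) =
      (π * y / t * Complex.I) * ((√(π / t) * rexp (-(π ^ 2 * y ^ 2 / t)) : ℝ) : ℂ) := by
  obtain ⟨i1, i2⟩ := gauss_int ht
  have h0 := integral_eq_zero_of_hasDerivAt_of_integrable
    (f := fun η : ℝ => e1 y η * ((rexp (-(t * η ^ 2)) : ℝ) : ℂ))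
    (f' := fun η : ℝ => (2 * π * y * Complex.I) * (e1 y η * ((rexp (-(t * η ^ 2)) : ℝ) : ℂ)) -
      (2 * t) * (e1 y η * ((η * rexp (-(t * η ^ 2)) : ℝ) : ℂ)))
    (fun η => by
      have h1 : HasDerivAt (fun u : ℝ => (u : ℂ)) 1 η := Complex.ofRealCLM.hasDerivAt
      have h2 : HasDerivAt (e1 y) _ η := (((h1.const_mul (y : ℂ)).const_mul (2 * π : ℂ)).mul_const Complex.I).cexp
      have h3 : HasDerivAt (fun η : ℝ => rexp (-(t * η ^ 2))) _ η :=
        ((hasDerivAt_pow 2 η).const_mul t).neg.exp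
      refine (h2.mul h3.ofReal_comp).congr_deriv ?_
      simp only [e1, Pi.neg_apply]
      push_cast
      ring)
    (((e1_int i1 y).const_mul _).sub ((e1_int i2 y).const_mul _)) (e1_int i1 y)
  rw [integral_sub ((e1_int i1 y).const_mul _) ((e1_int i2 y).const_mul _), integral_const_mul,
    integral_const_mul] at h0
  have hg := gauss1 ht y
  change ∫ η, e1 y η * ((rexp (-(t * η ^ 2)) : ℝ) : ℂ) = _ at hg
  rw [hg] at h0
  have ht' : (t : ℂ) ≠ 0 := by exact_mod_cast ht.ne'
  have h4 := sub_eq_zero.1 h0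
  generalize ((√(π / t) * rexp (-(π ^ 2 * y ^ 2 / t)) : ℝ) : ℂ) = G at h4 ⊢
  generalize (∫ η : ℝ, e1 y η * ((η * rexp (-(t * η ^ 2)) : ℝ) : ℂ)) = J at h4 ⊢
  field_simp
  linear_combination (-(1 / 2 : ℂ)) * h4

lemma A0_nonneg (ξ : ℝ) : 0 ≤ A0 ξ := by unfold A0; positivity

lemma sqrt_tt {r : ℝ} (hr : 0 < r) : √(π / tt r) = √π / Yf r := by
  rw [← Yf_sq hr, Real.sqrt_div Real.pi_pos.le, Real.sqrt_sq (Yf_pos hr).le]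

lemma sym1 : SymD s1 (fun _ => 1) A0 a1 b1 where
  σm := by unfold s1; fun_prop
  τm := by fun_prop
  Am := by unfold A0; fun_prop
  A_nonneg := A0_nonneg
  A_even ξ := by unfold A0; rw [abs_neg]
  odd ξ η := by unfold s1; rw [abs_neg]; ring
  bound ξ η := by
    have : |s1 ξ * 1| = A0 ξ := by
      unfold s1 A0
      rw [mul_one, abs_div, abs_pow, abs_of_pos (by positivity : 0 < 1 + |ξ|)]
    rw [this]; nlinarith [sq_nonneg η]
  hS r hr := (line_int hr (by norm_num) (fun ξ h => Sr1_eq hr h) (Sr1_neg r)).1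
  hT r hr := by
    have := (gauss_int (tt_pos hr)).1
    unfold Tr; simpa using this
  ha r hr x := by
    have := (line_int hr (by norm_num) (fun ξ h => Sr1_eq hr h) (Sr1_neg r)).2 x
    simp only [e1] at this
    rw [this, a1, ka1]; push_cast; ring
  hb r hr x := by
    have := gauss1 (tt_pos hr) x
    simp only [Tr, one_mul]
    rw [this, b1, kb1, g1, sqrt_tt hr, ← Yf_sq hr]; push_cast
    congr 3
    rw [div_pow]; ring

lemma sym2 : SymD s2 (fun η => η) A0 a2 b2 where
  σm := by unfold s2; fun_prop
  τm := by fun_prop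
  Am := by unfold A0; fun_prop
  A_nonneg := A0_nonneg
  A_even ξ := by unfold A0; rw [abs_neg]
  odd ξ η := by unfold s2; rw [abs_neg]; ring
  bound ξ η := by
    unfold s2 A0
    have hp : 0 < 1 + |ξ| := by positivity
    have e : |ξ ^ 2 / (1 + |ξ|) * η| = |ξ| ^ 2 * |η| / (1 + |ξ|) := by
      rw [abs_mul, abs_div, abs_pow, abs_of_pos hp]; ring
    have e2 : |ξ| ^ 3 / (1 + |ξ|) + η ^ 2 = (|ξ| ^ 3 + |ξ| * |η| ^ 2 + |η| ^ 2) / (1 + |ξ|) := by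
      rw [sq_abs]; field_simp; ring
    rw [e, e2]
    have h1 := abs_nonneg ξ
    have h2 := abs_nonneg η
    gcongr
    nlinarith [mul_nonneg h1 (sq_nonneg (|ξ| - |η|)), mul_nonneg (mul_nonneg h1 h1) h2, sq_nonneg (|η|)]
  hS r hr := (line_int hr (by norm_num) (fun ξ h => Sr2_eq hr h) (Sr2_neg r)).1
  hT r hr := (gauss_int (tt_pos hr)).2
  ha r hr x := by
    have := (line_int hr (by norm_num) (fun ξ h => Sr2_eq hr h) (Sr2_neg r)).2 x
    simp only [e1] at this
    rw [this, a2, ka2]; push_cast; ring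
  hb r hr x := by
    have := gauss_mul (tt_pos hr) x
    simp only [e1] at this
    simp only [Tr]
    rw [this, b2, kb2, g2, sqrt_tt hr, ← Yf_sq hr]
    have e : -(π ^ 2 * x ^ 2 / Yf r ^ 2) = -(π ^ 2 * (x / Yf r) ^ 2) := by rw [div_pow]; ring
    rw [e]
    push_cast
    ring

lemma mm1 (ζ : ℝ × ℝ) : mm s1 (fun _ => 1) A0 ζ = m₁ ζ := by
  unfold mm s1 A0 m₁
  have hp : 1 + |ζ.1| ≠ 0 := by positivity
  have e : |ζ.1| ^ 3 / (1 + |ζ.1|) + ζ.2 ^ 2 = (|ζ.1| ^ 3 + |ζ.1| * ζ.2 ^ 2 + ζ.2 ^ 2) / (1 + |ζ.1|) := by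
    field_simp; ring
  rw [e, mul_one, div_div_div_cancel_right₀ hp]

lemma mm2 (ζ : ℝ × ℝ) : mm s2 (fun η => η) A0 ζ = m₂ ζ := by
  unfold mm s2 A0 m₂
  have hp : 1 + |ζ.1| ≠ 0 := by positivity
  have e : |ζ.1| ^ 3 / (1 + |ζ.1|) + ζ.2 ^ 2 = (|ζ.1| ^ 3 + |ζ.1| * ζ.2 ^ 2 + ζ.2 ^ 2) / (1 + |ζ.1|) := by
    field_simp; ring
  rw [e, div_mul_eq_mul_div, div_div_div_cancel_right₀ hp]

lemma eLp_of_lint {g f : ℝ × ℝ → ℂ} {p : ℝ} (hp : 1 < p) {C : ℝ≥0∞}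
    (h : ∫⁻ z, ‖g z‖ₑ ^ p ≤ C * ∫⁻ z, ‖f z‖ₑ ^ p) :
    eLpNorm g (ENNReal.ofReal p) volume ≤ C ^ (1 / p) * eLpNorm f (ENNReal.ofReal p) volume := by
  have hp0 : 0 < p := by linarith
  have h0 : ENNReal.ofReal p ≠ 0 := by simpa using hp0
  rw [eLpNorm_eq_lintegral_rpow_enorm_toReal h0 ENNReal.ofReal_ne_top,
    eLpNorm_eq_lintegral_rpow_enorm_toReal h0 ENNReal.ofReal_ne_top, ENNReal.toReal_ofReal hp0.le,
    ← ENNReal.mul_rpow_of_nonneg _ _ (by positivity)]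
  exact ENNReal.rpow_le_rpow h (by positivity)

/-- (Lizorkin-type multipliers.) For every `1 < p < ∞` there is `C_p`
such that for every Schwartz `f` on `ℝ²` and `i ∈ {1,2}`, the function `gᵢ` whose
Fourier transform is `mᵢ · f̂` satisfies `‖gᵢ‖_{L^p} ≤ C_p ‖f‖_{L^p}`. -/
theorem lizorkin_multipliers (p : ℝ) (hp1 : 1 < p) :
    ∃ C : ℝ, 0 < C ∧ ∀ f : 𝓢(ℝ × ℝ, ℂ),
      eLpNorm (invFT fun ξ => (m₁ ξ : ℂ) * FT (⇑f) ξ) (ENNReal.ofReal p)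
          (volume : Measure (ℝ × ℝ)) ≤
        ENNReal.ofReal C * eLpNorm (⇑f) (ENNReal.ofReal p) (volume : Measure (ℝ × ℝ)) ∧
      eLpNorm (invFT fun ξ => (m₂ ξ : ℂ) * FT (⇑f) ξ) (ENNReal.ofReal p)
          (volume : Measure (ℝ × ℝ)) ≤
        ENNReal.ofReal C * eLpNorm (⇑f) (ENNReal.ofReal p) (volume : Measure (ℝ × ℝ)) := by
  obtain ⟨C₁, hC₁, h1⟩ := sym1.main fam1 hp1
  obtain ⟨C₂, hC₂, h2⟩ := sym2.main fam2 hp1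
  simp only [mm1] at h1
  simp only [mm2] at h2
  have hp0 : 0 ≤ 1 / p := by have : 0 < p := by linarith
                             positivity
  have f1 : C₁ ^ (1 / p) ≠ ∞ := ENNReal.rpow_ne_top_of_nonneg hp0 hC₁
  have f2 : C₂ ^ (1 / p) ≠ ∞ := ENNReal.rpow_ne_top_of_nonneg hp0 hC₂
  refine ⟨(C₁ ^ (1 / p)).toReal + (C₂ ^ (1 / p)).toReal + 1, by positivity, fun f => ⟨?_, ?_⟩⟩
  · refine (eLp_of_lint hp1 (h1 f f.continuous f.integrable)).trans ?_
    gcongr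
    refine ENNReal.le_ofReal_iff_toReal_le f1 (by positivity) |>.2 ?_
    have : 0 ≤ (C₂ ^ (1 / p)).toReal := ENNReal.toReal_nonneg
    linarith
  · refine (eLp_of_lint hp1 (h2 f f.continuous f.integrable)).trans ?_
    gcongr
    refine ENNReal.le_ofReal_iff_toReal_le f2 (by positivity) |>.2 ?_
    have : 0 ≤ (C₁ ^ (1 / p)).toReal := ENNReal.toReal_nonneg
    linarith
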